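/- arXiv:1106.6262 — 3 statements merged into one kernel-verified Lean document; each statement's English description precedes it below -/
import Mathlib

section
/- Let q̃ be the largest q ∈ (0,1) such that every complex zero of u ↦ Ψ(q,u) is real, and let ũ be the unique real number that is a double root of u ↦ Ψ(q̃,u). For i ≥ 2 let ζ_i denote the unique double root of the reverted polynomial P_i (which has all roots real and negative, exactly one of them double), and set P̃_i(x) = P_i(−ζ_i·x)/P_i(0). Then for every real x, P̃_i(x) → Ψ(q̃, −ũ·x) as i → ∞. -/
open Polynomial Filter

/-- A real polynomial is hyperbolic if all of its complex roots are real. -/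
def Hyperbolic (P : Polynomial ℝ) : Prop :=
  ∀ z : ℂ, Polynomial.aeval z P = 0 → z.im = 0

/-- The coefficients of the extremal series: `A_0 = A_1 = 1` and `A_{n+2}` is the largest
(here: supremum of) positive `t` such that `p_{n+1}(x) + t x^{n+2}` is hyperbolic, where
`p_{n+1}(x) = Σ_{j=0}^{n+1} A_j x^j`. -/
noncomputable def Acoef : ℕ → ℝ
  | 0 => 1
  | 1 => 1
  | n + 2 =>
    sSup {t : ℝ | 0 < t ∧ Hyperbolic
      ((∑ j ∈ (Finset.range (n + 2)).attach, Polynomial.C (Acoef j.1) * Polynomial.X ^ (j.1 : ℕ)) +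
        Polynomial.C t * Polynomial.X ^ (n + 2))}
decreasing_by
  exact Finset.mem_range.mp j.2

/-- The reverted polynomial `P_n(x) = x^n p_n(1/x) = Σ_{j=0}^n A_{n-j} x^j`. -/
noncomputable def Prev (n : ℕ) : Polynomial ℝ :=
  ∑ j ∈ Finset.range (n + 1), Polynomial.C (Acoef (n - j)) * Polynomial.X ^ j

/-- The partial theta function `Ψ(q,u) = Σ_{j≥0} q^{j(j+1)/2} u^j`, for real `q` and
complex `u`. -/
noncomputable def PsiC (q : ℝ) (u : ℂ) : ℂ :=
  ∑' j : ℕ, (q : ℂ) ^ (j * (j + 1) / 2) * u ^ j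

/-- The partial theta function for real arguments. -/
noncomputable def PsiR (q u : ℝ) : ℝ :=
  ∑' j : ℕ, q ^ (j * (j + 1) / 2) * u ^ j

/-- An entire function with `f 0 = 1` is a finite product of its zero factors in a disc times an
entire function without zeros there, bounded by the maximum of `f` on a larger circle. -/
theorem exists_factorization_zeros {f : ℂ → ℂ} (hf : Differentiable ℂ f) (h0 : f 0 = 1)
    {R : ℝ} (hR : 0 < R) :
    ∃ (Z : Multiset ℂ) (F : ℂ → ℂ), Differentiable ℂ F ∧ (∀ y ∈ Z, y ≠ 0 ∧ f y⁻¹ = 0) ∧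
      (∀ s, f s = (Z.map fun y => 1 - s * y).prod * F s) ∧ F 0 = 1 ∧
      (∀ s, ‖s‖ ≤ R → F s ≠ 0) ∧
      ∀ M, (∀ s, ‖s‖ = 3 * R → ‖f s‖ ≤ M) → ∀ s, ‖s‖ ≤ 3 * R → ‖F s‖ ≤ M := by
  let Good : Multiset ℂ → (ℂ → ℂ) → Prop := fun Z F =>
    Differentiable ℂ F ∧ (∀ y ∈ Z, R⁻¹ ≤ ‖y‖ ∧ f y⁻¹ = 0) ∧
      ∀ s, f s = (Z.map fun y => 1 - s * y).prod * F s
  have hF0 : ∀ Z F, Good Z F → F 0 = 1 := by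
    rintro Z F ⟨-, -, h⟩
    have := h 0
    simpa [h0] using this.symm
  have hprod : ∀ Z : Multiset ℂ, (∀ y ∈ Z, R⁻¹ ≤ ‖y‖) → ∀ s : ℂ, ‖s‖ = 3 * R →
      2 ^ (Multiset.card Z) ≤ ‖(Z.map fun y => 1 - s * y).prod‖ := by
    intro Z
    induction Z using Multiset.induction_on with
    | empty => simp
    | cons a Z ih =>
      intro hZ s hs
      have h1 := ih (fun y hy => hZ y (Multiset.mem_cons_of_mem hy)) s hs
      have h2 : 2 ≤ ‖1 - s * a‖ := by
        have h3 : R⁻¹ ≤ ‖a‖ := hZ a (Multiset.mem_cons_self a Z)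
        have h4 : 3 ≤ ‖s * a‖ := by
          rw [norm_mul, hs]
          calc (3 : ℝ) = 3 * R * R⁻¹ := by field_simp
            _ ≤ _ := by gcongr
        have h5 := norm_sub_norm_le (s * a) 1
        rw [norm_sub_rev, norm_one] at h5
        linarith
      rw [Multiset.map_cons, Multiset.prod_cons, Multiset.card_cons, norm_mul, pow_succ']
      gcongr
  have hmax : ∀ Z F, Good Z F → ∀ M, (∀ s, ‖s‖ = 3 * R → ‖f s‖ ≤ M) →
      ∀ s, ‖s‖ ≤ 3 * R → ‖F s‖ ≤ M / 2 ^ (Multiset.card Z) := by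
    rintro Z F ⟨hF, hZ, hfac⟩ M hM s hs
    refine Complex.norm_le_of_forall_mem_frontier_norm_le (U := Metric.ball 0 (3 * R))
      Metric.isBounded_ball hF.diffContOnCl ?_ ?_
    · intro w hw
      rw [frontier_ball _ (by positivity), mem_sphere_zero_iff_norm] at hw
      have h1 := hprod Z (fun y hy => (hZ y hy).1) w hw
      have h2 := hM w hw
      rw [hfac, norm_mul] at h2
      rw [le_div_iff₀ (by positivity)]
      nlinarith [norm_nonneg (F w)]
    · rw [closure_ball _ (by positivity)]
      simpa using hs
  obtain ⟨M, hM⟩ : ∃ M, ∀ s, ‖s‖ = 3 * R → ‖f s‖ ≤ M := by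
    obtain ⟨M, hM⟩ := (isCompact_sphere (0 : ℂ) (3 * R)).exists_bound_of_continuousOn
      hf.continuous.continuousOn
    exact ⟨M, fun s hs => hM s (by simpa using hs)⟩
  have hcard : ∀ Z F, Good Z F → (Multiset.card Z : ℝ) ≤ M := by
    intro Z F h
    have h1 := hmax Z F h M hM 0 (by simp; positivity)
    rw [hF0 Z F h, norm_one, le_div_iff₀ (by positivity), one_mul] at h1
    have h2 : (Multiset.card Z : ℝ) < 2 ^ (Multiset.card Z) := by
      exact_mod_cast Nat.lt_two_pow_self
    linarith
  let S : Set ℕ := {n | ∃ Z F, Good Z F ∧ Multiset.card Z = n}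
  have hSne : S.Nonempty := ⟨0, 0, f, ⟨hf, by simp, by simp⟩, rfl⟩
  have hSb : BddAbove S := by
    refine ⟨⌈M⌉₊, ?_⟩
    rintro _ ⟨Z, F, h, rfl⟩
    exact_mod_cast (hcard Z F h).trans (Nat.le_ceil M)
  obtain ⟨Z, F, hG, hc⟩ := Nat.sSup_mem hSne hSb
  obtain ⟨hF, hZ, hfac⟩ := hG
  refine ⟨Z, F, hF, fun y hy => ⟨?_, (hZ y hy).2⟩, hfac, hF0 Z F ⟨hF, hZ, hfac⟩, ?_, ?_⟩
  · rintro rfl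
    have := (hZ 0 hy).1
    rw [norm_zero] at this
    exact absurd (inv_pos.mpr hR) (not_lt.mpr this)
  · intro s hs hFs
    have hs0 : s ≠ 0 := by
      rintro rfl
      rw [hF0 Z F ⟨hF, hZ, hfac⟩] at hFs
      exact one_ne_zero hFs
    have hG' : Good (s⁻¹ ::ₘ Z) (fun w => - s * dslope F s w) := by
      refine ⟨?_, ?_, ?_⟩
      · have : Differentiable ℂ (dslope F s) := by
          rw [← differentiableOn_univ, Complex.differentiableOn_dslope Filter.univ_mem]
          exact hF.differentiableOn
        exact (differentiable_const _).mul this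
      · intro y hy
        rcases Multiset.mem_cons.mp hy with rfl | hy
        · refine ⟨?_, by rw [inv_inv, hfac, hFs, mul_zero]⟩
          rw [norm_inv]
          exact inv_anti₀ (norm_pos_iff.mpr hs0) hs
        · exact hZ y hy
      · intro w
        have h1 := sub_smul_dslope F s w
        rw [hFs, sub_zero, smul_eq_mul] at h1
        rw [hfac w, Multiset.map_cons, Multiset.prod_cons, ← h1]
        field_simp
        ring
    have : Multiset.card Z + 1 ≤ sSup S := le_csSup hSb ⟨_, _, hG', by simp⟩
    omega
  · intro M' hM' s hs
    refine (hmax Z F ⟨hF, hZ, hfac⟩ M' hM' s hs).trans ?_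
    have h0M : 0 ≤ M' := (norm_nonneg _).trans (hM' (3 * R : ℝ) (by
      rw [Complex.norm_real, Real.norm_of_nonneg (by positivity)]))
    exact div_le_self h0M (one_le_pow₀ one_le_two)

theorem norm_exp_sub_one_le_exp_norm_sub_one (z : ℂ) :
    ‖Complex.exp z - 1‖ ≤ Real.exp ‖z‖ - 1 := by
  simpa using Complex.norm_exp_sub_sum_le_exp_norm_sub_sum z 1

/-- A zero-free function on a large disc with moderate growth is close to `1` on the unit disc. -/
theorem norm_inv_sub_one_le_of_forall_ne_zero {F : ℂ → ℂ} (hF : Differentiable ℂ F) (h0 : F 0 = 1)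
    {R K : ℝ} (hR : 1 < R) (hK : 0 < K) (hne : ∀ s, ‖s‖ ≤ R → F s ≠ 0)
    (hb : ∀ s, ‖s‖ ≤ R → ‖F s‖ ≤ Real.exp K) {s : ℂ} (hs : ‖s‖ ≤ 1) :
    ‖(F s)⁻¹ - 1‖ ≤ Real.exp (2 * K / (R - 1)) - 1 := by
  have hmem : ∀ w ∈ Metric.ball (0 : ℂ) R, ‖w‖ ≤ R := fun w hw => by
    simpa using (Metric.mem_ball.mp hw).le
  have hd : DifferentiableOn ℂ (fun w => deriv F w / F w) (Metric.ball 0 R) :=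
    (hF.contDiff (n := 2)).differentiable_deriv_two.differentiableOn.div hF.differentiableOn
      fun w hw => hne w (hmem w hw)
  obtain ⟨l, hl0, hl⟩ := hd.isExactOn_ball.with_val_at 0 0
  have hexp : ∀ w ∈ Metric.ball (0 : ℂ) R, F w = Complex.exp (l w) := by
    have hder : ∀ w ∈ Metric.ball (0 : ℂ) R,
        HasDerivAt (fun w => F w * Complex.exp (-l w)) 0 w := by
      intro w hw
      have h1 := (hF w).hasDerivAt.mul (hl w hw).neg.cexp
      refine h1.congr_deriv ?_
      have := hne w (hmem w hw)
      simp only [Pi.neg_apply]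
      field_simp
      ring
    intro w hw
    have hconst := (convex_ball (0 : ℂ) R).is_const_of_fderivWithin_eq_zero (𝕜 := ℂ)
      (f := fun w => F w * Complex.exp (-l w))
      (fun w hw => (hder w hw).differentiableAt.differentiableWithinAt)
      (fun w hw => by
        rw [fderivWithin_of_isOpen Metric.isOpen_ball hw]
        ext
        simp [(hder w hw).deriv])
      hw (Metric.mem_ball_self (by linarith))
    simp only [h0, hl0, neg_zero, Complex.exp_zero, mul_one] at hconst
    rw [Complex.exp_neg] at hconst
    exact (mul_inv_eq_one₀ (Complex.exp_ne_zero _)).mp hconst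
  have hsb : s ∈ Metric.ball (0 : ℂ) R := by simpa using hs.trans_lt hR
  have hBC := Complex.borelCaratheodory_zero (f := l) hK
    (fun w hw => (hl w hw).differentiableAt.differentiableWithinAt)
    (fun w hw => by
      have := hb w (hmem w hw)
      rw [hexp w hw, Complex.norm_exp] at this
      exact Real.exp_le_exp.mp this) (by linarith) hsb hl0
  rw [hexp s hsb, ← Complex.exp_neg]
  refine (norm_exp_sub_one_le_exp_norm_sub_one _).trans ?_
  rw [norm_neg]
  gcongr
  refine hBC.trans ?_
  rw [div_le_div_iff₀ (by linarith) (by linarith)]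
  have : 0 ≤ ‖s‖ := norm_nonneg s
  nlinarith [mul_nonneg hK.le (sub_nonneg.mpr hs),
    mul_nonneg (mul_nonneg hK.le (sub_nonneg.mpr hs)) (by linarith : (0 : ℝ) ≤ R)]

/-- An entire function of exponential type zero with `f 0 = 1` is, on the unit disc, a uniform
limit of products of its zero factors. -/
theorem exists_multiset_norm_sub_prod_le {f : ℂ → ℂ} (hf : Differentiable ℂ f) (h0 : f 0 = 1)
    (hgrowth : ∀ ε > 0, ∃ C, ∀ s, ‖f s‖ ≤ C * Real.exp (ε * ‖s‖)) {δ : ℝ} (hδ : 0 < δ) :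
    ∃ Z : Multiset ℂ, (∀ y ∈ Z, y ≠ 0 ∧ f y⁻¹ = 0) ∧
      ∀ s, ‖s‖ ≤ 1 → ‖(Z.map fun y => 1 - s * y).prod - f s‖ ≤ δ := by
  obtain ⟨M, hM⟩ := (isCompact_closedBall (0 : ℂ) 1).exists_bound_of_continuousOn
      hf.continuous.continuousOn
  have hM1 : 1 ≤ M := by simpa [h0] using hM 0 (by simp)
  obtain ⟨η, hη, hηδ⟩ : ∃ η > 0, Real.exp η - 1 ≤ δ / M := by
    refine ⟨Real.log (1 + δ / M), Real.log_pos (by simp; positivity), ?_⟩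
    rw [Real.exp_log (by positivity)]
    linarith
  obtain ⟨C, hC⟩ := hgrowth (η / 24) (by positivity)
  have hC1 : 1 ≤ C := by simpa [h0] using hC 0
  obtain ⟨R, hR2, hRC⟩ : ∃ R : ℝ, 2 ≤ R ∧ 8 * Real.log C + 8 ≤ η * R := by
    refine ⟨max 2 ((8 * Real.log C + 8) / η), le_max_left _ _, ?_⟩
    have := le_max_right 2 ((8 * Real.log C + 8) / η)
    rw [div_le_iff₀ hη] at this
    linarith
  obtain ⟨Z, F, hF, hZ, hfac, hF0, hFne, hFb⟩ :=
    exists_factorization_zeros hf h0 (R := R) (by linarith)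
  refine ⟨Z, hZ, fun s hs => ?_⟩
  have hlog : 0 ≤ Real.log C := Real.log_nonneg hC1
  set K := Real.log C + 1 + η * R / 8 with hKdef
  have hKpos : 0 < K := by
    have : 0 ≤ η * R := by nlinarith
    rw [hKdef]; linarith
  have hb : ∀ s, ‖s‖ ≤ 3 * R → ‖F s‖ ≤ Real.exp K := by
    refine hFb _ fun w hw => (hC w).trans ?_
    rw [hw, hKdef]
    calc C * Real.exp (η / 24 * (3 * R)) = Real.exp (Real.log C + η / 24 * (3 * R)) := by
          rw [Real.exp_add, Real.exp_log (by linarith)]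
      _ ≤ _ := by
          rw [Real.exp_le_exp]
          linarith
  have h1 := norm_inv_sub_one_le_of_forall_ne_zero hF hF0 (R := R) (by linarith) hKpos hFne
    (fun s hs => hb s (by linarith)) hs
  have h2 : 2 * K / (R - 1) ≤ η := by
    rw [div_le_iff₀ (by linarith), hKdef]
    nlinarith
  have h3 : ‖(F s)⁻¹ - 1‖ ≤ δ / M :=
    h1.trans ((sub_le_sub_right (Real.exp_le_exp.mpr h2) 1).trans hηδ)
  have hFs := hFne s (by linarith)
  have h4 : (Z.map fun y => 1 - s * y).prod - f s = f s * ((F s)⁻¹ - 1) := by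
    rw [hfac s]
    field_simp
  rw [h4, norm_mul]
  calc ‖f s‖ * ‖(F s)⁻¹ - 1‖ ≤ M * (δ / M) := by
        gcongr
        exact hM s (by simpa using hs)
    _ = δ := by field_simp

/-- Coefficients of an entire function of exponential type zero. -/
def SubexpCoeff (c : ℕ → ℝ) : Prop :=
  ∀ ε > 0, ∃ C, ∀ j, |c j| ≤ C * (ε ^ j / j.factorial)

/-- The sum of the power series with real coefficients `c` at a complex point. -/
noncomputable def seriesC (c : ℕ → ℝ) (s : ℂ) : ℂ := ∑' j, (c j : ℂ) * s ^ j

theorem SubexpCoeff.summable_abs {c : ℕ → ℝ} (hc : SubexpCoeff c) (r : ℝ) :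
    Summable fun j => |c j| * |r| ^ j := by
  obtain ⟨C, hC⟩ := hc 1 one_pos
  refine Summable.of_nonneg_of_le (fun j => by positivity) (fun j => ?_)
    ((Real.summable_pow_div_factorial |r|).mul_left C)
  calc |c j| * |r| ^ j ≤ C * (1 ^ j / j.factorial) * |r| ^ j := by gcongr; exact hC j
    _ = C * (|r| ^ j / j.factorial) := by rw [one_pow]; ring

theorem SubexpCoeff.summable_norm {c : ℕ → ℝ} (hc : SubexpCoeff c) (s : ℂ) :
    Summable fun j => ‖(c j : ℂ) * s ^ j‖ := by
  simpa using hc.summable_abs ‖s‖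

theorem SubexpCoeff.norm_seriesC_le {c : ℕ → ℝ} (hc : SubexpCoeff c) :
    ∀ ε > 0, ∃ C, ∀ s, ‖seriesC c s‖ ≤ C * Real.exp (ε * ‖s‖) := by
  intro ε hε
  obtain ⟨C, hC⟩ := hc ε hε
  refine ⟨C, fun s => ?_⟩
  have h1 : HasSum (fun j : ℕ => C * ((ε * ‖s‖) ^ j / j.factorial)) (C * Real.exp (ε * ‖s‖)) := by
    rw [Real.exp_eq_exp_ℝ]
    exact (NormedSpace.exp_series_hasSum_exp' (𝕂 := ℝ) (ε * ‖s‖)).mul_left C |>.congr_fun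
      (fun j => by rw [smul_eq_mul]; ring)
  refine tsum_of_norm_bounded h1 fun j => ?_
  rw [norm_mul, norm_pow, Complex.norm_real, Real.norm_eq_abs]
  calc |c j| * ‖s‖ ^ j ≤ C * (ε ^ j / j.factorial) * ‖s‖ ^ j := by gcongr; exact hC j
    _ = _ := by rw [mul_pow]; ring

theorem SubexpCoeff.hasFPowerSeriesOnBall {c : ℕ → ℝ} (hc : SubexpCoeff c) :
    HasFPowerSeriesOnBall (seriesC c)
      (FormalMultilinearSeries.ofScalars ℂ fun j => (c j : ℂ)) 0 ⊤ where
  r_le := by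
    rw [FormalMultilinearSeries.radius_eq_top_of_summable_norm]
    intro r
    simpa using hc.summable_abs r
  r_pos := ENNReal.zero_lt_top
  hasSum := by
    intro y _
    have := (hc.summable_norm y).of_norm.hasSum
    simpa [FormalMultilinearSeries.ofScalars_apply_eq, seriesC, mul_comm] using this

theorem SubexpCoeff.differentiable {c : ℕ → ℝ} (hc : SubexpCoeff c) :
    Differentiable ℂ (seriesC c) := by
  rw [← differentiableOn_univ]
  simpa using hc.hasFPowerSeriesOnBall.differentiableOn

theorem SubexpCoeff.abs_le {c : ℕ → ℝ} (hc : SubexpCoeff c) {δ : ℝ}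
    (h : ∀ s, ‖s‖ ≤ 1 → ‖seriesC c s‖ ≤ δ) (k : ℕ) : |c k| ≤ δ := by
  have h1 := Complex.norm_iteratedDeriv_le_of_forall_mem_sphere_norm_le (c := 0) (C := δ) k one_pos
    hc.differentiable.diffContOnCl fun z hz => h z (by simpa using hz.le)
  have h2 := hc.hasFPowerSeriesOnBall.factorial_smul 1 k
  rw [← iteratedDeriv_eq_iteratedFDeriv] at h2
  rw [← h2] at h1
  simp only [FormalMultilinearSeries.ofScalars_apply_eq, one_pow, smul_eq_mul, mul_one, div_one,
    nsmul_eq_mul, norm_mul, Complex.norm_natCast, Complex.norm_real, Real.norm_eq_abs] at h1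
  exact le_of_mul_le_mul_left h1 (by positivity)

theorem SubexpCoeff.sub {c d : ℕ → ℝ} (hc : SubexpCoeff c) (hd : SubexpCoeff d) :
    SubexpCoeff fun j => c j - d j := by
  intro ε hε
  obtain ⟨C, hC⟩ := hc ε hε
  obtain ⟨D, hD⟩ := hd ε hε
  refine ⟨C + D, fun j => (abs_sub _ _).trans ?_⟩
  rw [add_mul]
  exact add_le_add (hC j) (hD j)

theorem subexpCoeff_polynomial (p : ℝ[X]) : SubexpCoeff p.coeff := by
  intro ε hε
  refine ⟨∑ j ∈ p.support, |p.coeff j| * (ε ^ j / j.factorial)⁻¹, fun j => ?_⟩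
  by_cases hj : j ∈ p.support
  · rw [← div_le_iff₀ (by positivity), div_eq_mul_inv]
    exact Finset.single_le_sum (f := fun j => |p.coeff j| * (ε ^ j / (j.factorial : ℝ))⁻¹)
      (fun i _ => by positivity) hj
  · rw [notMem_support_iff.mp hj, abs_zero]
    exact mul_nonneg (Finset.sum_nonneg fun i _ => by positivity) (by positivity)

theorem seriesC_polynomial (p : ℝ[X]) (s : ℂ) : seriesC p.coeff s = aeval s p := by
  rw [aeval_eq_sum_range, seriesC, tsum_eq_sum (s := Finset.range (p.natDegree + 1))]
  · simp [Algebra.smul_def]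
  · intro j hj
    rw [coeff_eq_zero_of_natDegree_lt (by simpa [Nat.lt_succ_iff] using hj)]
    simp

/-- The polynomial `∏ (1 - y X)` over a multiset of reals. -/
noncomputable def zeroProd (Y : Multiset ℝ) : ℝ[X] := (Y.map fun y => 1 - C y * X).prod

/-- The coefficients of an entire function of exponential type zero all of whose zeros are real
and positive are approximated by those of the products over its zeros. -/
theorem exists_zeroProd_coeff_approx {c : ℕ → ℝ} (hc : SubexpCoeff c) (h0 : c 0 = 1)
    (hreal : ∀ s, seriesC c s = 0 → s.im = 0) (hpos : ∀ s : ℝ, seriesC c s = 0 → 0 < s)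
    {δ : ℝ} (hδ : 0 < δ) :
    ∃ Y : Multiset ℝ, (∀ y ∈ Y, 0 < y ∧ seriesC c (y⁻¹ : ℝ) = 0) ∧
      ∀ k, |(zeroProd Y).coeff k - c k| ≤ δ := by
  have hs0 : seriesC c 0 = 1 := by
    rw [seriesC, tsum_eq_single 0 (fun j hj => by simp [hj])]
    simp [h0]
  obtain ⟨Z, hZ, happrox⟩ :=
    exists_multiset_norm_sub_prod_le hc.differentiable hs0 hc.norm_seriesC_le hδ
  have hre : ∀ y ∈ Z, ((y.re : ℝ) : ℂ) = y := by
    intro y hy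
    have h1 := hreal _ (hZ y hy).2
    refine Complex.ext rfl ?_
    rw [Complex.inv_im, div_eq_zero_iff] at h1
    rcases h1 with h1 | h1
    · simpa [eq_comm] using h1
    · exact absurd (Complex.normSq_eq_zero.mp h1) (hZ y hy).1
  refine ⟨Z.map Complex.re, ?_, fun k => ?_⟩
  · intro y hy
    obtain ⟨w, hw, rfl⟩ := Multiset.mem_map.mp hy
    have h1 : seriesC c ((w.re⁻¹ : ℝ) : ℂ) = 0 := by
      rw [Complex.ofReal_inv, hre w hw]
      exact (hZ w hw).2
    exact ⟨inv_pos.mp (hpos _ h1), h1⟩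
  · refine ((subexpCoeff_polynomial _).sub hc).abs_le (δ := δ) (fun s hs => ?_) k
    have h1 : seriesC (fun j => (zeroProd (Z.map Complex.re)).coeff j - c j) s
        = (Z.map fun y => 1 - s * y).prod - seriesC c s := by
      have h2 : aeval s (zeroProd (Z.map Complex.re)) = (Z.map fun y => 1 - s * y).prod := by
        rw [zeroProd, map_multiset_prod, Multiset.map_map, Multiset.map_map]
        congr 1
        refine Multiset.map_congr rfl fun y hy => ?_
        simp [hre y hy, mul_comm s]
      rw [← h2, ← seriesC_polynomial, seriesC, seriesC, seriesC, ← Summable.tsum_sub]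
      · congr 1
        ext j
        push_cast
        ring
      · exact ((subexpCoeff_polynomial _).summable_norm s).of_norm
      · exact (hc.summable_norm s).of_norm
    rw [h1]
    exact happrox s hs

theorem zeroProd_coeff (Y : Multiset ℝ) : (zeroProd Y).coeff 0 = 1 ∧
    Y.sum = -(zeroProd Y).coeff 1 ∧
    (Y.map fun y => y ^ 2).sum = (zeroProd Y).coeff 1 ^ 2 - 2 * (zeroProd Y).coeff 2 ∧
    (Y.map fun y => y ^ 3).sum = -(zeroProd Y).coeff 1 ^ 3
      + 3 * (zeroProd Y).coeff 1 * (zeroProd Y).coeff 2 - 3 * (zeroProd Y).coeff 3 := by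
  induction Y using Multiset.induction_on with
  | empty => simp [zeroProd, coeff_one]
  | cons a Y ih =>
    obtain ⟨h0, h1, h2, h3⟩ := ih
    have hcons : zeroProd (a ::ₘ Y) = zeroProd Y - C a * (X * zeroProd Y) := by
      rw [zeroProd, Multiset.map_cons, Multiset.prod_cons, ← zeroProd]
      ring
    rw [hcons]
    simp only [Multiset.sum_cons, Multiset.map_cons, coeff_sub, coeff_C_mul, h1, h2, h3, h0,
      coeff_X_mul, coeff_X_mul_zero]
    refine ⟨by ring, by ring, by ring, by ring⟩

/-- `c` is the coefficient sequence of `1 - s + ⋯`, an entire function of exponential type zero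
all of whose zeros are real and positive. -/
structure HasPositiveZeros (c : ℕ → ℝ) : Prop where
  subexp : SubexpCoeff c
  coeff_zero : c 0 = 1
  coeff_one : c 1 = -1
  real : ∀ s, seriesC c s = 0 → s.im = 0
  pos : ∀ s : ℝ, seriesC c s = 0 → 0 < s

namespace HasPositiveZeros

variable {c : ℕ → ℝ}

/-- The power sums of the reciprocals of the zeros, as limits of finite sums. -/
theorem exists_tendsto_power_sums (hc : HasPositiveZeros c) : ∃ Y : ℕ → Multiset ℝ,
    (∀ n, ∀ y ∈ Y n, 0 < y ∧ seriesC c (y⁻¹ : ℝ) = 0) ∧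
    Tendsto (fun n => (Y n).sum) atTop (nhds 1) ∧
    Tendsto (fun n => ((Y n).map fun y => y ^ 2).sum) atTop (nhds (1 - 2 * c 2)) ∧
    Tendsto (fun n => ((Y n).map fun y => y ^ 3).sum) atTop (nhds (1 - 3 * c 2 - 3 * c 3)) := by
  choose Y hY hYc using fun n : ℕ => exists_zeroProd_coeff_approx hc.subexp
    hc.coeff_zero hc.real hc.pos (δ := 1 / ((n : ℝ) + 1)) (by positivity)
  have hlim : ∀ k, Tendsto (fun n => (zeroProd (Y n)).coeff k) atTop (nhds (c k)) := by
    intro k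
    rw [tendsto_iff_dist_tendsto_zero]
    exact squeeze_zero (fun n => dist_nonneg) (fun n => hYc n k)
      tendsto_one_div_add_atTop_nhds_zero_nat
  refine ⟨Y, hY, ?_, ?_, ?_⟩
  · have := (hlim 1).neg
    rw [hc.coeff_one, neg_neg] at this
    exact this.congr fun n => (zeroProd_coeff (Y n)).2.1.symm
  · have := ((hlim 1).pow 2).sub ((hlim 2).const_mul 2)
    rw [hc.coeff_one] at this
    norm_num at this
    exact this.congr fun n => (zeroProd_coeff (Y n)).2.2.1.symm
  · have := (((hlim 1).pow 3).neg.add (((hlim 1).const_mul 3).mul (hlim 2))).sub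
      ((hlim 3).const_mul 3)
    rw [hc.coeff_one] at this
    have h2 : -(-1) ^ 3 + 3 * -1 * c 2 - 3 * c 3 = 1 - 3 * c 2 - 3 * c 3 := by ring
    rw [h2] at this
    exact this.congr fun n => (zeroProd_coeff (Y n)).2.2.2.symm

theorem sq_le (hc : HasPositiveZeros c) : (1 - 2 * c 2) ^ 2 ≤ 1 - 3 * c 2 - 3 * c 3 := by
  obtain ⟨Y, hY, l1, l2, l3⟩ := hc.exists_tendsto_power_sums
  have h : ∀ t : ℝ, 0 ≤ (1 - 3 * c 2 - 3 * c 3) * (t * t) + (-2 * (1 - 2 * c 2)) * t + 1 := by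
    intro t
    refine ge_of_tendsto' (((l3.mul_const (t * t)).add ((l2.const_mul (-2)).mul_const t)).add l1)
      fun n => ?_
    have h2 : 0 ≤ ((Y n).map fun y => y * (1 - t * y) ^ 2).sum := by
      refine Multiset.sum_nonneg fun x hx => ?_
      obtain ⟨y, hy, rfl⟩ := Multiset.mem_map.mp hx
      exact mul_nonneg (hY n y hy).1.le (sq_nonneg _)
    refine h2.trans_eq ?_
    clear l1 l2 l3 h2 hY
    induction Y n using Multiset.induction_on with
    | empty => simp
    | cons a Z ih => simp only [Multiset.map_cons, Multiset.sum_cons, ih]; ring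
  have := discrim_le_zero h
  rw [discrim] at this
  nlinarith

theorem one_sub_le_of_forall_zero (hc : HasPositiveZeros c) {m : ℝ} (hm : 0 < m)
    (hz : ∀ s : ℝ, seriesC c s = 0 → m ≤ s) : 1 - 2 * c 2 ≤ m⁻¹ := by
  obtain ⟨Y, hY, l1, l2, -⟩ := hc.exists_tendsto_power_sums
  have h := l1.const_mul m⁻¹
  rw [mul_one] at h
  refine le_of_tendsto_of_tendsto' l2 h fun n => ?_
  rw [← Multiset.map_id' (Y n), ← Multiset.sum_map_mul_left, Multiset.map_map]
  refine Multiset.sum_map_le_sum_map _ _ fun y hy => ?_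
  have h2 := hz _ (hY n y hy).2
  have h3 : y ≤ m⁻¹ := by
    rw [le_inv_comm₀ (hY n y hy).1 hm]
    exact h2
  change y ^ 2 ≤ m⁻¹ * y
  nlinarith [(hY n y hy).1]

/-- If all zeros are real and positive, one of them is at most `1 / (1 - 2 c₂)`. -/
theorem exists_zero_le (hc : HasPositiveZeros c) {m : ℝ} (hm : 0 < m)
    (hcm : 1 ≤ m * (1 - 2 * c 2)) :
    ∃ s : ℝ, 0 < s ∧ s ≤ m ∧ seriesC c s = 0 := by
  by_contra! hcon
  have hne : seriesC c (m : ℝ) ≠ 0 := hcon m hm le_rfl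
  have hcont : Continuous fun s : ℝ => seriesC c (s : ℂ) :=
    hc.subexp.differentiable.continuous.comp Complex.continuous_ofReal
  obtain ⟨r, hr, hball⟩ := Metric.eventually_nhds_iff.mp (hcont.continuousAt.eventually_ne hne)
  have h2 := hc.one_sub_le_of_forall_zero (m := m + r / 2) (by linarith) (by
    intro s hs
    by_contra! hlt
    rcases le_or_gt s m with h | h
    · exact hcon s (hc.pos s hs) h hs
    · exact hball (by rw [Real.dist_eq, abs_of_pos (by linarith)]; linarith) hs)
  rw [← one_div, le_div_iff₀ (by linarith)] at h2
  nlinarith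

end HasPositiveZeros

/-- The polynomial `1 - s g(ρ s)`. -/
noncomputable def extendBy (g : ℝ[X]) (ρ : ℝ) : ℝ[X] := 1 - X * g.comp (C ρ * X)

/-- The maximum of `s g(s)` over the unit interval. -/
noncomputable def peak (g : ℝ[X]) : ℝ := sSup ((fun s => s * g.eval s) '' Set.Icc 0 1)

/-- The normalized extremal polynomials `1 - s + ⋯`. -/
noncomputable def gPoly : ℕ → ℝ[X]
  | 0 => 1
  | n + 1 => extendBy (gPoly n) (peak (gPoly n))

theorem eval_extendBy (g : ℝ[X]) (ρ s : ℝ) :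
    (extendBy g ρ).eval s = 1 - s * g.eval (ρ * s) := by
  simp [extendBy]

theorem gPoly_succ (n : ℕ) : gPoly (n + 1) = extendBy (gPoly n) (peak (gPoly n)) := rfl

theorem eval_gPoly_succ (n : ℕ) (s : ℝ) :
    (gPoly (n + 1)).eval s = 1 - s * (gPoly n).eval (peak (gPoly n) * s) :=
  eval_extendBy _ _ _

theorem exists_isMax_peak (g : ℝ[X]) : ∃ s ∈ Set.Icc (0 : ℝ) 1, s * g.eval s = peak g ∧
    ∀ t ∈ Set.Icc (0 : ℝ) 1, t * g.eval t ≤ peak g := by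
  have hcont : ContinuousOn (fun s => s * g.eval s) (Set.Icc (0 : ℝ) 1) := by fun_prop
  obtain ⟨s, hs, hmax, hle⟩ := isCompact_Icc.exists_sSup_image_eq_and_ge
    (Set.nonempty_Icc.mpr zero_le_one) hcont
  exact ⟨s, hs, hmax.symm, fun t ht => by rw [peak, hmax]; exact hle t ht⟩

theorem le_peak (g : ℝ[X]) {t : ℝ} (h0 : 0 ≤ t) (h1 : t ≤ 1) : t * g.eval t ≤ peak g := by
  obtain ⟨-, -, -, h⟩ := exists_isMax_peak g
  exact h t ⟨h0, h1⟩

/-- Estimates on the unit interval shared by all the polynomials `gPoly n`, `1 ≤ n`. -/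
structure RegularOnUnit (g : ℝ → ℝ) : Prop where
  zero : g 0 = 1
  sub_le : ∀ x y, 0 ≤ x → x ≤ y → y ≤ 1 → g x - g y ≤ y - x
  le_sub : ∀ x y, 0 ≤ x → x ≤ y → y ≤ 1 → (y - x) * (1 - 0.32 * (x + y)) ≤ g x - g y
  le_cubic : ∀ x, 0 ≤ x → x ≤ 1 → g x ≤ 1 - x + 0.32 * x ^ 2 - 0.0245 * x ^ 3

namespace RegularOnUnit

theorem one_sub_le {g : ℝ → ℝ} (hg : RegularOnUnit g) {x : ℝ} (h0 : 0 ≤ x) (h1 : x ≤ 1) :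
    1 - x ≤ g x := by
  have := hg.sub_le 0 x le_rfl h0 h1
  rw [hg.zero] at this
  linarith

theorem le_one {g : ℝ → ℝ} (hg : RegularOnUnit g) {x : ℝ} (h0 : 0 ≤ x) (h1 : x ≤ 1) :
    g x ≤ 1 := by
  have := hg.le_cubic x h0 h1
  nlinarith [pow_nonneg h0 3, mul_nonneg h0 (sub_nonneg.mpr h1)]

theorem quarter_le_peak {g : ℝ[X]} (hg : RegularOnUnit fun x => g.eval x) : 1 / 4 ≤ peak g := by
  have h1 := le_peak g (t := 1 / 2) (by norm_num) (by norm_num)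
  have h2 := hg.one_sub_le (x := 1 / 2) (by norm_num) (by norm_num)
  linarith

theorem peak_le {g : ℝ[X]} (hg : RegularOnUnit fun x => g.eval x) : peak g ≤ 0.32 := by
  obtain ⟨s, ⟨h0, h1⟩, hs, -⟩ := exists_isMax_peak g
  rw [← hs]
  have h2 := mul_le_mul_of_nonneg_left (hg.le_cubic s h0 h1) h0
  nlinarith [sq_nonneg (s - 0.76), mul_nonneg (sub_nonneg.mpr h1) (sq_nonneg (s - 0.76)),
    mul_nonneg (mul_nonneg h0 h0) (sq_nonneg (s - 0.76)), mul_nonneg h0 (sq_nonneg (s - 0.76))]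

theorem argmax_le {g : ℝ[X]} (hg : RegularOnUnit fun x => g.eval x) {s : ℝ} (h0 : 0 ≤ s)
    (h1 : s ≤ 1) (hs : s * g.eval s = peak g) : s ≤ 0.9 := by
  by_contra! hlt
  have h2 := le_peak g (t := 0.9) (by norm_num) (by norm_num)
  have h3 := hg.le_sub 0.9 s (by norm_num) hlt.le h1
  have h4 := hg.le_cubic s h0 h1
  have h5 : 0 < (s - 0.9) * (0.9 * (1 - 0.32 * (0.9 + s)) - g.eval s) := by
    refine mul_pos (by linarith) ?_
    nlinarith [pow_nonneg h0 3, mul_nonneg (sub_nonneg.mpr h1) (sub_nonneg.mpr hlt.le)]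
  nlinarith

/-- Passing from `g` to `1 - s g(ρ s)` preserves the estimates. -/
theorem extendBy {g : ℝ[X]} (hg : RegularOnUnit fun x => g.eval x)
    (hlow : ∀ x, 0 ≤ x → x ≤ 1 / 2 → 1 - x + 0.24 * x ^ 2 ≤ g.eval x) {ρ : ℝ} (hρ0 : 0 ≤ ρ)
    (hρ1 : ρ ≤ 0.32) : RegularOnUnit fun x => (extendBy g ρ).eval x where
  zero := by simp [eval_extendBy]
  sub_le x y hx hxy hy := by
    have hy0 : 0 ≤ y := hx.trans hxy
    simp only [eval_extendBy]
    have h1 : g.eval (ρ * y) ≤ 1 := hg.le_one (by positivity) (by nlinarith)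
    have h2 := hg.le_sub (ρ * x) (ρ * y) (by positivity) (by gcongr) (by nlinarith)
    have h3 : 0 ≤ g.eval (ρ * x) - g.eval (ρ * y) := by
      refine le_trans (mul_nonneg ?_ ?_) h2 <;> nlinarith
    nlinarith [mul_nonneg hx h3, mul_nonneg (sub_nonneg.mpr hxy) (sub_nonneg.mpr h1)]
  le_sub x y hx hxy hy := by
    have hy0 : 0 ≤ y := hx.trans hxy
    simp only [eval_extendBy]
    have h1 : 1 - ρ * y ≤ g.eval (ρ * y) := hg.one_sub_le (by positivity) (by nlinarith)
    have h2 := hg.sub_le (ρ * x) (ρ * y) (by positivity) (by gcongr) (by nlinarith)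
    have h3 := mul_le_mul_of_nonneg_left h2 hx
    have h4 := mul_le_mul_of_nonneg_left h1 (sub_nonneg.mpr hxy)
    have h5 : 0 ≤ (y - x) * ((0.32 - ρ) * (x + y)) :=
      mul_nonneg (by linarith) (mul_nonneg (by linarith) (by linarith))
    nlinarith
  le_cubic x hx hx1 := by
    simp only [eval_extendBy]
    have h1 := mul_le_mul_of_nonneg_left (hlow (ρ * x) (by positivity) (by nlinarith)) hx
    have h2 : 0 ≤ x ^ 2 * ((0.32 - ρ) * (1 - 0.24 * x * (0.32 + ρ))) := by
      refine mul_nonneg (sq_nonneg x) (mul_nonneg (by linarith) ?_)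
      nlinarith
    nlinarith [pow_nonneg hx 3]

theorem low_extendBy {g : ℝ[X]} (hg : RegularOnUnit fun x => g.eval x) {ρ : ℝ} (hρ0 : 1 / 4 ≤ ρ)
    (hρ1 : ρ ≤ 0.32) :
    ∀ x, 0 ≤ x → x ≤ 1 / 2 → 1 - x + 0.24 * x ^ 2 ≤ (_root_.extendBy g ρ).eval x := by
  intro x hx hx1
  rw [eval_extendBy]
  have h1 := hg.le_cubic (ρ * x) (by positivity) (by nlinarith)
  have h2 : g.eval (ρ * x) ≤ 1 - 0.24 * x := by
    have h3 : 0 ≤ (ρ - 1 / 4) * x := mul_nonneg (by linarith) hx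
    have h4 : ρ * x ≤ 0.16 := by nlinarith
    nlinarith [pow_nonneg (by positivity : 0 ≤ ρ * x) 3]
  nlinarith

end RegularOnUnit

theorem peak_one : peak (gPoly 0) = 1 := by
  obtain ⟨s, ⟨h0, h1⟩, hs, h⟩ := exists_isMax_peak (gPoly 0)
  have h2 := h 1 (by simp)
  simp only [gPoly, eval_one, mul_one] at hs h2 ⊢
  linarith

theorem eval_gPoly_one (s : ℝ) : (gPoly 1).eval s = 1 - s := by
  rw [eval_gPoly_succ]
  simp [gPoly]

theorem peak_gPoly_one : peak (gPoly 1) = 1 / 4 := by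
  obtain ⟨s, ⟨h0, h1⟩, hs, h⟩ := exists_isMax_peak (gPoly 1)
  have h2 := h (1 / 2) (by norm_num)
  rw [eval_gPoly_one] at hs h2
  nlinarith [sq_nonneg (s - 1 / 2)]

theorem eval_gPoly_two (s : ℝ) : (gPoly 2).eval s = 1 - s + s ^ 2 / 4 := by
  rw [eval_gPoly_succ, eval_gPoly_one, peak_gPoly_one]
  ring

theorem regular_gPoly_one : RegularOnUnit fun x => (gPoly 1).eval x where
  zero := by simp [eval_gPoly_one]
  sub_le x y hx hxy hy := by simp only [eval_gPoly_one]; linarith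
  le_sub x y hx hxy hy := by simp only [eval_gPoly_one]; nlinarith
  le_cubic x hx hx1 := by
    simp only [eval_gPoly_one]
    nlinarith [mul_nonneg (mul_nonneg hx hx) (sub_nonneg.mpr hx1)]

theorem regular_gPoly_add_two (n : ℕ) : (RegularOnUnit fun x => (gPoly (n + 2)).eval x) ∧
    ∀ x, 0 ≤ x → x ≤ 1 / 2 → 1 - x + 0.24 * x ^ 2 ≤ (gPoly (n + 2)).eval x := by
  induction n with
  | zero =>
    refine ⟨⟨by simp [eval_gPoly_two], ?_, ?_, ?_⟩, ?_⟩
    · intro x y hx hxy hy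
      simp only [zero_add, eval_gPoly_two]
      nlinarith
    · intro x y hx hxy hy
      simp only [zero_add, eval_gPoly_two]
      nlinarith
    · intro x hx hx1
      simp only [zero_add, eval_gPoly_two]
      nlinarith [mul_nonneg (mul_nonneg hx hx) (sub_nonneg.mpr hx1)]
    · intro x hx hx1
      simp only [zero_add, eval_gPoly_two]
      nlinarith
  | succ n ih =>
    obtain ⟨h1, h2⟩ := ih
    exact ⟨h1.extendBy h2 (by linarith [h1.quarter_le_peak]) h1.peak_le,
      h1.low_extendBy h1.quarter_le_peak h1.peak_le⟩

theorem regular_gPoly {n : ℕ} (hn : 1 ≤ n) : RegularOnUnit fun x => (gPoly n).eval x := by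
  rcases Nat.exists_eq_add_of_le hn with ⟨_ | k, rfl⟩
  · exact regular_gPoly_one
  · rw [show 1 + (k + 1) = k + 2 by ring]
    exact (regular_gPoly_add_two k).1

theorem peak_gPoly_pos (n : ℕ) : 0 < peak (gPoly n) := by
  rcases n with _ | n
  · rw [peak_one]; norm_num
  · linarith [(regular_gPoly (Nat.le_add_left 1 n)).quarter_le_peak]

/-- The peak depends on the polynomial in a contractive way. -/
theorem peak_sub_peak_le {g k : ℝ[X]} (hg : RegularOnUnit fun x => g.eval x) {η : ℝ}
    (hη : 0 ≤ η) (h : ∀ t, 0 ≤ t → t ≤ 1 → g.eval t - k.eval t ≤ η * t ^ 2) :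
    peak g - peak k ≤ 0.73 * η := by
  obtain ⟨s, ⟨h0, h1⟩, hs, -⟩ := exists_isMax_peak g
  have h2 := hg.argmax_le h0 h1 hs
  have h3 := le_peak k h0 h1
  have h4 := mul_le_mul_of_nonneg_left (h s h0 h1) h0
  have h5 : s ^ 3 ≤ 0.9 ^ 3 := by gcongr
  nlinarith

theorem abs_gPoly_succ_sub_le (n : ℕ) : ∀ t, 0 ≤ t → t ≤ 1 →
    |(gPoly (n + 2)).eval t - (gPoly (n + 1)).eval t| ≤ 0.84 ^ n * t ^ 2 := by
  induction n with
  | zero =>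
    intro t h0 h1
    rw [eval_gPoly_two, eval_gPoly_one]
    rw [show 1 - t + t ^ 2 / 4 - (1 - t) = t ^ 2 / 4 by ring, abs_of_nonneg (by positivity)]
    nlinarith [sq_nonneg t]
  | succ n ih =>
    intro t h0 h1
    have hA := regular_gPoly (n := n + 2) (by omega)
    have hB := regular_gPoly (n := n + 1) (by omega)
    have hη : (0 : ℝ) ≤ 0.84 ^ n := by positivity
    have hp1 := peak_sub_peak_le (k := gPoly (n + 1)) hA hη
      fun t h0 h1 => (le_abs_self _).trans (ih t h0 h1)
    have hp2 := peak_sub_peak_le (k := gPoly (n + 2)) hB hη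
      fun t h0 h1 => (le_abs_self _).trans ((abs_sub_comm _ _).trans_le (ih t h0 h1))
    rw [show n + 1 + 2 = n + 2 + 1 by ring, show n + 1 + 1 = n + 2 by ring,
      eval_gPoly_succ (n + 2) t, show (gPoly (n + 2)).eval t = _ from eval_gPoly_succ (n + 1) t]
    have ha0 := peak_gPoly_pos (n + 2)
    have hb0 := peak_gPoly_pos (n + 1)
    have ha1 := hA.peak_le
    have hb1 := hB.peak_le
    set a := peak (gPoly (n + 2))
    set b := peak (gPoly (n + 1))
    have h2 : |(gPoly (n + 2)).eval (a * t) - (gPoly (n + 2)).eval (b * t)| ≤ |a - b| * t := by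
      have key : ∀ u v, 0 ≤ u → u ≤ v → v ≤ 1 →
          |(gPoly (n + 2)).eval u - (gPoly (n + 2)).eval v| ≤ v - u := by
        intro u v hu huv hv
        rw [abs_of_nonneg]
        · exact hA.sub_le u v hu huv hv
        · refine le_trans (mul_nonneg ?_ ?_) (hA.le_sub u v hu huv hv) <;> linarith
      rcases le_total a b with hab | hab
      · rw [abs_of_nonpos (by linarith : a - b ≤ 0)]
        refine (key _ _ (by positivity) (by gcongr) (by nlinarith)).trans_eq (by ring)
      · rw [abs_of_nonneg (by linarith : 0 ≤ a - b), abs_sub_comm]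
        refine (key _ _ (by positivity) (by gcongr) (by nlinarith)).trans_eq (by ring)
    have h3 := ih (b * t) (by positivity) (by nlinarith)
    have h4 : |a - b| ≤ 0.73 * 0.84 ^ n := abs_le.mpr ⟨by linarith, hp1⟩
    have h5 : (b * t) ^ 2 ≤ 0.1024 * t := by
      have : b ^ 2 ≤ 0.1024 := by nlinarith
      rw [mul_pow]
      nlinarith [sq_nonneg t]
    calc |1 - t * (gPoly (n + 2)).eval (a * t) - (1 - t * (gPoly (n + 1)).eval (b * t))|
        = t * |((gPoly (n + 2)).eval (a * t) - (gPoly (n + 2)).eval (b * t))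
          + ((gPoly (n + 2)).eval (b * t) - (gPoly (n + 1)).eval (b * t))| := by
          rw [← abs_of_nonneg h0, ← abs_mul, abs_of_nonneg h0, ← abs_neg]
          congr 1
          ring
      _ ≤ t * (0.73 * 0.84 ^ n * t + 0.84 ^ n * (0.1024 * t)) := by
          gcongr
          refine (abs_add_le _ _).trans (add_le_add (h2.trans ?_) (h3.trans ?_))
          · gcongr
          · gcongr
      _ ≤ 0.84 ^ (n + 1) * t ^ 2 := by
          rw [pow_succ (0.84 : ℝ)]
          nlinarith [mul_nonneg hη (sq_nonneg t)]

/-- The ratios converge. -/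
theorem exists_tendsto_peak : ∃ q, Tendsto (fun n => peak (gPoly n)) atTop (nhds q) := by
  have h : CauchySeq fun n => peak (gPoly (n + 1)) := by
    refine cauchySeq_of_le_geometric 0.84 0.73 (by norm_num) fun n => ?_
    have hA := regular_gPoly (n := n + 2) (by omega)
    have hB := regular_gPoly (n := n + 1) (by omega)
    have hη : (0 : ℝ) ≤ 0.84 ^ n := by positivity
    have hp1 := peak_sub_peak_le (k := gPoly (n + 1)) hA hη
      fun t h0 h1 => (le_abs_self _).trans (abs_gPoly_succ_sub_le n t h0 h1)
    have hp2 := peak_sub_peak_le (k := gPoly (n + 2)) hB hη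
      fun t h0 h1 => (le_abs_self _).trans
        ((abs_sub_comm _ _).trans_le (abs_gPoly_succ_sub_le n t h0 h1))
    rw [Real.dist_eq, abs_le]
    exact ⟨by linarith, by linarith⟩
  obtain ⟨q, hq⟩ := cauchySeq_tendsto_of_complete h
  exact ⟨q, (tendsto_add_atTop_iff_nat 1).mp hq⟩

theorem sq_X_sub_C_dvd {p : ℝ[X]} {z : ℝ} (h0 : p.eval z = 0) (h1 : p.derivative.eval z = 0) :
    (X - C z) ^ 2 ∣ p := by
  obtain ⟨h, rfl⟩ := dvd_iff_isRoot.mpr h0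
  rw [sq]
  refine mul_dvd_mul_left _ (dvd_iff_isRoot.mpr ?_)
  simpa [derivative_mul] using h1

/-- A one-sided sign condition at an interior zero forces a double root. -/
theorem sq_X_sub_C_dvd_of_nonneg {p : ℝ[X]} {a b z : ℝ} (haz : a < z) (hzb : z < b)
    (hp : ∀ s, a < s → s < b → 0 ≤ p.eval s) (h0 : p.eval z = 0) : (X - C z) ^ 2 ∣ p := by
  refine sq_X_sub_C_dvd h0 ?_
  have hmin : IsLocalMin (fun s => p.eval s) z := by
    filter_upwards [Ioo_mem_nhds haz hzb] with s hs
    rw [h0]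
    exact hp s hs.1 hs.2
  rw [← Polynomial.deriv]
  exact hmin.deriv_eq_zero

theorem natDegree_gPoly_le (n : ℕ) : (gPoly n).natDegree ≤ n := by
  induction n with
  | zero => simp [gPoly]
  | succ n ih =>
    rw [gPoly_succ, extendBy]
    refine (natDegree_sub_le _ _).trans (max_le (by simp) ?_)
    refine (natDegree_mul_le).trans ?_
    rw [natDegree_X, add_comm]
    refine Nat.add_le_add_right (natDegree_comp_le.trans ?_) 1
    have : (C (peak (gPoly n)) * X : ℝ[X]).natDegree ≤ 1 :=
      (natDegree_C_mul_le _ _).trans natDegree_X_le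
    nlinarith

theorem eval_gPoly_zero_right (n : ℕ) : (gPoly n).eval 0 = 1 := by
  rcases n with _ | n
  · simp [gPoly]
  · simp [eval_gPoly_succ]

theorem gPoly_ne_zero (n : ℕ) : gPoly n ≠ 0 := fun h => by
  have := eval_gPoly_zero_right n
  simp [h] at this

theorem eval_gPoly_nonneg (n : ℕ) {s : ℝ} (h0 : 0 ≤ s) (h1 : peak (gPoly n) * s ≤ 1) :
    0 ≤ (gPoly (n + 1)).eval s := by
  have hρ := peak_gPoly_pos n
  rw [eval_gPoly_succ]
  have := le_peak (gPoly n) (by positivity) h1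
  have h2 : peak (gPoly n) * (s * (gPoly n).eval (peak (gPoly n) * s)) ≤ peak (gPoly n) * 1 := by
    linarith
  linarith [le_of_mul_le_mul_left h2 hρ]

/-- The polynomials oscillate beyond their smallest zero. -/
theorem exists_oscillation (m : ℕ) : ∃ (z : ℝ) (x : ℕ → ℝ), 1 ≤ z ∧
    peak (gPoly (m + 1)) * z ≤ 0.9 ∧ (gPoly (m + 2)).eval z = 0 ∧ StrictMono x ∧ z < x 0 ∧
    ∀ k < m + 1, (Even k → 1 ≤ (gPoly (m + 2)).eval (x k)) ∧
      (Odd k → (gPoly (m + 2)).eval (x k) < 0) := by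
  induction m with
  | zero =>
    refine ⟨2, fun k => 4 + k, by norm_num, ?_, ?_, ?_, by norm_num, ?_⟩
    · rw [zero_add, peak_gPoly_one]; norm_num
    · rw [zero_add, eval_gPoly_two]; norm_num
    · intro a b hab
      simpa using hab
    · intro k hk
      obtain rfl : k = 0 := by omega
      simp [eval_gPoly_two]
      norm_num
  | succ m ih =>
    obtain ⟨z, x, hz1, -, hz0, hx, hzx, hosc⟩ := ih
    have hreg := regular_gPoly (n := m + 2) (by omega)
    have hρ0 := peak_gPoly_pos (m + 2)
    have hρ1 := hreg.peak_le
    obtain ⟨s, ⟨hs0, hs1⟩, hs, -⟩ := exists_isMax_peak (gPoly (m + 2))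
    have hs9 := hreg.argmax_le hs0 hs1 hs
    have hle := hreg.le_one hs0 hs1
    have hev : ∀ y, (gPoly (m + 1 + 2)).eval (y / peak (gPoly (m + 2))) =
        1 - y / peak (gPoly (m + 2)) * (gPoly (m + 2)).eval y := by
      intro y
      rw [show m + 1 + 2 = m + 2 + 1 by ring, eval_gPoly_succ, mul_div_cancel₀ _ hρ0.ne']
    rw [show m + 1 + 1 = m + 2 by ring]
    set ρ := peak (gPoly (m + 2))
    have hxz : ∀ k, z < x k := fun k => hzx.trans_le (hx.monotone (Nat.zero_le k))
    refine ⟨s / ρ, fun k => Nat.casesOn k (z / ρ) fun j => x j / ρ, ?_, ?_, ?_, ?_, ?_, ?_⟩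
    · rw [le_div_iff₀ hρ0, one_mul, ← hs]
      nlinarith
    · rwa [mul_div_cancel₀ _ hρ0.ne']
    · rw [hev, div_mul_eq_mul_div, hs, div_self hρ0.ne', sub_self]
    · refine strictMono_nat_of_lt_succ fun k => ?_
      cases k with
      | zero => exact div_lt_div_of_pos_right hzx hρ0
      | succ k => exact div_lt_div_of_pos_right (hx (Nat.lt_succ_self k)) hρ0
    · exact div_lt_div_of_pos_right (by linarith) hρ0
    · intro k hk
      cases k with
      | zero => simp [hev, hz0]
      | succ k =>
        obtain ⟨h1, h2⟩ := hosc k (by omega)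
        have hgt : 1 < x k / ρ := by
          rw [lt_div_iff₀ hρ0]
          linarith [hxz k]
        simp only [hev]
        constructor
        · intro hk1
          have := h2 (by rwa [← Nat.not_even_iff_odd, ← Nat.even_add_one])
          nlinarith
        · intro hk1
          have := h1 (by rwa [← Nat.not_odd_iff_even, ← Nat.odd_add_one])
          nlinarith

/-- The polynomials split over the reals, with exactly one double root. -/
theorem exists_factorization_gPoly (m : ℕ) : ∃ (z c : ℝ) (r : ℕ → ℝ), 1 ≤ z ∧
    peak (gPoly (m + 1)) * z ≤ 0.9 ∧ c ≠ 0 ∧ Set.InjOn r (Finset.range m : Set ℕ) ∧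
    gPoly (m + 2) = (X - C z) ^ 2 * (∏ k ∈ Finset.range m, (X - C (r k))) * C c := by
  obtain ⟨z, x, hz1, hz9, hz0, hx, hzx, hosc⟩ := exists_oscillation m
  have hρ0 := peak_gPoly_pos (m + 1)
  have hroot : ∀ k, ∃ r, k < m → x k < r ∧ r < x (k + 1) ∧ (gPoly (m + 2)).eval r = 0 := by
    intro k
    by_cases hk : k < m
    swap
    · exact ⟨0, fun h => absurd h hk⟩
    obtain ⟨he, ho⟩ := hosc k (by omega)
    obtain ⟨he', ho'⟩ := hosc (k + 1) (by omega)
    have hlt := hx (Nat.lt_succ_self k)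
    have hc : ContinuousOn (fun s => (gPoly (m + 2)).eval s) (Set.Icc (x k) (x (k + 1))) := by
      fun_prop
    rcases Nat.even_or_odd k with h | h
    · obtain ⟨r, hr, hr0⟩ := intermediate_value_Ioo' hlt.le hc
        (show (0 : ℝ) ∈ _ from ⟨ho' h.add_one, by linarith [he h]⟩)
      exact ⟨r, fun _ => ⟨hr.1, hr.2, hr0⟩⟩
    · obtain ⟨r, hr, hr0⟩ := intermediate_value_Ioo hlt.le hc
        (show (0 : ℝ) ∈ _ from ⟨ho h, by linarith [he' h.add_one]⟩)
      exact ⟨r, fun _ => ⟨hr.1, hr.2, hr0⟩⟩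
  choose r hr using hroot
  have hinj : Set.InjOn r (Finset.range m : Set ℕ) := by
    have hlt : ∀ a < m, ∀ b < m, a < b → r a < r b := fun a ha b hb hab =>
      ((hr a ha).2.1.trans_le (hx.monotone hab)).trans (hr b hb).1
    intro a ha b hb hab
    simp only [Finset.coe_range, Set.mem_Iio] at ha hb
    rcases lt_trichotomy a b with h | h | h
    · exact absurd hab (hlt a ha b hb h).ne
    · exact h
    · exact absurd hab (hlt b hb a ha h).ne'
  have hzr : ∀ k < m, z ≠ r k := fun k hk =>
    ((hzx.trans_le (hx.monotone (Nat.zero_le k))).trans (hr k hk).1).ne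
  have hd1 : (X - C z) ^ 2 ∣ gPoly (m + 2) := by
    refine sq_X_sub_C_dvd_of_nonneg (a := 0) (b := 1 / peak (gPoly (m + 1))) (by linarith) ?_
      (fun s hs0 hs1 => eval_gPoly_nonneg (m + 1) hs0.le ?_) hz0
    · rw [lt_div_iff₀ hρ0]; linarith
    · rw [lt_div_iff₀ hρ0] at hs1; linarith
  have hd2 : ∏ k ∈ Finset.range m, (X - C (r k)) ∣ gPoly (m + 2) := by
    refine Finset.prod_dvd_of_coprime (fun a ha b hb hab => ?_) fun k hk => ?_
    · exact isCoprime_X_sub_C_of_isUnit_sub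
        (sub_ne_zero.mpr fun h => hab (hinj ha hb h)).isUnit
    · exact dvd_iff_isRoot.mpr (hr k (Finset.mem_range.mp hk)).2.2
  have hcop : IsCoprime ((X - C z) ^ 2) (∏ k ∈ Finset.range m, (X - C (r k))) := by
    refine IsCoprime.pow_left (IsCoprime.prod_right fun k hk => ?_)
    exact isCoprime_X_sub_C_of_isUnit_sub
      (sub_ne_zero.mpr (hzr k (Finset.mem_range.mp hk))).isUnit
  obtain ⟨h, hh⟩ := hcop.mul_dvd hd1 hd2
  have hdeg := natDegree_gPoly_le (m + 2)
  have hh0 : h ≠ 0 := fun h0 => gPoly_ne_zero (m + 2) (by rw [hh, h0, mul_zero])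
  have hm : ((X - C z) ^ 2 * ∏ k ∈ Finset.range m, (X - C (r k))).Monic :=
    ((monic_X_sub_C z).pow 2).mul (monic_prod_of_monic _ _ fun k _ => monic_X_sub_C (r k))
  rw [hh, hm.natDegree_mul' hh0, ((monic_X_sub_C z).pow 2).natDegree_mul
    (monic_prod_of_monic _ _ fun k _ => monic_X_sub_C (r k)), natDegree_pow, natDegree_X_sub_C,
    natDegree_prod_of_monic _ _ fun k _ => monic_X_sub_C (r k)] at hdeg
  simp only [natDegree_X_sub_C, Finset.sum_const, Finset.card_range, smul_eq_mul] at hdeg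
  have hC := eq_C_of_natDegree_eq_zero (show h.natDegree = 0 by omega)
  refine ⟨z, h.coeff 0, r, hz1, hz9, fun h0 => hh0 (by rw [hC, h0, C_0]), hinj, ?_⟩
  rw [← hC]
  exact hh

theorem exists_prod_gPoly (m : ℕ) : ∃ (c : ℝ) (r : ℕ → ℝ) (N : ℕ), c ≠ 0 ∧
    ∀ s : ℂ, aeval s (gPoly (m + 1)) = (∏ k ∈ Finset.range N, (s - r k)) * c := by
  rcases m with _ | m
  · refine ⟨-1, fun _ => 1, 1, by norm_num, fun s => ?_⟩
    simp [gPoly, extendBy]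
  · obtain ⟨z, c, r, -, -, hc, -, h⟩ := exists_factorization_gPoly m
    refine ⟨c, fun k => if k < m then r k else z, m + 2, hc, fun s => ?_⟩
    rw [h, Finset.prod_range_succ, Finset.prod_range_succ]
    have hprod : ∏ k ∈ Finset.range m, (s - ((if k < m then r k else z : ℝ) : ℂ)) =
        ∏ k ∈ Finset.range m, (s - (r k : ℂ)) :=
      Finset.prod_congr rfl fun k hk => by rw [if_pos (Finset.mem_range.mp hk)]
    rw [hprod]
    simp only [map_mul, map_pow, map_sub, map_prod, aeval_X, aeval_C, Complex.coe_algebraMap,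
      lt_irrefl, if_false, add_lt_iff_neg_left, not_lt_zero]
    ring

/-- A double root of one of the polynomials is bounded. -/
theorem bounds_of_sq_dvd_gPoly {m : ℕ} {w : ℝ} (hw : (X - C w) ^ 2 ∣ gPoly (m + 2)) :
    1 ≤ w ∧ peak (gPoly (m + 1)) * w ≤ 0.9 := by
  obtain ⟨z, c, r, hz1, hz9, hc, hinj, h⟩ := exists_factorization_gPoly m
  suffices w = z by rw [this]; exact ⟨hz1, hz9⟩
  by_contra hne
  rw [h] at hw
  have hcop : IsCoprime ((X - C w) ^ 2) ((X - C z) ^ 2) :=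
    (isCoprime_X_sub_C_of_isUnit_sub (sub_ne_zero.mpr hne).isUnit).pow
  have h1 := hcop.dvd_of_dvd_mul_left
    ((isUnit_C.mpr hc.isUnit).dvd_mul_right.mp hw)
  have h2 : (∏ k ∈ Finset.range m, (X - C (r k))).Separable :=
    separable_prod_X_sub_C_iff'.mpr hinj
  exact not_isUnit_X_sub_C w (h2.squarefree _ (by rwa [← sq]))

theorem coeff_zero_extendBy (g : ℝ[X]) (ρ : ℝ) : (extendBy g ρ).coeff 0 = 1 := by
  simp [extendBy]

theorem coeff_succ_extendBy (g : ℝ[X]) (ρ : ℝ) (j : ℕ) :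
    (extendBy g ρ).coeff (j + 1) = -(g.coeff j * ρ ^ j) := by
  simp [extendBy, coeff_one, comp_C_mul_X_coeff]

theorem coeff_zero_gPoly (n : ℕ) : (gPoly n).coeff 0 = 1 := by
  rw [coeff_zero_eq_eval_zero, eval_gPoly_zero_right]

theorem coeff_one_gPoly {n : ℕ} (hn : 1 ≤ n) : (gPoly n).coeff 1 = -1 := by
  obtain ⟨k, rfl⟩ := Nat.exists_eq_add_of_le' hn
  rw [gPoly_succ, show (1 : ℕ) = 0 + 1 from rfl, coeff_succ_extendBy, coeff_zero_gPoly]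
  simp

theorem coeff_two_gPoly_le {n : ℕ} (hn : 1 ≤ n) : (gPoly n).coeff 2 ≤ 0.32 := by
  obtain ⟨k, rfl⟩ := Nat.exists_eq_add_of_le' hn
  rw [gPoly_succ, show (2 : ℕ) = 1 + 1 from rfl, coeff_succ_extendBy]
  rcases k with _ | k
  · simp [gPoly, coeff_one]
    norm_num
  · rw [coeff_one_gPoly (by omega)]
    simpa using (regular_gPoly (n := k + 1) (by omega)).peak_le

theorem one_le_eval_gPoly_of_nonpos (n : ℕ) : ∀ {s : ℝ}, s ≤ 0 → 1 ≤ (gPoly n).eval s := by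
  induction n with
  | zero => simp [gPoly]
  | succ n ih =>
    intro s hs
    rw [eval_gPoly_succ]
    have := ih (mul_nonpos_of_nonneg_of_nonpos (peak_gPoly_pos n).le hs)
    nlinarith

theorem aeval_ofReal (p : ℝ[X]) (s : ℝ) : aeval (s : ℂ) p = ((p.eval s : ℝ) : ℂ) := by
  have := aeval_algebraMap_apply ℂ s p
  simpa using this

/-- The peak is the largest scaling parameter for which the extension is hyperbolic. -/
theorem le_peak_of_hyperbolic {n : ℕ} (hn : 1 ≤ n) {ρ : ℝ} (hρ : 0 < ρ)
    (h : Hyperbolic (extendBy (gPoly n) ρ)) : ρ ≤ peak (gPoly n) := by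
  have hzero : ∀ s : ℝ, seriesC (extendBy (gPoly n) ρ).coeff s = 0 →
      1 - s * (gPoly n).eval (ρ * s) = 0 := by
    intro s hs
    rw [seriesC_polynomial, aeval_ofReal, eval_extendBy] at hs
    exact_mod_cast hs
  have hc1 : (extendBy (gPoly n) ρ).coeff 1 = -1 := by
    rw [show (1 : ℕ) = 0 + 1 from rfl, coeff_succ_extendBy, coeff_zero_gPoly]; simp
  have hc2 : (extendBy (gPoly n) ρ).coeff 2 = ρ := by
    rw [show (2 : ℕ) = 1 + 1 from rfl, coeff_succ_extendBy, coeff_one_gPoly hn]; simp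
  have hc3 : (extendBy (gPoly n) ρ).coeff 3 = -((gPoly n).coeff 2 * ρ ^ 2) := by
    rw [show (3 : ℕ) = 2 + 1 from rfl, coeff_succ_extendBy]
  have H : HasPositiveZeros (extendBy (gPoly n) ρ).coeff :=
    { subexp := subexpCoeff_polynomial _
      coeff_zero := coeff_zero_extendBy _ _
      coeff_one := hc1
      real := fun s hs => h s (by rwa [seriesC_polynomial] at hs)
      pos := fun s hs => by
        by_contra! hle
        have h1 := hzero s hs
        have h2 := one_le_eval_gPoly_of_nonpos n (mul_nonpos_of_nonneg_of_nonpos hρ.le hle)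
        nlinarith }
  have hsq := H.sq_le
  rw [hc2, hc3] at hsq
  have ha := coeff_two_gPoly_le hn
  have h3 : ρ ≤ 1 / 3 := by
    by_contra! hlt
    nlinarith [mul_nonneg (sub_nonneg.mpr ha) (sq_nonneg ρ)]
  obtain ⟨s, hs0, hs1, hs⟩ := H.exists_zero_le (m := 1 / ρ) (by positivity) (by
    rw [hc2, one_div_mul_eq_div, le_div_iff₀ hρ]; linarith)
  have h4 := hzero s hs
  rw [le_div_iff₀ hρ] at hs1
  have h5 := le_peak (gPoly n) (t := ρ * s) (by positivity) (by linarith)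
  have h6 : ρ * s * (gPoly n).eval (ρ * s) = ρ := by linear_combination (-ρ) * h4
  linarith

theorem hyperbolic_gPoly_succ (m : ℕ) : Hyperbolic (gPoly (m + 1)) := by
  obtain ⟨c, r, N, hc, h⟩ := exists_prod_gPoly m
  intro s hs
  rw [h, mul_eq_zero, Finset.prod_eq_zero_iff] at hs
  rcases hs with ⟨k, -, hk⟩ | hs
  · rw [sub_eq_zero.mp hk, Complex.ofReal_im]
  · exact absurd (by exact_mod_cast hs) hc

/-- The closed recursion for the extremal coefficients. -/
noncomputable def Bcoef : ℕ → ℝ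
  | 0 => 1
  | 1 => 1
  | n + 2 => peak (gPoly (n + 1)) * Bcoef (n + 1) ^ 2 / Bcoef n

theorem Bcoef_add_two (n : ℕ) :
    Bcoef (n + 2) = peak (gPoly (n + 1)) * Bcoef (n + 1) ^ 2 / Bcoef n := by
  rw [Bcoef]

theorem Bcoef_pos (n : ℕ) : 0 < Bcoef n ∧ 0 < Bcoef (n + 1) := by
  induction n with
  | zero => simp [Bcoef]
  | succ n ih =>
    refine ⟨ih.2, ?_⟩
    rw [Bcoef_add_two]
    have := peak_gPoly_pos (n + 1)
    have h1 := ih.1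
    have h2 := ih.2
    positivity

/-- The reverted polynomials of the series with coefficients `Bcoef`. -/
noncomputable def revB (n : ℕ) : ℝ[X] := ∑ j ∈ Finset.range (n + 1), C (Bcoef (n - j)) * X ^ j

theorem revB_succ (n : ℕ) : revB (n + 1) = C (Bcoef (n + 1)) + X * revB n := by
  rw [revB, Finset.sum_range_succ', revB, Finset.mul_sum, add_comm]
  congr 1
  · simp
  · refine Finset.sum_congr rfl fun j _ => ?_
    rw [Nat.add_sub_add_right, pow_succ]
    ring

theorem C_add_X_mul_comp (g : ℝ[X]) {t b ρ a : ℝ} (ht : t ≠ 0) (hρ : ρ * (b / t) = a) :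
    C t + X * (C b * g.comp (C (-a) * X)) =
      C t * (extendBy g ρ).comp (C (-(b / t)) * X) := by
  have h : C t * C (-(b / t)) = (-C b : ℝ[X]) := by
    rw [← C_mul, ← C_neg]; congr 1; field_simp
  have h2 : (C ρ * X : ℝ[X]).comp (C (-(b / t)) * X) = C (-a) * X := by
    rw [mul_comp, C_comp, X_comp, ← mul_assoc, ← C_mul, mul_neg, hρ]
  rw [extendBy, sub_comp, one_comp, mul_comp, X_comp, comp_assoc, h2]
  linear_combination X * g.comp (C (-a) * X) * h

/-- The reverted polynomials are rescaled copies of the normalized ones. -/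
theorem revB_eq (n : ℕ) : revB (n + 1) =
    C (Bcoef (n + 1)) * (gPoly (n + 1)).comp (C (-(Bcoef n / Bcoef (n + 1))) * X) := by
  induction n with
  | zero =>
    rw [revB_succ]
    simp [revB, Bcoef, gPoly, extendBy]
  | succ n ih =>
    obtain ⟨h0, h1⟩ := Bcoef_pos n
    obtain ⟨-, h2⟩ := Bcoef_pos (n + 1)
    rw [revB_succ, ih, gPoly_succ (n + 1)]
    refine C_add_X_mul_comp _ h2.ne' ?_
    have hp := peak_gPoly_pos (n + 1)
    rw [Bcoef_add_two]
    field_simp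

theorem aeval_inv_revB (n : ℕ) {x : ℂ} (hx : x ≠ 0) :
    aeval x (∑ j ∈ Finset.range (n + 1), C (Bcoef j) * X ^ j : ℝ[X]) =
      x ^ n * aeval x⁻¹ (revB n) := by
  rw [revB, map_sum, map_sum, Finset.mul_sum,
    ← Finset.sum_range_reflect (fun j => aeval x (C (Bcoef j) * X ^ j : ℝ[X]))]
  refine Finset.sum_congr rfl fun j hj => ?_
  have hj' : j ≤ n := Nat.lt_succ_iff.mp (Finset.mem_range.mp hj)
  rw [show n + 1 - 1 - j = n - j by omega]
  simp only [map_mul, map_pow, aeval_X, aeval_C, Complex.coe_algebraMap]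
  rw [pow_sub₀ x hx hj', inv_pow]
  ring

theorem aeval_partial_sum_add (n : ℕ) {t : ℝ} (ht : 0 < t) {x : ℂ} (hx : x ≠ 0) :
    aeval x (∑ j ∈ Finset.range (n + 2), C (Bcoef j) * X ^ j + C t * X ^ (n + 2) : ℝ[X]) =
      x ^ (n + 2) * t * aeval (-(Bcoef (n + 1) / t : ℝ) * x⁻¹ : ℂ)
        (extendBy (gPoly (n + 1)) (t * Bcoef n / Bcoef (n + 1) ^ 2)) := by
  obtain ⟨h0, h1⟩ := Bcoef_pos n
  have key := congrArg (aeval x⁻¹) (C_add_X_mul_comp (gPoly (n + 1)) (t := t)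
    (b := Bcoef (n + 1)) (ρ := t * Bcoef n / Bcoef (n + 1) ^ 2)
    (a := Bcoef n / Bcoef (n + 1)) ht.ne' (by field_simp))
  rw [← revB_eq, map_mul, aeval_comp, map_add, map_mul] at key
  simp only [map_mul, aeval_X, aeval_C, Complex.coe_algebraMap, Complex.ofReal_neg] at key
  rw [map_add, aeval_inv_revB (n + 1) hx, mul_assoc, ← key]
  simp only [map_mul, map_pow, aeval_X, aeval_C, Complex.coe_algebraMap]
  rw [pow_succ x (n + 1)]
  linear_combination -(x ^ (n + 1) * aeval x⁻¹ (revB (n + 1))) * mul_inv_cancel₀ hx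

theorem hyperbolic_partial_sum_iff (n : ℕ) {t : ℝ} (ht : 0 < t) :
    Hyperbolic (∑ j ∈ Finset.range (n + 2), C (Bcoef j) * X ^ j + C t * X ^ (n + 2)) ↔
      Hyperbolic (extendBy (gPoly (n + 1)) (t * Bcoef n / Bcoef (n + 1) ^ 2)) := by
  obtain ⟨h0, h1⟩ := Bcoef_pos n
  have hα : 0 < Bcoef (n + 1) / t := by positivity
  set α := Bcoef (n + 1) / t with hαdef
  have hαC : (α : ℂ) ≠ 0 := by exact_mod_cast hα.ne'
  constructor
  · intro h s hs
    rcases eq_or_ne s 0 with rfl | hs0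
    · rfl
    have hx : (-(α : ℂ) * s⁻¹) ≠ 0 := by simp [hαC, hs0]
    have h2 := h (-(α : ℂ) * s⁻¹) (by
      rw [aeval_partial_sum_add n ht hx, ← hαdef,
        show -(α : ℂ) * (-(α : ℂ) * s⁻¹)⁻¹ = s by field_simp, hs, mul_zero])
    have h3 : s = ((-α : ℝ) : ℂ) / (-(α : ℂ) * s⁻¹) := by push_cast; field_simp
    have h4 : (-(α : ℂ) * s⁻¹) = ((-(α : ℂ) * s⁻¹).re : ℂ) :=
      Complex.ext (Complex.ofReal_re _).symm (h2.trans (Complex.ofReal_im _).symm)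
    rw [h3, h4, ← Complex.ofReal_div, Complex.ofReal_im]
  · intro h x hx
    rcases eq_or_ne x 0 with rfl | hx0
    · rfl
    rw [aeval_partial_sum_add n ht hx0, ← hαdef, mul_eq_zero, or_iff_right (by
      simp [hx0, ht.ne'])] at hx
    have h2 := h _ hx
    have h3 : x = ((-α : ℝ) : ℂ) / (-(α : ℂ) * x⁻¹) := by push_cast; field_simp
    have h4 : (-(α : ℂ) * x⁻¹) = ((-(α : ℂ) * x⁻¹).re : ℂ) :=
      Complex.ext (Complex.ofReal_re _).symm (h2.trans (Complex.ofReal_im _).symm)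
    rw [h3, h4, ← Complex.ofReal_div, Complex.ofReal_im]

theorem Acoef_eq_Bcoef (n : ℕ) : Acoef n = Bcoef n := by
  induction n using Nat.strong_induction_on with
  | _ n ih =>
    match n, ih with
    | 0, _ => simp [Acoef, Bcoef]
    | 1, _ => simp [Acoef, Bcoef]
    | n + 2, ih =>
      obtain ⟨h0, h1⟩ := Bcoef_pos n
      obtain ⟨-, h2⟩ := Bcoef_pos (n + 1)
      rw [Acoef]
      have hsum : (∑ j ∈ (Finset.range (n + 2)).attach, C (Acoef j.1) * X ^ (j.1 : ℕ) : ℝ[X]) =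
          ∑ j ∈ Finset.range (n + 2), C (Bcoef j) * X ^ j := by
        rw [Finset.sum_attach (Finset.range (n + 2)) fun j => (C (Acoef j) * X ^ j : ℝ[X])]
        exact Finset.sum_congr rfl fun j hj => by rw [ih j (Finset.mem_range.mp hj)]
      rw [hsum]
      refine IsGreatest.csSup_eq ⟨⟨h2, ?_⟩, ?_⟩
      · rw [hyperbolic_partial_sum_iff n h2, show Bcoef (n + 2) * Bcoef n / Bcoef (n + 1) ^ 2 =
          peak (gPoly (n + 1)) by rw [Bcoef_add_two]; field_simp]
        exact hyperbolic_gPoly_succ (n + 1)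
      · rintro t ⟨ht, h⟩
        rw [hyperbolic_partial_sum_iff n ht] at h
        have := le_peak_of_hyperbolic (by omega) (by positivity) h
        rw [div_le_iff₀ (by positivity)] at this
        rw [Bcoef_add_two, le_div_iff₀ h0]
        exact this

theorem Prev_eq (n : ℕ) : Prev (n + 1) =
    C (Bcoef (n + 1)) * (gPoly (n + 1)).comp (C (-(Bcoef n / Bcoef (n + 1))) * X) := by
  rw [← revB_eq, Prev, revB]
  simp only [Acoef_eq_Bcoef]

/-- A double root of a reverted polynomial gives a double root of the normalized one, and the
rescaled values agree. -/
theorem exists_double_root_gPoly {n : ℕ} {ζ : ℝ} (h : (X - C ζ) ^ 2 ∣ Prev (n + 1)) :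
    ∃ w, (X - C w) ^ 2 ∣ gPoly (n + 1) ∧
      ∀ x, (Prev (n + 1)).eval (-ζ * x) / (Prev (n + 1)).eval 0 =
        (gPoly (n + 1)).eval (-w * x) := by
  obtain ⟨h0, h1⟩ := Bcoef_pos n
  set a := Bcoef n / Bcoef (n + 1) with ha
  have ha0 : 0 < a := by positivity
  refine ⟨-a * ζ, ?_, fun x => ?_⟩
  · rw [Prev_eq, ← ha, (isUnit_C.mpr h1.ne'.isUnit).dvd_mul_left] at h
    obtain ⟨k, hk⟩ := h
    have h3 := congrArg (fun p => p.comp (C (-a⁻¹) * X)) hk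
    simp only [comp_assoc, mul_comp, pow_comp, sub_comp, X_comp, C_comp] at h3
    have hC : C (-a) * (C (-a⁻¹) * X) = (X : ℝ[X]) := by
      rw [← mul_assoc, ← C_mul, neg_mul_neg, mul_inv_cancel₀ ha0.ne', C_1, one_mul]
    rw [hC, comp_X] at h3
    have hX : C (-a⁻¹) * X - C ζ = C (-a⁻¹) * (X - C (-a * ζ)) := by
      rw [mul_sub, ← C_mul]; congr 2; field_simp
    rw [h3, hX, mul_pow, mul_assoc]
    exact Dvd.dvd.mul_left (Dvd.intro _ rfl) _
  · rw [Prev_eq, ← ha]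
    simp only [eval_mul, eval_C, eval_comp, eval_X, mul_zero, eval_gPoly_zero_right, mul_one]
    rw [mul_div_cancel_left₀ _ h1.ne']
    congr 1
    ring

/-- The coefficients of the entire function `θ_q(s) = ∑ (-1)^j q^{j(j-1)/2} s^j`. -/
noncomputable def thetaCoeff (q : ℝ) (j : ℕ) : ℝ := (-1) ^ j * q ^ j.choose 2

/-- The function `θ_q` on the real line. -/
noncomputable def thetaR (q s : ℝ) : ℝ := ∑' j, thetaCoeff q j * s ^ j

theorem seriesC_thetaCoeff_ofReal (q s : ℝ) :
    seriesC (thetaCoeff q) (s : ℂ) = (thetaR q s : ℂ) := by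
  rw [seriesC, thetaR, Complex.ofReal_tsum]
  push_cast
  rfl

theorem choose_succ_two (j : ℕ) : (j + 1).choose 2 = j.choose 2 + j := by
  rw [Nat.choose_succ_succ' j 1, Nat.choose_one_right, add_comm]

theorem thetaCoeff_zero (q : ℝ) : thetaCoeff q 0 = 1 := by simp [thetaCoeff]

theorem thetaCoeff_succ (q : ℝ) (j : ℕ) :
    thetaCoeff q (j + 1) = -(thetaCoeff q j * q ^ j) := by
  rw [thetaCoeff, thetaCoeff, choose_succ_two]
  ring

theorem abs_thetaCoeff {q : ℝ} (hq : 0 ≤ q) (j : ℕ) : |thetaCoeff q j| = q ^ j.choose 2 := by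
  rw [thetaCoeff, abs_mul, abs_pow, abs_neg, abs_one, one_pow, one_mul,
    abs_of_nonneg (by positivity)]

theorem subexpCoeff_thetaCoeff {q : ℝ} (h0 : 0 < q) (h1 : q < 1) : SubexpCoeff (thetaCoeff q) := by
  intro ε hε
  have hs : Summable fun j : ℕ => q ^ j.choose 2 * (j.factorial : ℝ) / ε ^ j := by
    refine summable_of_ratio_test_tendsto_lt_one zero_lt_one
      (Eventually.of_forall fun j => by positivity) ?_
    have h2 : Tendsto (fun j : ℕ => ((j : ℝ) * q ^ j + q ^ j) / ε) atTop (nhds ((0 + 0) / ε)) :=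
      ((tendsto_self_mul_const_pow_of_lt_one h0.le h1).add
        (tendsto_pow_atTop_nhds_zero_of_lt_one h0.le h1)).div_const ε
    rw [add_zero, zero_div] at h2
    refine h2.congr fun j => ?_
    rw [Real.norm_of_nonneg (by positivity), Real.norm_of_nonneg (by positivity),
      choose_succ_two, Nat.factorial_succ]
    push_cast
    field_simp
    ring
  obtain ⟨C, hC⟩ := hs.tendsto_atTop_zero.bddAbove_range
  refine ⟨C, fun j => ?_⟩
  rw [abs_thetaCoeff h0.le]
  have h2 := hC ⟨j, rfl⟩
  simp only at h2
  have h3 : 0 < ε ^ j / (j.factorial : ℝ) := by positivity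
  calc q ^ j.choose 2 = q ^ j.choose 2 * (j.factorial : ℝ) / ε ^ j * (ε ^ j / j.factorial) := by
        field_simp
    _ ≤ _ := by gcongr

theorem summable_thetaR {q : ℝ} (h0 : 0 < q) (h1 : q < 1) (s : ℝ) :
    Summable fun j => thetaCoeff q j * s ^ j := by
  refine Summable.of_norm ?_
  simpa [abs_mul] using (subexpCoeff_thetaCoeff h0 h1).summable_abs s

theorem thetaR_eq {q : ℝ} (h0 : 0 < q) (h1 : q < 1) (s : ℝ) :
    thetaR q s = 1 - s * thetaR q (q * s) := by
  rw [thetaR, (summable_thetaR h0 h1 s).tsum_eq_zero_add, thetaR, ← tsum_mul_left, thetaCoeff_zero,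
    pow_zero, one_mul, sub_eq_add_neg, ← tsum_neg]
  congr 2
  funext j
  rw [thetaCoeff_succ]
  ring

theorem one_le_thetaR {q : ℝ} (h0 : 0 < q) (h1 : q < 1) {s : ℝ} (hs : s ≤ 0) :
    1 ≤ thetaR q s := by
  have h := (summable_thetaR h0 h1 s).le_tsum 0 fun j _ => ?_
  · simpa [thetaCoeff_zero, thetaR] using h
  · rw [thetaCoeff, mul_right_comm, ← mul_pow]
    have : 0 ≤ -1 * s := by linarith
    positivity

theorem triangle_eq (j : ℕ) : j * (j + 1) / 2 = j.choose 2 + j := by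
  rw [← choose_succ_two, Nat.choose_two_right, Nat.add_sub_cancel, mul_comm]

theorem PsiR_eq (q u : ℝ) : PsiR q u = thetaR q (-q * u) := by
  rw [PsiR, thetaR]
  congr 1
  funext j
  have h : ((-1 : ℝ) ^ j) * (-1) ^ j = 1 := by rw [← mul_pow]; norm_num
  rw [triangle_eq, thetaCoeff, pow_add, mul_pow, neg_pow]
  linear_combination -(q ^ j.choose 2 * q ^ j * u ^ j) * h

theorem PsiC_eq (q : ℝ) (u : ℂ) : PsiC q u = seriesC (thetaCoeff q) (-q * u) := by
  rw [PsiC, seriesC]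
  congr 1
  funext j
  have h : ((-1 : ℂ) ^ j) * (-1) ^ j = 1 := by rw [← mul_pow]; norm_num
  rw [triangle_eq, thetaCoeff, pow_add, mul_pow, neg_pow]
  push_cast
  linear_combination -((q : ℂ) ^ j.choose 2 * q ^ j * u ^ j) * h

theorem forall_PsiC_iff {q : ℝ} (h0 : 0 < q) : (∀ u : ℂ, PsiC q u = 0 → u.im = 0) ↔
    ∀ s : ℂ, seriesC (thetaCoeff q) s = 0 → s.im = 0 := by
  have hq : (q : ℂ) ≠ 0 := by exact_mod_cast h0.ne'
  constructor
  · intro h s hs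
    have h2 := h ((-1 / q : ℝ) * s) (by
      rw [PsiC_eq, ← hs]; congr 1; push_cast; field_simp)
    rw [Complex.im_ofReal_mul] at h2
    simpa [h0.ne'] using h2
  · intro h u hu
    rw [PsiC_eq] at hu
    have h2 := h _ hu
    simpa [h0.ne'] using h2

theorem abs_coeff_gPoly_le (n : ℕ) : ∀ j, |(gPoly n).coeff j| ≤ 0.32 ^ j.choose 2 := by
  induction n with
  | zero =>
    intro j
    rcases j with _ | j
    · simp [gPoly]
    · rw [gPoly, coeff_one, if_neg (by omega), abs_zero]
      positivity
  | succ n ih =>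
    intro j
    rcases j with _ | j
    · simp [coeff_zero_gPoly]
    rw [gPoly_succ, coeff_succ_extendBy, abs_neg, abs_mul, choose_succ_two, pow_add, abs_pow,
      abs_of_pos (peak_gPoly_pos n)]
    rcases n with _ | n
    · rw [peak_one, one_pow, mul_one]
      rcases j with _ | j
      · simp [gPoly]
      · rw [gPoly, coeff_one, if_neg (by omega), abs_zero]
        positivity
    · have := (regular_gPoly (n := n + 1) (by omega)).peak_le
      have := peak_gPoly_pos (n + 1)
      gcongr
      exact ih j

section Limit

variable {q : ℝ}

theorem tendsto_coeff_gPoly (hq : Tendsto (fun n => peak (gPoly n)) atTop (nhds q)) (j : ℕ) :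
    Tendsto (fun n => (gPoly n).coeff j) atTop (nhds (thetaCoeff q j)) := by
  induction j with
  | zero => simp [coeff_zero_gPoly, thetaCoeff_zero]
  | succ j ih =>
    refine (tendsto_add_atTop_iff_nat 1).mp ?_
    simp only [gPoly_succ, coeff_succ_extendBy, thetaCoeff_succ]
    exact (ih.mul (hq.pow j)).neg

theorem tendsto_aeval_gPoly (hq : Tendsto (fun n => peak (gPoly n)) atTop (nhds q))
    {k : ℕ → ℕ} (hk : Tendsto k atTop atTop) {s : ℕ → ℂ} {a : ℂ}
    (hs : Tendsto s atTop (nhds a)) :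
    Tendsto (fun n => aeval (s n) (gPoly (k n))) atTop (nhds (seriesC (thetaCoeff q) a)) := by
  simp only [← seriesC_polynomial]
  refine tendsto_tsum_of_dominated_convergence
    ((subexpCoeff_thetaCoeff (q := 0.32) (by norm_num) (by norm_num)).summable_abs (‖a‖ + 1))
    (fun j => ?_) ?_
  · exact ((Complex.continuous_ofReal.tendsto _).comp ((tendsto_coeff_gPoly hq j).comp hk)).mul
      (hs.pow j)
  · filter_upwards [hs.norm.eventually_le_const (lt_add_one ‖a‖)] with n hn
    intro j
    rw [norm_mul, norm_pow, Complex.norm_real, Real.norm_eq_abs, abs_thetaCoeff (by norm_num),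
      abs_of_nonneg (by positivity : 0 ≤ ‖a‖ + 1)]
    gcongr
    exact abs_coeff_gPoly_le _ j

theorem tendsto_eval_gPoly (hq : Tendsto (fun n => peak (gPoly n)) atTop (nhds q))
    {k : ℕ → ℕ} (hk : Tendsto k atTop atTop) {s : ℕ → ℝ} {a : ℝ}
    (hs : Tendsto s atTop (nhds a)) :
    Tendsto (fun n => (gPoly (k n)).eval (s n)) atTop (nhds (thetaR q a)) := by
  have h := tendsto_aeval_gPoly hq hk ((Complex.continuous_ofReal.tendsto a).comp hs)
  rw [seriesC_thetaCoeff_ofReal] at h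
  have h2 := (Complex.continuous_re.tendsto _).comp h
  simpa [Function.comp_def, aeval_ofReal] using h2

theorem bounds_of_tendsto_peak (hq : Tendsto (fun n => peak (gPoly n)) atTop (nhds q)) :
    1 / 4 ≤ q ∧ q ≤ 0.32 :=
  ⟨ge_of_tendsto hq ((eventually_ge_atTop 1).mono fun _ hn => (regular_gPoly hn).quarter_le_peak),
    le_of_tendsto hq ((eventually_ge_atTop 1).mono fun _ hn => (regular_gPoly hn).peak_le)⟩

theorem regular_thetaR (hq : Tendsto (fun n => peak (gPoly n)) atTop (nhds q)) :
    RegularOnUnit (thetaR q) := by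
  have ht : ∀ x, Tendsto (fun n => (gPoly n).eval x) atTop (nhds (thetaR q x)) := fun x =>
    tendsto_eval_gPoly hq tendsto_id tendsto_const_nhds
  have hev := eventually_ge_atTop 1
  constructor
  · exact tendsto_nhds_unique (ht 0) (by simp [eval_gPoly_zero_right])
  · intro x y hx hxy hy
    exact le_of_tendsto ((ht x).sub (ht y))
      (hev.mono fun n hn => (regular_gPoly hn).sub_le x y hx hxy hy)
  · intro x y hx hxy hy
    exact ge_of_tendsto ((ht x).sub (ht y))
      (hev.mono fun n hn => (regular_gPoly hn).le_sub x y hx hxy hy)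
  · intro x hx hx1
    exact le_of_tendsto (ht x) (hev.mono fun n hn => (regular_gPoly hn).le_cubic x hx hx1)

theorem mul_thetaR_le (hq : Tendsto (fun n => peak (gPoly n)) atTop (nhds q)) {t : ℝ}
    (h0 : 0 ≤ t) (h1 : t ≤ 1) : t * thetaR q t ≤ q :=
  le_of_tendsto_of_tendsto' ((tendsto_eval_gPoly hq tendsto_id tendsto_const_nhds).const_mul t) hq
    fun n => le_peak (gPoly n) h0 h1

theorem thetaR_nonneg (hq : Tendsto (fun n => peak (gPoly n)) atTop (nhds q)) {s : ℝ}
    (h0 : 0 ≤ s) (h1 : q * s ≤ 1) : 0 ≤ thetaR q s := by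
  obtain ⟨hq0, hq1⟩ := bounds_of_tendsto_peak hq
  have h2 := mul_thetaR_le hq (t := q * s) (by positivity) h1
  rw [thetaR_eq (by linarith) (by linarith)]
  have h3 : q * (s * thetaR q (q * s)) ≤ q * 1 := by linarith
  linarith [le_of_mul_le_mul_left h3 (by linarith)]

/-- Moving towards the real axis decreases the modulus of a real-rooted polynomial. -/
theorem norm_aeval_gPoly_le (m : ℕ) (x : ℝ) {v w : ℝ} (h : |v| ≤ |w|) :
    ‖aeval (x + v * Complex.I) (gPoly (m + 1))‖ ≤ ‖aeval (x + w * Complex.I) (gPoly (m + 1))‖ := by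
  obtain ⟨c, r, N, -, hprod⟩ := exists_prod_gPoly m
  rw [hprod, hprod, norm_mul, norm_mul, norm_prod, norm_prod]
  gcongr with k hk
  have hn : ∀ y : ℝ, ‖(x : ℂ) + y * Complex.I - r k‖ ^ 2 = (x - r k) ^ 2 + y ^ 2 := by
    intro y
    rw [Complex.sq_norm, Complex.normSq_apply]
    simp
    ring
  refine le_of_sq_le_sq ?_ (norm_nonneg _)
  rw [hn, hn]
  linarith [sq_le_sq.mpr h]

theorem im_eq_zero_of_seriesC_thetaCoeff
    (hq : Tendsto (fun n => peak (gPoly n)) atTop (nhds q)) (s : ℂ)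
    (hs : seriesC (thetaCoeff q) s = 0) : s.im = 0 := by
  obtain ⟨hq0, hq1⟩ := bounds_of_tendsto_peak hq
  by_contra hv
  have hseg : ∀ v : ℝ, |v| ≤ |s.im| → seriesC (thetaCoeff q) (s.re + v * Complex.I) = 0 := by
    intro v hle
    have ht : ∀ y : ℂ, Tendsto (fun n => ‖aeval y (gPoly (n + 1))‖) atTop
        (nhds ‖seriesC (thetaCoeff q) y‖) := fun y =>
      (tendsto_aeval_gPoly hq (tendsto_add_atTop_nat 1) tendsto_const_nhds).norm
    have h := le_of_tendsto_of_tendsto' (ht _) (ht _)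
      fun n => norm_aeval_gPoly_le n s.re hle
    rw [Complex.re_add_im, hs, norm_zero] at h
    exact norm_le_zero_iff.mp h
  have hdiff := (subexpCoeff_thetaCoeff (q := q) (by linarith) (by linarith)).differentiable
  have hana : AnalyticOnNhd ℂ (seriesC (thetaCoeff q)) Set.univ :=
    hdiff.differentiableOn.analyticOnNhd isOpen_univ
  have hfreq : ∃ᶠ z in nhdsWithin (s.re : ℂ) {(s.re : ℂ)}ᶜ, seriesC (thetaCoeff q) z = 0 := by
    have ht : Tendsto (fun n : ℕ => (s.re : ℂ) + ((s.im * (1 / ((n : ℝ) + 1)) : ℝ) : ℂ) * Complex.I)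
        atTop (nhdsWithin (s.re : ℂ) {(s.re : ℂ)}ᶜ) := by
      refine tendsto_nhdsWithin_iff.mpr ⟨?_, Eventually.of_forall fun n => ?_⟩
      · have h1 := (tendsto_one_div_add_atTop_nhds_zero_nat (𝕜 := ℝ)).const_mul s.im
        rw [mul_zero] at h1
        have h2 := (((Complex.continuous_ofReal.tendsto 0).comp h1).mul_const Complex.I).const_add
          (s.re : ℂ)
        simpa using h2
      · have h3 : (n : ℂ) + 1 ≠ 0 := Nat.cast_add_one_ne_zero n
        simp [hv, h3]
    refine ht.frequently (Frequently.of_forall fun n => hseg _ ?_)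
    rw [abs_mul]
    refine mul_le_of_le_one_right (abs_nonneg _) ?_
    rw [abs_of_nonneg (by positivity), div_le_one (by positivity)]
    linarith [(Nat.cast_nonneg n : (0 : ℝ) ≤ n)]
  have h0 := hana.eqOn_zero_of_preconnected_of_frequently_eq_zero isPreconnected_univ
    (Set.mem_univ _) hfreq (Set.mem_univ (0 : ℂ))
  have h1 := seriesC_thetaCoeff_ofReal q 0
  rw [Complex.ofReal_zero, h0, (regular_thetaR hq).zero] at h1
  simp at h1

end Limit

theorem exists_zero_of_hyperbolic_theta {q : ℝ} (h0 : 0 < q) (h1 : q < 1)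
    (h : ∀ s : ℂ, seriesC (thetaCoeff q) s = 0 → s.im = 0) :
    q ≤ 1 / 3 ∧ ∃ t, 0 < t ∧ t ≤ 1 ∧ t * thetaR q t = q := by
  have hzero : ∀ s : ℝ, seriesC (thetaCoeff q) s = 0 → thetaR q s = 0 := fun s hs => by
    rw [seriesC_thetaCoeff_ofReal] at hs
    exact_mod_cast hs
  have H : HasPositiveZeros (thetaCoeff q) :=
    { subexp := subexpCoeff_thetaCoeff h0 h1
      coeff_zero := thetaCoeff_zero q
      coeff_one := by simp [thetaCoeff]
      real := h
      pos := fun s hs => by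
        by_contra! hle
        linarith [one_le_thetaR h0 h1 hle, hzero s hs] }
  have hc2 : thetaCoeff q 2 = q := by simp [thetaCoeff]
  have hc3 : thetaCoeff q 3 = -q ^ 3 := by
    rw [thetaCoeff_succ, hc2]; ring
  have hsq := H.sq_le
  rw [hc2, hc3] at hsq
  have h3 : q ≤ 1 / 3 := by
    by_contra! hlt
    nlinarith [mul_pos h0 (mul_pos (sub_pos.mpr h1) (sub_pos.mpr hlt))]
  obtain ⟨s, hs0, hs1, hs⟩ := H.exists_zero_le (m := 1 / q) (by positivity) (by
    rw [hc2, one_div_mul_eq_div, le_div_iff₀ h0]; linarith)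
  refine ⟨h3, q * s, by positivity, ?_, ?_⟩
  · rw [le_div_iff₀ h0] at hs1
    linarith
  · have h4 := thetaR_eq h0 h1 s
    rw [hzero s hs] at h4
    linear_combination q * h4

theorem exists_abs_thetaR_le {q : ℝ} (h0 : 0 < q) (h1 : q < 1) :
    ∃ M, ∀ t, 0 ≤ t → t ≤ 1 → |thetaR q t| ≤ M := by
  have hsum := (subexpCoeff_thetaCoeff h0 h1).summable_abs 1
  refine ⟨∑' j, |thetaCoeff q j| * |(1 : ℝ)| ^ j, fun t ht0 ht1 => ?_⟩
  rw [← Real.norm_eq_abs]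
  refine tsum_of_norm_bounded hsum.hasSum fun j => ?_
  rw [norm_mul, norm_pow, Real.norm_eq_abs, Real.norm_eq_abs]
  gcongr

/-- Comparison of two theta functions with nearby parameters. -/
theorem abs_thetaR_sub_le {p q : ℝ} (hp0 : 0 < p) (hpq : p < q) (hq : q ≤ 1 / 3)
    (hreg : RegularOnUnit (thetaR p)) {t : ℝ} (ht0 : 0 ≤ t) (ht1 : t ≤ 1) :
    |thetaR q t - thetaR p t| ≤ 9 / 8 * (q - p) * t ^ 2 := by
  have hstep : ∀ t, 0 ≤ t → t ≤ 1 → |thetaR q t - thetaR p t| ≤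
      (q - p) * t ^ 2 + t * |thetaR q (q * t) - thetaR p (q * t)| := by
    intro t h0 h1
    have hmono : p * t ≤ q * t := by gcongr
    have e1 := hreg.sub_le (p * t) (q * t) (by positivity) hmono (by nlinarith)
    have e2 : 0 ≤ thetaR p (p * t) - thetaR p (q * t) := by
      refine le_trans (mul_nonneg ?_ ?_) (hreg.le_sub (p * t) (q * t) (by positivity) hmono
        (by nlinarith)) <;> nlinarith
    have e3 : thetaR q t - thetaR p t = t * (thetaR p (p * t) - thetaR p (q * t))
        - t * (thetaR q (q * t) - thetaR p (q * t)) := by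
      rw [thetaR_eq (q := q) (by linarith) (by linarith) t,
        thetaR_eq (q := p) (by linarith) (by linarith) t]
      ring
    rw [e3]
    refine (abs_sub _ _).trans (add_le_add ?_ ?_)
    · rw [abs_of_nonneg (by positivity)]
      nlinarith
    · rw [abs_mul, abs_of_nonneg h0]
  obtain ⟨M₁, hM₁⟩ := exists_abs_thetaR_le (q := q) (by linarith) (by linarith)
  obtain ⟨M₂, hM₂⟩ := exists_abs_thetaR_le (q := p) (by linarith) (by linarith)
  have hM : ∀ t, 0 ≤ t → t ≤ 1 → |thetaR q t - thetaR p t| ≤ M₁ + M₂ := fun t h0 h1 =>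
    (abs_sub _ _).trans (add_le_add (hM₁ t h0 h1) (hM₂ t h0 h1))
  have hM0 : 0 ≤ M₁ + M₂ := (abs_nonneg _).trans (hM 0 le_rfl zero_le_one)
  have hiter : ∀ N : ℕ, ∀ t, 0 ≤ t → t ≤ 1 → |thetaR q t - thetaR p t| ≤
      9 / 8 * (q - p) * t ^ 2 + (M₁ + M₂) * (1 / 3) ^ N * t := by
    intro N
    induction N with
    | zero =>
      intro t h0 h1
      have e1 := hstep t h0 h1
      have e2 := mul_le_mul_of_nonneg_left (hM (q * t) (by nlinarith) (by nlinarith)) h0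
      nlinarith [mul_nonneg (sub_nonneg.mpr hpq.le) (sq_nonneg t)]
    | succ N ih =>
      intro t h0 h1
      have e1 := hstep t h0 h1
      have e2 := mul_le_mul_of_nonneg_left (ih (q * t) (by nlinarith) (by nlinarith)) h0
      have e3 : 0 ≤ (M₁ + M₂) * (1 / 3) ^ N := by positivity
      have hq0 : 0 < q := hp0.trans hpq
      have e4 : t * ((M₁ + M₂) * (1 / 3) ^ N * (q * t)) ≤ (M₁ + M₂) * (1 / 3) ^ (N + 1) * t := by
        have : q * t ≤ 1 / 3 := by nlinarith
        calc t * ((M₁ + M₂) * (1 / 3) ^ N * (q * t)) ≤ t * ((M₁ + M₂) * (1 / 3) ^ N * (1 / 3)) := by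
              gcongr
          _ = _ := by ring
      have e5 : t * (9 / 8 * (q - p) * (q * t) ^ 2) ≤ 1 / 8 * (q - p) * t ^ 2 := by
        have e6 : t * q ^ 2 ≤ 1 / 9 := by
          have : q ^ 2 ≤ 1 / 9 := by nlinarith
          nlinarith [sq_nonneg q]
        have e7 : 0 ≤ (q - p) * t ^ 2 := mul_nonneg (by linarith) (sq_nonneg t)
        nlinarith
      linarith
  have hlim : Tendsto (fun N : ℕ => 9 / 8 * (q - p) * t ^ 2 + (M₁ + M₂) * (1 / 3) ^ N * t) atTop
      (nhds (9 / 8 * (q - p) * t ^ 2 + (M₁ + M₂) * 0 * t)) :=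
    (((tendsto_pow_atTop_nhds_zero_of_lt_one (by norm_num) (by norm_num)).const_mul _).mul_const
      t).const_add _
  have := ge_of_tendsto' hlim fun N => hiter N t ht0 ht1
  linarith

theorem le_of_hyperbolic_theta {p q : ℝ} (hp : Tendsto (fun n => peak (gPoly n)) atTop (nhds p))
    (h0 : 0 < q) (h1 : q < 1) (h : ∀ s : ℂ, seriesC (thetaCoeff q) s = 0 → s.im = 0) : q ≤ p := by
  by_contra! hpq
  obtain ⟨hp0, hp1⟩ := bounds_of_tendsto_peak hp
  obtain ⟨hq3, t, ht0, ht1, ht⟩ := exists_zero_of_hyperbolic_theta h0 h1 h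
  have hreg := regular_thetaR hp
  have hple := mul_thetaR_le hp ht0.le ht1
  have hp' : 0 < p := by linarith
  have hdiff : ∀ s, thetaR q s - thetaR p s = s * (thetaR p (p * s) - thetaR p (q * s))
      - s * (thetaR q (q * s) - thetaR p (q * s)) := by
    intro s
    rw [thetaR_eq (q := q) (by linarith) (by linarith) s,
      thetaR_eq (q := p) (by linarith) (by linarith) s]
    ring
  have hpos : 0 < thetaR q (q * t) - thetaR p (q * t) := by
    have hu0 : 0 < q * t := by positivity
    have hu1 : q * t ≤ 1 / 3 := by nlinarith
    set u := q * t
    rw [hdiff u]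
    have hmono : p * u ≤ q * u := by gcongr
    have e1 := hreg.le_sub (p * u) (q * u) (by positivity) hmono (by nlinarith)
    have e2 := (abs_le.mp (abs_thetaR_sub_le hp' hpq hq3 hreg (t := q * u) (by positivity)
      (by nlinarith))).2
    have e3 : p * u + q * u ≤ 2 / 9 := by nlinarith
    have e4 : (q - p) * u * 0.9 ≤ (q * u - p * u) * (1 - 0.32 * (p * u + q * u)) := by
      have : 0 ≤ (q - p) * u := mul_nonneg (by linarith) hu0.le
      nlinarith
    have e5 : 9 / 8 * (q - p) * (q * u) ^ 2 ≤ (q - p) * u * 0.1 := by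
      have e6 : 9 / 8 * (q ^ 2 * u) ≤ 0.1 := by
        have : q ^ 2 ≤ 1 / 9 := by nlinarith
        nlinarith [sq_nonneg q]
      have : 0 ≤ (q - p) * u := mul_nonneg (by linarith) hu0.le
      nlinarith
    have e7 : 0 < (q - p) * u := mul_pos (by linarith) hu0
    rw [← mul_sub]
    refine mul_pos hu0 ?_
    linarith
  have hmono : p * t ≤ q * t := by gcongr
  have e1 := hreg.sub_le (p * t) (q * t) (by positivity) hmono (by nlinarith)
  have e2 := hdiff t
  have e3 : t * (thetaR q t - thetaR p t) < q - p := by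
    have e4 : thetaR q t - thetaR p t < (q - p) * t ^ 2 := by
      nlinarith [mul_pos ht0 hpos]
    have e5 : t ^ 3 ≤ 1 := pow_le_one₀ ht0.le ht1
    nlinarith
  linarith

/-- The double roots of the normalized polynomials converge to a zero of `θ_q` at which `θ_q` has a
local minimum. -/
theorem tendsto_double_roots {q z : ℝ} (hq : Tendsto (fun n => peak (gPoly n)) atTop (nhds q))
    (hz : ∀ y, thetaR q y = 0 → IsLocalMin (thetaR q) y → y = z) {w : ℕ → ℝ}
    (hw : ∀ n, (X - C (w n)) ^ 2 ∣ gPoly (n + 2)) : Tendsto w atTop (nhds z) := by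
  obtain ⟨hq0, hq1⟩ := bounds_of_tendsto_peak hq
  have hmem : ∀ n, w n ∈ Set.Icc (1 : ℝ) 3.6 := by
    intro n
    obtain ⟨h1, h2⟩ := bounds_of_sq_dvd_gPoly (hw n)
    have h3 := (regular_gPoly (n := n + 1) (by omega)).quarter_le_peak
    exact ⟨h1, by nlinarith⟩
  refine tendsto_of_subseq_tendsto fun ns hns => ?_
  obtain ⟨y, hy, ms, hms, hlim⟩ := isCompact_Icc.tendsto_subseq fun n => hmem (ns n)
  have hk : Tendsto (fun n => ns (ms n)) atTop atTop := hns.comp hms.tendsto_atTop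
  refine ⟨ms, ?_⟩
  suffices y = z by rw [← this]; exact hlim
  have hy9 : q * y ≤ 0.9 := by
    refine le_of_tendsto' (((hq.comp (tendsto_add_atTop_nat 1)).comp hk).mul hlim) fun n => ?_
    exact (bounds_of_sq_dvd_gPoly (hw (ns (ms n)))).2
  have hy0 : thetaR q y = 0 := by
    refine tendsto_nhds_unique
      (tendsto_eval_gPoly hq ((tendsto_add_atTop_nat 2).comp hk) hlim) ?_
    refine tendsto_const_nhds.congr fun n => ?_
    exact (dvd_iff_isRoot.mp ((dvd_pow_self _ two_ne_zero).trans (hw (ns (ms n))))).symm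
  refine hz y hy0 ?_
  have hqp : 0 < q := by linarith
  filter_upwards [Ioo_mem_nhds (show (0 : ℝ) < y by linarith [hy.1])
    (show y < 1 / q by rw [lt_div_iff₀ hqp]; linarith)] with s hs
  rw [hy0]
  refine thetaR_nonneg hq hs.1.le ?_
  have := hs.2
  rw [lt_div_iff₀ hqp] at this
  linarith

/-- Let `q̃` be the largest `q ∈ (0,1)` for which all complex zeros of `u ↦ Ψ(q,u)` are real,
let `ũ` be the unique real double root of `u ↦ Ψ(q̃,u)`, and for `i ≥ 2` let `ζ_i` be a double
root of the reverted polynomial `P_i`.  Then the scaled reverted polynomials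
`P̃_i(x) = P_i(-ζ_i x)/P_i(0)` converge pointwise to `Ψ(q̃, -ũ x)`. -/
theorem stmt7 (qt : ℝ) (hqt1 : qt ∈ Set.Ioo (0 : ℝ) 1)
    (hqt2 : ∀ u : ℂ, PsiC qt u = 0 → u.im = 0)
    (hqt3 : ∀ q ∈ Set.Ioo (0 : ℝ) 1, (∀ u : ℂ, PsiC q u = 0 → u.im = 0) → q ≤ qt)
    (ut : ℝ) (hut : PsiR qt ut = 0 ∧ deriv (PsiR qt) ut = 0)
    (hutu : ∀ u : ℝ, PsiR qt u = 0 → deriv (PsiR qt) u = 0 → u = ut)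
    (ζ : ℕ → ℝ)
    (hζ : ∀ i, 2 ≤ i → (Polynomial.X - Polynomial.C (ζ i)) ^ 2 ∣ Prev i) :
    ∀ x : ℝ,
      Tendsto (fun i : ℕ => (Prev i).eval (-(ζ i) * x) / (Prev i).eval 0)
        atTop (nhds (PsiR qt (-ut * x))) := by
  intro x
  obtain ⟨hq0, hq1⟩ := hqt1
  obtain ⟨p, hp⟩ := exists_tendsto_peak
  obtain ⟨hp0, hp1⟩ := bounds_of_tendsto_peak hp
  obtain rfl : p = qt := le_antisymm
    (hqt3 p ⟨by linarith, by linarith⟩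
      ((forall_PsiC_iff (by linarith)).mpr (im_eq_zero_of_seriesC_thetaCoeff hp)))
    (le_of_hyperbolic_theta hp hq0 hq1 ((forall_PsiC_iff hq0).mp hqt2))
  choose w hw1 hw2 using fun n => exists_double_root_gPoly (hζ (n + 2) (by omega))
  have hlim : Tendsto w atTop (nhds (-p * ut)) := by
    refine tendsto_double_roots hp (fun y hy hmin => ?_) hw1
    have hmul : -p * (-y / p) = y := by field_simp
    have h1 : IsLocalMin (PsiR p) (-y / p) := by
      have hc : ContinuousAt (fun u => -p * u) (-y / p) := by fun_prop
      have h2 := hc.tendsto.eventually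
        (show ∀ᶠ s in nhds (-p * (-y / p)), thetaR p y ≤ thetaR p s by rw [hmul]; exact hmin)
      filter_upwards [h2] with u hu
      rwa [PsiR_eq, PsiR_eq, hmul]
    rw [← hutu _ (by rw [PsiR_eq, hmul, hy]) h1.deriv_eq_zero, hmul]
  rw [← tendsto_add_atTop_iff_nat 2, PsiR_eq]
  have h3 := tendsto_eval_gPoly hp (tendsto_add_atTop_nat 2) (hlim.neg.mul_const x)
  rw [show -p * (-ut * x) = -(-p * ut) * x by ring]
  exact h3.congr fun n => (hw2 n x).symm
end

section
/- For all integers k and s with 1 ≤ s ≤ k−2, the sign of S_k(ξ_s) equals (−1)^{k−s+1}; in particular S_k(ξ_s) ≠ 0. -/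
open Polynomial Filter

/-- The data of the iteration: `S 1` is a monic polynomial of degree `d ≥ 2` with all roots
real, negative and simple, whose rightmost local minimum point has the strictly largest value
among all local minima; for `j ≥ 1`, `ξ j` is a local minimum point of `S j` at which `S j`
attains the largest value among all of its local minima, and
`S (j+1) (x) = x (S j (x) - S j (ξ j))`. -/
def GoodSetup (S : ℕ → Polynomial ℝ) (ξ : ℕ → ℝ) (d : ℕ) : Prop :=
  2 ≤ d ∧ (S 1).Monic ∧ (S 1).natDegree = d ∧
  (∀ z : ℂ, Polynomial.aeval z (S 1) = 0 → z.im = 0) ∧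
  (∀ x : ℝ, (S 1).IsRoot x → x < 0) ∧
  Squarefree (S 1) ∧
  (∃ xr : ℝ, IsLocalMin (fun x => (S 1).eval x) xr ∧
    (∀ y : ℝ, IsLocalMin (fun x => (S 1).eval x) y → y ≤ xr) ∧
    (∀ y : ℝ, IsLocalMin (fun x => (S 1).eval x) y → y ≠ xr →
      (S 1).eval y < (S 1).eval xr)) ∧
  (∀ j, 1 ≤ j →
    IsLocalMin (fun x => (S j).eval x) (ξ j) ∧
    (∀ y : ℝ, IsLocalMin (fun x => (S j).eval x) y → (S j).eval y ≤ (S j).eval (ξ j)) ∧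
    S (j + 1) = Polynomial.X * (S j - Polynomial.C ((S j).eval (ξ j))))

/-- `r 0 > r 1 ≥ r 2 > r 3 ≥ ⋯` lists the `n` roots of the monic polynomial `P` in decreasing
order, each negative well of `P` being nondegenerate. -/
structure RootChain (P : ℝ[X]) (n : ℕ) (r : ℕ → ℝ) : Prop where
  pos : 0 < n
  eq_prod : P = ∏ i ∈ Finset.range n, (X - C (r i))
  anti : ∀ i j, i ≤ j → j < n → r j ≤ r i
  strict : ∀ i, 2 * i + 1 < n → r (2 * i + 1) < r (2 * i)

namespace RootChain

variable {P : ℝ[X]} {n : ℕ} {r : ℕ → ℝ}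

theorem eval_eq (h : RootChain P n r) (x : ℝ) :
    P.eval x = ∏ i ∈ Finset.range n, (x - r i) := by
  rw [h.eq_prod, eval_prod]
  simp

theorem monic (h : RootChain P n r) : P.Monic := by
  rw [h.eq_prod]
  exact monic_prod_of_monic _ _ fun i _ => monic_X_sub_C _

theorem natDegree_eq (h : RootChain P n r) : P.natDegree = n := by
  rw [h.eq_prod, natDegree_prod_of_monic _ _ fun i _ => monic_X_sub_C _]
  simp

theorem eval_root (h : RootChain P n r) {i : ℕ} (hi : i < n) : P.eval (r i) = 0 := by
  rw [h.eval_eq]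
  exact Finset.prod_eq_zero (Finset.mem_range.2 hi) (sub_self _)

theorem eval_nonneg (h : RootChain P n r) {x : ℝ} (hx : r 0 ≤ x) : 0 ≤ P.eval x := by
  rw [h.eval_eq]
  refine Finset.prod_nonneg fun i hi => ?_
  have := h.anti 0 i (Nat.zero_le _) (Finset.mem_range.1 hi)
  linarith

/-- `P` is negative on each well. -/
theorem eval_neg (h : RootChain P n r) {i : ℕ} (hi : 2 * i < n) {x : ℝ} (hx : x < r (2 * i))
    (hx' : 2 * i + 1 < n → r (2 * i + 1) < x) : P.eval x < 0 := by
  rw [h.eval_eq, ← Finset.prod_range_mul_prod_Ico _ (show 2 * i + 1 ≤ n by omega)]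
  refine mul_neg_of_neg_of_pos ?_ ?_
  · have hprod : ∏ k ∈ Finset.range (2 * i + 1), (x - r k)
        = -∏ k ∈ Finset.range (2 * i + 1), (r k - x) := by
      have : ∀ k ∈ Finset.range (2 * i + 1), x - r k = (-1) * (r k - x) := fun k _ => by ring
      rw [Finset.prod_congr rfl this, Finset.prod_mul_distrib]
      simp [pow_succ, pow_mul]
    rw [hprod, neg_lt_zero]
    refine Finset.prod_pos fun k hk => ?_
    have := h.anti k (2 * i) (by have := Finset.mem_range.1 hk; omega) hi
    linarith
  · refine Finset.prod_pos fun k hk => ?_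
    obtain ⟨hk, hkn⟩ := Finset.mem_Ico.1 hk
    have := h.anti (2 * i + 1) k hk hkn
    have := hx' (by omega)
    linarith

theorem eval_nonpos_of_isLocalMin (h : RootChain P n r) {y : ℝ}
    (hy : IsLocalMin (fun x => P.eval x) y) : P.eval y ≤ 0 := by
  by_contra! hpos
  have hne : ∀ i ∈ Finset.range n, y - r i ≠ 0 := by
    rw [h.eval_eq] at hpos
    exact Finset.prod_ne_zero_iff.1 hpos.ne'
  have hsmall : ∀ᶠ t in nhds (0 : ℝ), ∀ i ∈ Finset.range n, t ^ 2 < (y - r i) ^ 2 := by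
    rw [Finset.eventually_all]
    intro i hi
    have hc : ContinuousAt (fun t : ℝ => t ^ 2) 0 := by fun_prop
    exact hc.eventually (gt_mem_nhds (by simpa using pow_pos (abs_pos.2 (hne i hi)) 2))
  have hr : ∀ᶠ t in nhds (0 : ℝ), P.eval y ≤ P.eval (y + t) := by
    have hc : Tendsto (fun t : ℝ => y + t) (nhds 0) (nhds y) := by
      have : ContinuousAt (fun t : ℝ => y + t) 0 := by fun_prop
      simpa [ContinuousAt] using this
    exact hc.eventually hy
  have hl : ∀ᶠ t in nhds (0 : ℝ), P.eval y ≤ P.eval (y - t) := by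
    have hc : Tendsto (fun t : ℝ => y - t) (nhds 0) (nhds y) := by
      have : ContinuousAt (fun t : ℝ => y - t) 0 := by fun_prop
      simpa [ContinuousAt] using this
    exact hc.eventually hy
  have hall := (hsmall.and (hr.and hl)).filter_mono (nhdsWithin_le_nhds (s := Set.Ioi 0))
  obtain ⟨t, ⟨ht, htr, htl⟩, ht0⟩ := (hall.and self_mem_nhdsWithin).exists
  have hlt : P.eval (y + t) * P.eval (y - t) < P.eval y * P.eval y := by
    simp only [h.eval_eq, ← Finset.prod_mul_distrib]
    refine Finset.prod_lt_prod_of_nonempty (fun i hi => ?_) (fun i hi => ?_)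
      (Finset.nonempty_range_iff.2 h.pos.ne')
    · nlinarith [ht i hi]
    · nlinarith [ht i hi]
  nlinarith

theorem eval_neg_of_isLocalMin (h : RootChain P n r) {y : ℝ}
    (hy : IsLocalMin (fun x => P.eval x) y) : P.eval y < 0 := by
  refine lt_of_le_of_ne (h.eval_nonpos_of_isLocalMin hy) fun h0 => ?_
  have hroot := h0
  rw [h.eval_eq, Finset.prod_eq_zero_iff] at hroot
  obtain ⟨k, hk, hyk⟩ := hroot
  rw [Finset.mem_range] at hk
  obtain rfl : y = r k := by linarith
  obtain ⟨i, rfl | rfl⟩ := Nat.even_or_odd' k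
  · have hlow : ∃ b < r (2 * i), 2 * i + 1 < n → r (2 * i + 1) ≤ b := by
      by_cases hi : 2 * i + 1 < n
      · exact ⟨_, h.strict i hi, fun _ => le_rfl⟩
      · exact ⟨r (2 * i) - 1, by linarith, fun h => absurd h hi⟩
    obtain ⟨b, hb, hbr⟩ := hlow
    obtain ⟨x, hx, hbx, hxr⟩ :=
      ((hy.filter_mono (nhdsWithin_le_nhds (s := Set.Iio (r (2 * i))))).and
        (Ioo_mem_nhdsLT hb)).exists
    have := h.eval_neg hk hxr fun hi => (hbr hi).trans_lt hbx
    linarith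
  · obtain ⟨x, hx, hbx, hxr⟩ :=
      ((hy.filter_mono (nhdsWithin_le_nhds (s := Set.Ioi (r (2 * i + 1))))).and
        (Ioo_mem_nhdsGT (h.strict i hk))).exists
    have := h.eval_neg (by omega) hxr fun _ => hbx
    linarith

theorem lt_of_isLocalMin (h : RootChain P n r) {y : ℝ}
    (hy : IsLocalMin (fun x => P.eval x) y) : y < r 0 := by
  by_contra! hle
  exact (h.eval_nonneg hle).not_gt (h.eval_neg_of_isLocalMin hy)

/-- Every bounded well contains a local minimum. -/
theorem exists_isLocalMin (h : RootChain P n r) {i : ℕ} (hi : 2 * i + 1 < n) :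
    ∃ y ∈ Set.Ioo (r (2 * i + 1)) (r (2 * i)), IsLocalMin (fun x => P.eval x) y := by
  have hlt := h.strict i hi
  refine (isCompact_Icc (a := r (2 * i + 1)) (b := r (2 * i))).exists_isLocalMin_mem_open
    (z := (r (2 * i + 1) + r (2 * i)) / 2) Set.Ioo_subset_Icc_self P.continuous.continuousOn
    ⟨by linarith, by linarith⟩ (fun z hz => ?_) isOpen_Ioo
  have hneg := h.eval_neg (i := i) (by omega) (x := (r (2 * i + 1) + r (2 * i)) / 2)
    (by linarith) fun _ => by linarith
  have : z = r (2 * i + 1) ∨ z = r (2 * i) := by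
    have hz2 := hz.2
    rw [Set.mem_Ioo, not_and_or, not_lt, not_lt] at hz2
    exact hz2.imp (fun h => le_antisymm h hz.1.1) (fun h => le_antisymm hz.1.2 h)
  rcases this with rfl | rfl
  · rwa [h.eval_root hi]
  · rwa [h.eval_root (by omega)]

theorem X_sub_C_isCoprime {a b : ℝ} (hab : a ≠ b) : IsCoprime (X - C a) (X - C b) :=
  isCoprime_X_sub_C_of_isUnit_sub (sub_ne_zero.2 hab).isUnit

/-- A level `m < 0` above all local minimum values is attained twice in each bounded well. -/
theorem exists_pair_dvd (h : RootChain P n r) {m : ℝ} (hm : m < 0)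
    (hmin : ∀ y, IsLocalMin (fun x => P.eval x) y → P.eval y ≤ m) {i : ℕ} (hi : 2 * i + 1 < n) :
    ∃ u v, v ≤ u ∧ u < r (2 * i) ∧ r (2 * i + 1) < v ∧
      (X - C u) * (X - C v) ∣ P - C m := by
  obtain ⟨y, ⟨hby, hya⟩, hy⟩ := h.exists_isLocalMin hi
  rcases (hmin y hy).eq_or_lt with heq | hlt
  · refine ⟨y, y, le_rfl, hya, hby, ?_⟩
    have hne : P - C m ≠ 0 := by
      intro h0
      have := congrArg (eval (r (2 * i + 1))) h0
      rw [eval_sub, eval_C, h.eval_root hi, eval_zero] at this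
      linarith
    rw [← sq, ← le_rootMultiplicity_iff hne]
    refine (one_lt_rootMultiplicity_iff_isRoot hne).2 ⟨by simp [heq], ?_⟩
    have := hy.deriv_eq_zero
    rw [Polynomial.deriv] at this
    simp [this]
  · obtain ⟨u, hu, hum⟩ := intermediate_value_Ioo hya.le P.continuous.continuousOn
      (show m ∈ Set.Ioo (P.eval y) (P.eval (r (2 * i))) from
        ⟨hlt, by rwa [h.eval_root (by omega)]⟩)
    obtain ⟨v, hv, hvm⟩ := intermediate_value_Ioo' hby.le P.continuous.continuousOn
      (show m ∈ Set.Ioo (P.eval y) (P.eval (r (2 * i + 1))) from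
        ⟨hlt, by rwa [h.eval_root hi]⟩)
    have hvu : v < u := hv.2.trans hu.1
    refine ⟨u, v, hvu.le, hu.2, hv.1, (X_sub_C_isCoprime hvu.ne').mul_dvd ?_ ?_⟩
    · exact dvd_iff_isRoot.2 (by simp_all)
    · exact dvd_iff_isRoot.2 (by simp_all)

/-- A negative level is attained in the unbounded well. -/
theorem exists_dvd_of_odd (h : RootChain P n r) {m : ℝ} (hm : m < 0) {i : ℕ}
    (hi : 2 * i + 1 = n) : ∃ u < r (2 * i), (X - C u) ∣ P - C m := by
  have hlow : P.eval (r (2 * i) - (1 - m)) < m := by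
    have hprod : P.eval (r (2 * i) - (1 - m))
        = -∏ k ∈ Finset.range n, (r k - r (2 * i) + (1 - m)) := by
      have : ∀ k ∈ Finset.range n, r (2 * i) - (1 - m) - r k
          = (-1) * (r k - r (2 * i) + (1 - m)) := fun k _ => by ring
      rw [h.eval_eq, Finset.prod_congr rfl this, Finset.prod_mul_distrib]
      simp [← hi, pow_succ, pow_mul]
    have hle : (1 - m) ^ n ≤ ∏ k ∈ Finset.range n, (r k - r (2 * i) + (1 - m)) := by
      calc (1 - m) ^ n = ∏ k ∈ Finset.range n, (1 - m) := by simp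
        _ ≤ _ := Finset.prod_le_prod (fun _ _ => by linarith) fun k hk => by
          have := h.anti k (2 * i) (by have := Finset.mem_range.1 hk; omega) (by omega)
          linarith
    have := le_self_pow₀ (show 1 ≤ 1 - m by linarith) h.pos.ne'
    linarith
  obtain ⟨u, hu, hum⟩ := intermediate_value_Ioo (by linarith) P.continuous.continuousOn
    (show m ∈ Set.Ioo (P.eval (r (2 * i) - (1 - m))) (P.eval (r (2 * i))) from
      ⟨hlow, by rwa [h.eval_root (by omega)]⟩)
  exact ⟨u, hu.2, dvd_iff_isRoot.2 (by simp_all)⟩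

/-- Shifting by a level `m < 0` above all local minimum values and multiplying by `X`
preserves root chains. -/
theorem X_mul_sub_C (h : RootChain P n r) (h0 : r 0 ≤ 0) {m : ℝ} (hm : m < 0)
    (hmin : ∀ y, IsLocalMin (fun x => P.eval x) y → P.eval y ≤ m) :
    ∃ r', RootChain (X * (P - C m)) (n + 1) r' ∧ r' 0 = 0 := by
  have hex : ∀ i, ∃ u v : ℝ, (2 * i < n → u < r (2 * i) ∧ X - C u ∣ P - C m) ∧
      (2 * i + 1 < n → v ≤ u ∧ r (2 * i + 1) < v ∧ (X - C u) * (X - C v) ∣ P - C m) := by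
    intro i
    rcases lt_trichotomy (2 * i + 1) n with hi | hi | hi
    · obtain ⟨u, v, hvu, hur, hrv, hd⟩ := h.exists_pair_dvd hm hmin hi
      exact ⟨u, v, fun _ => ⟨hur, (dvd_mul_right _ _).trans hd⟩, fun _ => ⟨hvu, hrv, hd⟩⟩
    · obtain ⟨u, hu, hd⟩ := h.exists_dvd_of_odd hm hi
      exact ⟨u, 0, fun _ => ⟨hu, hd⟩, fun hi' => by omega⟩
    · exact ⟨0, 0, fun _ => by omega, fun _ => by omega⟩
  choose u v hu hv using hex
  obtain ⟨q, hqe, hqo⟩ : ∃ q : ℕ → ℝ, (∀ i, q (2 * i) = u i) ∧ ∀ i, q (2 * i + 1) = v i := by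
    refine ⟨fun k => if k % 2 = 0 then u (k / 2) else v (k / 2), fun i => ?_, fun i => ?_⟩
    · simp
    · have h1 : (2 * i + 1) % 2 = 1 := by omega
      have h2 : (2 * i + 1) / 2 = i := by omega
      simp [h1, h2]
  have hgap : ∀ i, 2 * i + 2 < n → u (i + 1) < v i := fun i hi =>
    (hu (i + 1) (by omega)).1.trans_le
      ((h.anti (2 * i + 1) (2 * (i + 1)) (by omega) (by omega)).trans
        (hv i (by omega)).2.1.le)
  have hsucc : ∀ k, k + 1 < n → q (k + 1) ≤ q k := by
    intro k hk
    obtain ⟨i, rfl | rfl⟩ := Nat.even_or_odd' k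
    · rw [hqe, hqo]
      exact (hv i hk).1
    · rw [hqo, show 2 * i + 1 + 1 = 2 * (i + 1) by ring, hqe]
      exact (hgap i hk).le
  have hanti : ∀ i j, i ≤ j → j < n → q j ≤ q i := by
    intro i j hij
    induction j, hij using Nat.le_induction with
    | base => exact fun _ => le_rfl
    | succ j _ ih => exact fun hj => (hsucc j hj).trans (ih (by omega))
  have hcop : ∀ l, 2 * l < n → ∀ c ≤ u l,
      IsCoprime (∏ k ∈ Finset.range (2 * l), (X - C (q k))) (X - C c) := by
    intro l hl c hc
    refine IsCoprime.prod_left fun k hk => X_sub_C_isCoprime (ne_of_gt ?_)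
    have hk := Finset.mem_range.1 hk
    obtain ⟨l, rfl⟩ : ∃ l', l = l' + 1 := ⟨l - 1, by omega⟩
    have h1 := hanti k (2 * l + 1) (by omega) (by omega)
    rw [hqo] at h1
    exact (hc.trans_lt (hgap l (by omega))).trans_le h1
  have hdvd_even : ∀ l, 2 * l ≤ n → ∏ k ∈ Finset.range (2 * l), (X - C (q k)) ∣ P - C m := by
    intro l
    induction l with
    | zero => simp
    | succ l ih =>
      intro hl
      rw [show 2 * (l + 1) = 2 * l + 1 + 1 by ring, Finset.prod_range_succ,
        Finset.prod_range_succ, hqe, hqo, mul_assoc]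
      have hvl := hv l (by omega)
      exact ((hcop l (by omega) _ le_rfl).mul_right (hcop l (by omega) _ hvl.1)).mul_dvd
        (ih (by omega)) hvl.2.2
  have hdvd : ∏ k ∈ Finset.range n, (X - C (q k)) ∣ P - C m := by
    obtain ⟨l, hl | hl⟩ := Nat.even_or_odd' n
    · rw [hl]
      exact hdvd_even l hl.ge
    · rw [hl, Finset.prod_range_succ, hqe]
      exact (hcop l (by omega) _ le_rfl).mul_dvd (hdvd_even l (by omega)) (hu l (by omega)).2
  have hdeg : 0 < P.natDegree := h.natDegree_eq ▸ h.pos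
  have hprod : P - C m = ∏ k ∈ Finset.range n, (X - C (q k)) := by
    refine eq_of_monic_of_dvd_of_natDegree_le (monic_prod_of_monic _ _ fun i _ => monic_X_sub_C _)
      (h.monic.sub_of_left ?_) hdvd ?_
    · exact degree_C_le.trans_lt (natDegree_pos_iff_degree_pos.1 hdeg)
    · rw [natDegree_sub_C, h.natDegree_eq,
        natDegree_prod_of_monic _ _ fun i _ => monic_X_sub_C _]
      simp
  have hq0 : q 0 < 0 := by
    have := (hu 0 (by have := h.pos; omega)).1
    rw [← hqe] at this
    exact this.trans_le h0
  refine ⟨fun k => k.casesOn 0 q, ⟨n.succ_pos, ?_, ?_, ?_⟩, rfl⟩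
  · rw [Finset.prod_range_succ', hprod, mul_comm]
    simp
  · rintro (_ | i) (_ | j) hij hj
    · exact le_rfl
    · exact (hanti 0 j (Nat.zero_le _) (by omega)).trans hq0.le
    · omega
    · exact hanti i j (by omega) (by omega)
  · rintro (_ | i) hi
    · exact hq0
    · change q (2 * i + 1 + 1) < q (2 * i + 1)
      rw [hqo, show 2 * i + 1 + 1 = 2 * (i + 1) by ring, hqe]
      exact hgap i (by omega)

end RootChain

theorem splits_of_forall_root_im_eq_zero {P : ℝ[X]}
    (hP : ∀ z : ℂ, aeval z P = 0 → z.im = 0) : P.Splits := by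
  refine Splits.of_splits_map (algebraMap ℝ ℂ) (IsAlgClosed.splits _) fun z hz => ?_
  have hz0 : aeval z P = 0 := by
    rw [← eval_map_algebraMap]
    exact isRoot_of_mem_roots hz
  exact ⟨z.re, Complex.ext rfl (by simp [hP z hz0])⟩

theorem exists_rootChain {P : ℝ[X]} (hP : P.Monic) (hs : P.Splits) (hsq : Squarefree P)
    (hd : 0 < P.natDegree) : ∃ r, RootChain P P.natDegree r ∧ P.IsRoot (r 0) := by
  set l := P.roots.sort (· ≥ ·) with hl
  have hlen : l.length = P.natDegree := by
    rw [hl, Multiset.length_sort, ← hs.natDegree_eq_card_roots]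
  have hcoe : (l : Multiset ℝ) = P.roots := Multiset.sort_eq _ _
  have hnodup : l.Nodup := by
    rw [← Multiset.coe_nodup, hcoe]
    exact nodup_roots (PerfectField.separable_iff_squarefree.2 hsq)
  have hpair : l.Pairwise (· ≥ ·) := Multiset.pairwise_sort _ _
  have hget : ∀ i (hi : i < l.length), l.getD i 0 = l[i] := fun i hi => by simp [hi]
  have hstrict : ∀ i j, i < j → j < P.natDegree → l.getD j 0 < l.getD i 0 := by
    intro i j hij hj
    rw [hget i (by omega), hget j (by omega)]
    refine lt_of_le_of_ne (List.pairwise_iff_getElem.1 hpair i j (by omega) (by omega) hij) ?_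
    intro he
    exact hij.ne' ((hnodup.getElem_inj_iff).1 he)
  refine ⟨fun i => l.getD i 0, ⟨hd, ?_, fun i j hij hj => ?_, fun i hi => ?_⟩, ?_⟩
  · conv_lhs => rw [hs.eq_prod_roots_of_monic hP, ← hcoe]
    rw [Multiset.map_coe, Multiset.prod_coe, ← hlen, Finset.prod_range, ← List.prod_ofFn]
    congr 1
    refine List.ext_getElem (by simp) fun i h1 h2 => ?_
    simp
  · rcases hij.eq_or_lt with rfl | hij
    · exact le_rfl
    · exact (hstrict i j hij hj).le
  · exact hstrict _ _ (by omega) hi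
  · have h0 : 0 < l.length := by omega
    refine isRoot_of_mem_roots ?_
    rw [← hcoe, Multiset.mem_coe]
    change l.getD 0 0 ∈ l
    rw [hget 0 h0]
    exact List.getElem_mem h0

namespace GoodSetup

variable {S : ℕ → ℝ[X]} {ξ : ℕ → ℝ} {d : ℕ}

theorem isLocalMin (h : GoodSetup S ξ d) {j : ℕ} (hj : 1 ≤ j) :
    IsLocalMin (fun x => (S j).eval x) (ξ j) := (h.2.2.2.2.2.2.2 j hj).1

theorem eval_le (h : GoodSetup S ξ d) {j : ℕ} (hj : 1 ≤ j) {y : ℝ}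
    (hy : IsLocalMin (fun x => (S j).eval x) y) : (S j).eval y ≤ (S j).eval (ξ j) :=
  (h.2.2.2.2.2.2.2 j hj).2.1 y hy

theorem succ_eq (h : GoodSetup S ξ d) {j : ℕ} (hj : 1 ≤ j) :
    S (j + 1) = X * (S j - C ((S j).eval (ξ j))) := (h.2.2.2.2.2.2.2 j hj).2.2

theorem eval_succ (h : GoodSetup S ξ d) {j : ℕ} (hj : 1 ≤ j) (x : ℝ) :
    (S (j + 1)).eval x = x * ((S j).eval x - (S j).eval (ξ j)) := by
  simp [h.succ_eq hj]

theorem rootChain (h : GoodSetup S ξ d) {j : ℕ} (hj : 1 ≤ j) :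
    ∃ n r, j < n ∧ RootChain (S j) n r ∧ r 0 ≤ 0 ∧ (2 ≤ j → r 0 = 0) := by
  induction j, hj using Nat.le_induction with
  | base =>
    obtain ⟨hd, hmonic, hdeg, him, hneg, hsq, -⟩ := h
    obtain ⟨r, hr, hr0⟩ := exists_rootChain hmonic (splits_of_forall_root_im_eq_zero him) hsq
      (by omega)
    exact ⟨_, r, by omega, hr, (hneg _ hr0).le, by omega⟩
  | succ j hj ih =>
    obtain ⟨n, r, hn, hr, hr0, -⟩ := ih
    obtain ⟨r', hr', h0⟩ := hr.X_mul_sub_C hr0 (hr.eval_neg_of_isLocalMin (h.isLocalMin hj))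
      fun y hy => h.eval_le hj hy
    exact ⟨n + 1, r', by omega, h.succ_eq hj ▸ hr', h0.le, fun _ => h0⟩

theorem eval_neg (h : GoodSetup S ξ d) {j : ℕ} (hj : 1 ≤ j) : (S j).eval (ξ j) < 0 := by
  obtain ⟨n, r, -, hr, -⟩ := h.rootChain hj
  exact hr.eval_neg_of_isLocalMin (h.isLocalMin hj)

theorem neg (h : GoodSetup S ξ d) {j : ℕ} (hj : 1 ≤ j) : ξ j < 0 := by
  obtain ⟨n, r, -, hr, hr0, -⟩ := h.rootChain hj
  exact (hr.lt_of_isLocalMin (h.isLocalMin hj)).trans_le hr0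

theorem eval_succ_neg_of_nonneg (h : GoodSetup S ξ d) {j : ℕ} (hj : 1 ≤ j) {x : ℝ} (hx : x < 0)
    (hSx : 0 ≤ (S j).eval x) : (S (j + 1)).eval x < 0 := by
  rw [h.eval_succ hj]
  exact mul_neg_of_neg_of_pos hx (by linarith [h.eval_neg hj])

/-- The rightmost well of `S (j + 1)` lies inside that of `S j`, and its minimum exceeds the
value of `S (j + 1)` at any `x < 0` with `S j x ≥ 0`. -/
theorem eval_succ_succ_pos_of_nonneg (h : GoodSetup S ξ d) {j : ℕ} (hj : 2 ≤ j) {x : ℝ}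
    (hx : x < 0) (hSx : 0 ≤ (S j).eval x) : 0 < (S (j + 2)).eval x := by
  have hj1 : 1 ≤ j := by omega
  obtain ⟨n, r, hn, hr, -, hr0⟩ := h.rootChain hj1
  obtain ⟨n', r', hn', hr', -, hr0'⟩ := h.rootChain (j := j + 1) (by omega)
  replace hr0 := hr0 hj
  replace hr0' := hr0' (by omega)
  have hxr : x ≤ r 1 := by
    by_contra! hlt
    exact hSx.not_gt (hr.eval_neg (i := 0) (by omega) (by simpa [hr0] using hx) fun _ => hlt)
  obtain ⟨b, ⟨hb1, hb0⟩, hb⟩ := hr.exists_isLocalMin (i := 0) (by omega)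
  obtain ⟨y, ⟨hy1, hy0⟩, hy⟩ := hr'.exists_isLocalMin (i := 0) (by omega)
  simp only [mul_zero, zero_add, hr0, hr0'] at hb1 hb0 hy1 hy0
  have hbr : b ≤ r' 1 := by
    by_contra! hlt
    have hneg := hr'.eval_neg (i := 0) (by omega) (x := b) (by simpa [hr0'] using hb0)
      fun _ => hlt
    rw [h.eval_succ hj1] at hneg
    nlinarith [h.eval_le hj1 hb]
  have hSy : (S j).eval y < 0 :=
    hr.eval_neg (i := 0) (by omega) (by simpa [hr0] using hy0) fun _ => by
      simpa using hb1.trans (hbr.trans_lt hy1)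
  have hle := h.eval_le (j := j + 1) (by omega) hy
  have hc := h.eval_neg hj1
  have hlt : (S (j + 1)).eval x < (S (j + 1)).eval y := by
    rw [h.eval_succ hj1, h.eval_succ hj1]
    have hxy : x < y := by linarith
    nlinarith [mul_pos_of_neg_of_neg hy0 hSy, mul_nonpos_of_nonpos_of_nonneg hx.le hSx,
      mul_pos (sub_pos.2 hxy) (neg_pos.2 hc)]
  rw [h.eval_succ (j := j + 1) (by omega)]
  exact mul_pos_of_neg_of_neg hx (by linarith)

end GoodSetup

/-- For `1 ≤ s ≤ k-2`, the sign of `S_k(ξ_s)` is `(-1)^{k-s+1}`; in particular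
`S_k(ξ_s) ≠ 0`. -/
theorem stmt11 (S : ℕ → Polynomial ℝ) (ξ : ℕ → ℝ) (d : ℕ) (h : GoodSetup S ξ d) :
    ∀ k s : ℕ, 1 ≤ s → s + 2 ≤ k →
      0 < (-1 : ℝ) ^ (k - s + 1) * (S k).eval (ξ s) := by
  intro k s hs hk
  have hneg := h.neg hs
  have heven : ∀ q, 0 ≤ (S (s + 1 + 2 * q)).eval (ξ s) := by
    intro q
    induction q with
    | zero => simp [h.eval_succ hs]
    | succ q ih => exact (h.eval_succ_succ_pos_of_nonneg (by omega) hneg ih).le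
  obtain ⟨i, rfl⟩ : ∃ i, k = s + 2 + i := ⟨k - (s + 2), by omega⟩
  rw [show s + 2 + i - s + 1 = i + 3 by omega]
  obtain ⟨q, rfl | rfl⟩ := Nat.even_or_odd' i
  · have := h.eval_succ_neg_of_nonneg (by omega) hneg (heven q)
    rw [show s + 2 + 2 * q = s + 1 + 2 * q + 1 by ring]
    simpa [pow_succ, pow_mul] using this
  · have := h.eval_succ_succ_pos_of_nonneg (by omega) hneg (heven q)
    rw [show s + 2 + (2 * q + 1) = s + 1 + 2 * q + 2 by ring]
    simpa [pow_succ, pow_mul] using this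
end

section
/- The quantity A_m^2/(A_{m−1}·A_{m+1}) tends to 1/λ as m → ∞, where λ = lim_{k→∞} ξ_k/ξ_{k−1} (this limit exists and lies in (0,1)). -/
open Polynomial Filter

theorem Polynomial.Splits.derivative_real {p : ℝ[X]} (hp : p.Splits) : p.derivative.Splits := by
  rw [splits_iff_card_roots] at hp ⊢
  have h1 := p.card_roots_le_derivative
  have h2 := p.derivative.card_roots'
  have h3 := natDegree_derivative_le p
  omega

theorem multiset_prod_X_sub_C_derivatives (s : Multiset ℝ) (x : ℝ) (hx : ∀ r ∈ s, x ≠ r) :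
    (derivative (s.map fun r => X - C r).prod).eval x =
      ((s.map fun r => X - C r).prod).eval x * (s.map fun r => (x - r)⁻¹).sum ∧
    (derivative (derivative (s.map fun r => X - C r).prod)).eval x =
      ((s.map fun r => X - C r).prod).eval x *
        ((s.map fun r => (x - r)⁻¹).sum ^ 2 - (s.map fun r => (x - r)⁻¹ ^ 2).sum) := by
  induction s using Multiset.induction_on with
  | empty => simp
  | cons a s ih =>
    obtain ⟨h1, h2⟩ := ih fun r hr => hx r (Multiset.mem_cons_of_mem hr)
    have ha : x - a ≠ 0 := sub_ne_zero.2 (hx a (Multiset.mem_cons_self a s))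
    simp only [Multiset.map_cons, Multiset.prod_cons, Multiset.sum_cons, derivative_mul,
      derivative_add, derivative_sub, derivative_X, derivative_C, eval_add, eval_mul, eval_sub,
      eval_X, eval_C, h1, h2, sub_zero, one_mul]
    constructor
    · field_simp
    · field_simp
      ring

theorem Polynomial.Splits.eval_derivatives {p : ℝ[X]} (hp : p.Splits) {x : ℝ}
    (hx : p.eval x ≠ 0) :
    p.derivative.eval x = p.eval x * (p.roots.map fun r => (x - r)⁻¹).sum ∧
    p.derivative.derivative.eval x = p.eval x *
        ((p.roots.map fun r => (x - r)⁻¹).sum ^ 2 - (p.roots.map fun r => (x - r)⁻¹ ^ 2).sum) := by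
  have hr : ∀ r ∈ p.roots, x ≠ r := by
    rintro r hr rfl
    exact hx (isRoot_of_mem_roots hr)
  obtain ⟨h1, h2⟩ := multiset_prod_X_sub_C_derivatives p.roots x hr
  have hd := hp.eq_prod_roots
  set F := (p.roots.map fun r => X - C r).prod
  generalize p.roots = s at *
  rw [hd]
  simp only [derivative_C_mul, eval_C_mul, h1, h2]
  constructor <;> ring

/-- The strict Laguerre inequality at a critical point. -/
theorem Polynomial.Splits.laguerre {p : ℝ[X]} (hp : p.Splits) (hd : p.natDegree ≠ 0) {x : ℝ}
    (hx : p.eval x ≠ 0) (h0 : p.derivative.eval x = 0) :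
    p.eval x * p.derivative.derivative.eval x < 0 := by
  obtain ⟨h1, h2⟩ := hp.eval_derivatives hx
  have hs : (p.roots.map fun r => (x - r)⁻¹).sum = 0 := by
    rw [h0] at h1
    simpa [hx] using h1.symm
  have hpos : 0 < (p.roots.map fun r => (x - r)⁻¹ ^ 2).sum := by
    have hne := hp.roots_ne_zero hd
    obtain ⟨r, hr⟩ := Multiset.exists_mem_of_ne_zero hne
    have hxr : x - r ≠ 0 := by
      intro h
      apply hx
      rw [sub_eq_zero.1 h]
      exact isRoot_of_mem_roots hr
    have : 0 < (x - r)⁻¹ ^ 2 := by positivity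
    refine this.trans_le (Multiset.single_le_sum ?_ _ (Multiset.mem_map_of_mem _ hr))
    intro y hy
    obtain ⟨r, -, rfl⟩ := Multiset.mem_map.1 hy
    positivity
  rw [h2, hs]
  have : 0 < p.eval x ^ 2 := by positivity
  nlinarith

theorem splits_of_forall_aeval_im {p : ℝ[X]} (h : ∀ z : ℂ, aeval z p = 0 → z.im = 0) : p.Splits := by
  refine Splits.of_splits_map (algebraMap ℝ ℂ) (IsAlgClosed.splits _) fun z hz => ?_
  have h0 := h z (by rw [aeval_def, ← eval_map]; exact isRoot_of_mem_roots hz)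
  exact ⟨z.re, by apply Complex.ext <;> simp [h0]⟩

/-- A real polynomial all of whose critical points are real and nondegenerate, with nonpositive
values at the local minima and nonnegative values at the local maxima, is real-rooted: the
partial fraction expansion of `q / q'` maps the upper half-plane to itself. -/
theorem splits_of_critical {q : ℝ[X]} (hq : q.natDegree ≠ 0) (hD : q.derivative.Splits)
    (hcrit : ∀ y, q.derivative.eval y = 0 → q.derivative.derivative.eval y ≠ 0 ∧
      q.eval y * q.derivative.derivative.eval y ≤ 0) : q.Splits := by
  refine splits_of_forall_aeval_im fun z hz => ?_
  by_contra him
  set D := q.derivative with hDdef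
  have hDdeg : D.natDegree = q.natDegree - 1 := natDegree_derivative _
  have hD0 : D ≠ 0 := by
    intro h
    exact hq (derivative_eq_zero.1 h)
  have hdegle : D.degree ≤ q.degree := (degree_derivative_lt (by rintro rfl; simp at hq)).le
  have hlc : D.leadingCoeff = q.leadingCoeff * q.natDegree := by
    rw [leadingCoeff, hDdeg, hDdef, coeff_derivative, Nat.sub_add_cancel (by omega), leadingCoeff]
    rw [← Nat.cast_succ, Nat.succ_eq_add_one, Nat.sub_add_cancel (by omega)]
  have hqlc : q.leadingCoeff ≠ 0 := by
    rw [Ne, leadingCoeff_eq_zero]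
    rintro rfl
    simp at hq
  have hn : (0 : ℝ) < q.natDegree := by exact_mod_cast Nat.pos_of_ne_zero hq
  have hdivlc : (q / D).leadingCoeff = 1 / q.natDegree := by
    rw [leadingCoeff_div hdegle, hlc]
    field_simp
  have hdivdeg : (q / D).natDegree = 1 := by
    have h := degree_add_div hD0 hdegle
    have h0 : q / D ≠ 0 := by
      rw [Ne, ← leadingCoeff_eq_zero, hdivlc]
      positivity
    rw [← degree_mul, degree_eq_natDegree (mul_ne_zero hD0 h0), natDegree_mul hD0 h0,
      degree_eq_natDegree (by rintro rfl; simp at hq), hDdeg] at h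
    have h' : q.natDegree - 1 + (q / D).natDegree = q.natDegree := by exact_mod_cast h
    omega
  have hdivcoeff : (q / D).coeff 1 = 1 / q.natDegree := by
    rw [← hdivlc, leadingCoeff, hdivdeg]
  set α : ℝ := 1 / q.natDegree
  have hα : 0 < α := by positivity
  have hdiv : q / D = C α * X + C ((q / D).coeff 0) := by
    rw [← hdivcoeff]
    exact eq_X_add_C_of_natDegree_le_one hdivdeg.le
  set β := (q / D).coeff 0
  have hdecomp : q = D * (C α * X + C β) + q % D := by
    rw [← hdiv, EuclideanDomain.div_add_mod]
  -- the nodes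
  have hnodup : D.roots.Nodup := by
    rw [Multiset.nodup_iff_count_le_one]
    intro y
    by_contra! h
    rw [count_roots, one_lt_rootMultiplicity_iff_isRoot hD0] at h
    exact (hcrit y h.1).1 h.2
  set Y := D.roots.toFinset with hY
  set ι : ℝ →+* ℂ := algebraMap ℝ ℂ
  have hDnodal : D.map ι = C (ι D.leadingCoeff) * Lagrange.nodal Y (fun y => ι y) := by
    conv_lhs => rw [hD.eq_prod_roots]
    rw [Polynomial.map_mul, map_C, Lagrange.nodal_eq, Finset.prod_eq_multiset_prod, hY,
      Multiset.toFinset_val, hnodup.dedup, Polynomial.map_multiset_prod, Multiset.map_map]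
    simp
  have hYmem : ∀ y ∈ Y, D.eval y = 0 := by
    intro y hy
    exact isRoot_of_mem_roots (Multiset.mem_toFinset.1 hy)
  have hRdeg : ((q % D).map ι).degree < Y.card := by
    rw [degree_map]
    refine (degree_mod_lt q hD0).trans_le ?_
    rw [degree_eq_natDegree hD0, hD.natDegree_eq_card_roots, hY, Multiset.toFinset_card_of_nodup hnodup]
  have hinj : Set.InjOn (fun y : ℝ => ι y) (Y : Set ℝ) := fun a _ b _ hab => ι.injective hab
  have hR := Lagrange.eq_interpolate_of_eval_eq (r := fun y => ι (q.eval y)) hinj hRdeg (by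
      intro y hy
      rw [eval_map_apply, EuclideanDomain.mod_eq_sub_mul_div]
      simp [hYmem y hy])
  have hzY : ∀ y ∈ Y, z ≠ ι y := by
    rintro y - rfl
    exact him (Complex.ofReal_im y)
  have hN := Lagrange.eval_nodal_not_at_node hzY
  have hc : ι D.leadingCoeff ≠ 0 := by simpa using hD0
  have hw : ∀ y ∈ Y, Lagrange.nodalWeight Y (fun y => ι y) y * (z - ι y)⁻¹ * ι (q.eval y) =
      ι D.leadingCoeff * (ι (q.eval y / D.derivative.eval y) * (z - ι y)⁻¹) := by
    intro y hy
    have h1 := congrArg (fun p => (derivative p).eval (ι y)) hDnodal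
    simp only [derivative_map, derivative_C_mul, eval_C_mul, eval_map_apply] at h1
    have h2 : ι (D.derivative.eval y) ≠ 0 := by simpa using (hcrit y (hYmem y hy)).1
    have h3 : eval (ι y) (derivative (Lagrange.nodal Y fun y => ι y)) ≠ 0 := by
      intro h
      rw [h, mul_zero] at h1
      exact h2 h1
    rw [Lagrange.nodalWeight_eq_eval_derivative_nodal hy, map_div₀, h1]
    field_simp
  have hval : α * z + β + ∑ y ∈ Y, ι (q.eval y / D.derivative.eval y) * (z - ι y)⁻¹ = 0 := by
    have h1 := congrArg (fun p => (p.map ι).eval z) hdecomp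
    simp only [Polynomial.map_add, Polynomial.map_mul, hDnodal, hR, eval_add, eval_mul,
      Lagrange.eval_interpolate_not_at_node _ hzY, eval_C, map_C, map_X, eval_X] at h1
    rw [Finset.sum_congr rfl hw, ← Finset.mul_sum, eval_map, ← aeval_def, hz] at h1
    have h2 : (ι D.leadingCoeff * eval z (Lagrange.nodal Y fun y => ι y)) * (α * z + β +
        ∑ y ∈ Y, ι (q.eval y / D.derivative.eval y) * (z - ι y)⁻¹) = 0 := by
      rw [h1]
      simp only [ι, Complex.coe_algebraMap]
      ring
    exact (mul_eq_zero.1 h2).resolve_left (mul_ne_zero hc hN)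
  have him0 := congrArg Complex.im hval
  have hterm : ∀ y ∈ Y, (ι (q.eval y / D.derivative.eval y) * (z - ι y)⁻¹).im =
      z.im * (-(q.eval y / D.derivative.eval y) / Complex.normSq (z - ι y)) := by
    intro y _
    rw [Complex.coe_algebraMap, Complex.im_ofReal_mul, Complex.inv_im]
    simp
    ring
  rw [Complex.add_im, Complex.im_sum, Finset.sum_congr rfl hterm, ← Finset.mul_sum] at him0
  simp only [Complex.add_im, Complex.im_ofReal_mul, Complex.ofReal_im, Complex.zero_im] at him0
  have hnonneg : 0 ≤ ∑ y ∈ Y, -(q.eval y / D.derivative.eval y) / Complex.normSq (z - ι y) := by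
    refine Finset.sum_nonneg fun y hy => div_nonneg ?_ (Complex.normSq_nonneg _)
    obtain ⟨h1, h2⟩ := hcrit y (hYmem y hy)
    rw [← mul_div_mul_right _ _ h1, ← neg_div]
    exact div_nonneg (by linarith) (mul_self_nonneg _)
  have : z.im * (α + ∑ y ∈ Y, -(q.eval y / D.derivative.eval y) / Complex.normSq (z - ι y)) = 0 := by
    linarith
  rcases mul_eq_zero.1 this with h | h
  · exact him h
  · linarith

theorem exists_isLocalMax_mem_Ioo {f : ℝ → ℝ} (hf : Continuous f) {a b x : ℝ}
    (hx : x ∈ Set.Ioo a b) (ha : f a ≤ f x) (hb : f b ≤ f x) :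
    ∃ v ∈ Set.Ioo a b, IsLocalMax f v := by
  obtain ⟨v, hv, hmax⟩ := isCompact_Icc.exists_isMaxOn
    (Set.nonempty_Icc.2 (hx.1.trans hx.2).le) (hf.continuousOn (s := Set.Icc a b))
  have hinner : ∀ u ∈ Set.Ioo a b, f v ≤ f u → ∃ v ∈ Set.Ioo a b, IsLocalMax f v := by
    refine fun u hu huv => ⟨u, hu, ?_⟩
    filter_upwards [Icc_mem_nhds hu.1 hu.2] with z hz using (hmax hz).trans huv
  rcases hv.1.eq_or_lt with rfl | hav
  · exact hinner x hx ha
  rcases hv.2.eq_or_lt with rfl | hvb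
  · exact hinner x hx hb
  exact hinner v ⟨hav, hvb⟩ le_rfl

theorem deriv_polynomial_eval (p : ℝ[X]) :
    deriv (fun x => p.eval x) = fun x => p.derivative.eval x := by
  funext x
  exact p.deriv

theorem Polynomial.derivative2_eq_zero_of_isLocalMin_of_isLocalMax {p : ℝ[X]} {y : ℝ}
    (h1 : IsLocalMin (fun x => p.eval x) y) (h2 : IsLocalMax (fun x => p.eval x) y) :
    p.derivative.derivative.eval y = 0 := by
  have h : (fun x => p.eval x) =ᶠ[nhds y] fun _ => p.eval y := by
    filter_upwards [h1, h2] with x h3 h4 using le_antisymm h4 h3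
  have h' := h.deriv.deriv_eq
  simpa [deriv_polynomial_eval] using h'

theorem Polynomial.isLocalMin_of_derivative2_pos {p : ℝ[X]} {y : ℝ} (h1 : p.derivative.eval y = 0)
    (h2 : 0 < p.derivative.derivative.eval y) : IsLocalMin (fun x => p.eval x) y := by
  refine isLocalMin_of_deriv_deriv_pos ?_ ?_ p.continuous.continuousAt
  · simpa [deriv_polynomial_eval] using h2
  · simpa using h1

theorem Polynomial.isLocalMax_of_derivative2_neg {p : ℝ[X]} {y : ℝ} (h1 : p.derivative.eval y = 0)
    (h2 : p.derivative.derivative.eval y < 0) : IsLocalMax (fun x => p.eval x) y := by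
  have h := isLocalMin_of_derivative2_pos (p := -p) (y := y) (by simpa using h1) (by simpa using h2)
  simpa using h.neg

/-- Real-rooted monic polynomials with nondegenerate critical points, negative at local minima
and nonnegative at local maxima and on the nonnegative half-line. -/
structure Oscillating (p : ℝ[X]) : Prop where
  monic : p.Monic
  natDegree_ne_zero : p.natDegree ≠ 0
  splits : p.Splits
  eval_nonneg : ∀ x, 0 ≤ x → 0 ≤ p.eval x
  critical : ∀ y, p.derivative.eval y = 0 →
    (0 < p.derivative.derivative.eval y ∧ p.eval y < 0) ∨
      (p.derivative.derivative.eval y < 0 ∧ 0 ≤ p.eval y)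

/-- `ξ` is a local minimum point of `p` with the largest value among all local minima. -/
def IsHighestLocalMin (p : ℝ[X]) (ξ : ℝ) : Prop :=
  IsLocalMin (fun x => p.eval x) ξ ∧
    ∀ y : ℝ, IsLocalMin (fun x => p.eval x) y → p.eval y ≤ p.eval ξ

namespace Oscillating

variable {p : ℝ[X]} {y ξ : ℝ}

theorem of_isLocalMin (hp : Oscillating p) (hy : IsLocalMin (fun x => p.eval x) y) :
    p.derivative.eval y = 0 ∧ 0 < p.derivative.derivative.eval y ∧ p.eval y < 0 := by
  have h0 : p.derivative.eval y = 0 := by simpa using hy.deriv_eq_zero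
  refine ⟨h0, (hp.critical y h0).resolve_right fun h => ?_⟩
  have := derivative2_eq_zero_of_isLocalMin_of_isLocalMax hy (isLocalMax_of_derivative2_neg h0 h.1)
  linarith [h.1]

theorem eval_nonneg_of_isLocalMax (hp : Oscillating p) (hy : IsLocalMax (fun x => p.eval x) y) :
    0 ≤ p.eval y := by
  have h0 : p.derivative.eval y = 0 := by simpa using hy.deriv_eq_zero
  rcases hp.critical y h0 with h | h
  · have := derivative2_eq_zero_of_isLocalMin_of_isLocalMax
      (isLocalMin_of_derivative2_pos h0 h.1) hy
    linarith [h.1]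
  · exact h.2

theorem splits_sub_C (hp : Oscillating p) (hξ : IsHighestLocalMin p ξ) :
    (p - C (p.eval ξ)).Splits := by
  have hd : (p - C (p.eval ξ)).derivative = p.derivative := by simp
  refine splits_of_critical ?_ ?_ ?_
  · rw [natDegree_sub_C]
    exact hp.natDegree_ne_zero
  · rw [hd]
    exact hp.splits.derivative_real
  · intro y hy
    rw [hd] at hy ⊢
    rw [eval_sub, eval_C]
    have hneg := (hp.of_isLocalMin hξ.1).2.2
    rcases hp.critical y hy with h | h
    · have := hξ.2 y (isLocalMin_of_derivative2_pos hy h.1)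
      exact ⟨h.1.ne', mul_nonpos_of_nonpos_of_nonneg (by linarith) h.1.le⟩
    · exact ⟨h.1.ne, mul_nonpos_of_nonneg_of_nonpos (by linarith) h.1.le⟩

theorem step (hp : Oscillating p) (hξ : IsHighestLocalMin p ξ) :
    Oscillating (X * (p - C (p.eval ξ))) := by
  have hneg := (hp.of_isLocalMin hξ.1).2.2
  have hsplit : (X * (p - C (p.eval ξ))).Splits := Splits.X.mul (hp.splits_sub_C hξ)
  have hmonic : (X * (p - C (p.eval ξ))).Monic := by
    refine monic_X.mul (hp.monic.sub_of_left ?_)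
    refine degree_C_le.trans_lt ?_
    rw [← natDegree_pos_iff_degree_pos]
    exact Nat.pos_of_ne_zero hp.natDegree_ne_zero
  have hdeg : (X * (p - C (p.eval ξ))).natDegree ≠ 0 := by
    rw [natDegree_X_mul]
    · simp
    · rintro h
      rw [h] at hmonic
      simp [Monic] at hmonic
  refine ⟨hmonic, hdeg, hsplit, fun x hx => ?_, fun y hy => ?_⟩
  · have := hp.eval_nonneg x hx
    simp only [eval_mul, eval_X, eval_sub, eval_C]
    exact mul_nonneg hx (by linarith)
  · by_cases h0 : (X * (p - C (p.eval ξ))).eval y = 0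
    · right
      refine ⟨?_, h0.ge⟩
      simp only [derivative_mul, derivative_X, derivative_sub, derivative_C, eval_mul, eval_add,
        eval_sub, eval_X, eval_C, one_mul, sub_zero, mul_eq_zero] at hy h0 ⊢
      have hyneg : y < 0 := by
        by_contra! hy0
        have := hp.eval_nonneg y hy0
        rcases h0 with h0 | h0
        · rw [h0] at hy this
          linarith
        · linarith
      have h1 := h0.resolve_left hyneg.ne
      have h2 : p.derivative.eval y = 0 := by
        rw [h1, zero_add] at hy
        exact (mul_eq_zero.1 hy).resolve_left hyneg.ne
      rcases hp.critical y h2 with h | h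
      · simp [h2]
        nlinarith
      · linarith
    · have := hsplit.laguerre hdeg h0 hy
      rcases lt_or_gt_of_ne h0 with h | h
      · exact Or.inl ⟨by nlinarith, h⟩
      · exact Or.inr ⟨by nlinarith, h.le⟩

/-- The largest root `-ρ` of `p - p(ξ)`. -/
theorem exists_largest_root (hp : Oscillating p) (hp0 : p.eval 0 = 0)
    (hξ : IsHighestLocalMin p ξ) :
    ∃ ρ > 0, p.eval (-ρ) = p.eval ξ ∧ (∀ x, -ρ < x → p.eval ξ < p.eval x) ∧
      ∀ x ∈ Set.Icc (-ρ) 0, p.eval x ≤ 0 := by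
  have hneg := (hp.of_isLocalMin hξ.1).2.2
  have hq0 : p - C (p.eval ξ) ≠ 0 := by
    intro h
    have := congrArg (eval 0) h
    simp [hp0] at this
    linarith
  have hmem : ξ ∈ (p - C (p.eval ξ)).roots.toFinset := by
    simp [hq0]
  set r := (p - C (p.eval ξ)).roots.toFinset.max' ⟨ξ, hmem⟩ with hr
  have hroot : p.eval r = p.eval ξ := by
    have := Finset.max'_mem _ ⟨ξ, hmem⟩
    rw [← hr, Multiset.mem_toFinset, mem_roots hq0] at this
    simpa [sub_eq_zero] using this
  have hmax : ∀ x, p.eval x = p.eval ξ → x ≤ r := by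
    intro x hx
    refine Finset.le_max' _ _ ?_
    simp [hq0, hx]
  have hr0 : r < 0 := by
    by_contra! h
    have := hp.eval_nonneg r h
    linarith
  have hpos : ∀ x, r < x → p.eval ξ < p.eval x := by
    intro x hx
    by_contra! h
    have hx0 : x ≤ max x 0 := le_max_left _ _
    have hM := hp.eval_nonneg (max x 0) (le_max_right _ _)
    obtain ⟨c, hc, hc'⟩ := intermediate_value_Icc hx0 p.continuous.continuousOn
      (⟨h, by linarith⟩ : p.eval ξ ∈ Set.Icc (p.eval x) (p.eval (max x 0)))
    have := hmax c hc'
    linarith [hc.1]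
  refine ⟨-r, by linarith, by simpa using hroot, by simpa using hpos, fun x hx => ?_⟩
  rw [neg_neg] at hx
  by_contra! hxpos
  have hxr : r < x := by
    rcases hx.1.lt_or_eq with h | h
    · exact h
    · rw [← h] at hxpos
      linarith
  have hx0 : x < 0 := by
    rcases hx.2.lt_or_eq with h | h
    · exact h
    · rw [h] at hxpos
      linarith
  obtain ⟨c, hc, hcmin⟩ := isCompact_Icc.exists_isMinOn (Set.nonempty_Icc.2 hx0.le)
    (p.continuous.continuousOn (s := Set.Icc x 0))
  have hcneg : p.eval c < 0 := by
    by_contra! h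
    have h0 : IsLocalMin (fun x => p.eval x) 0 := by
      filter_upwards [Ioi_mem_nhds hx0] with z hz
      rw [hp0]
      rcases le_total z 0 with hz0 | hz0
      · exact h.trans (hcmin ⟨hz.le, hz0⟩)
      · exact hp.eval_nonneg z hz0
    have := (hp.of_isLocalMin h0).2.2
    linarith
  have hxc : x < c := hc.1.lt_of_ne (by rintro rfl; linarith)
  have hc0 : c < 0 := hc.2.lt_of_ne (by rintro rfl; linarith)
  have h1 := hξ.2 c (hcmin.isLocalMin (Icc_mem_nhds hxc hc0))
  have h2 := hpos c (hxr.trans hxc)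
  linarith

/-- To the right of a point where `p` increases from a negative value, `p` stays above that value
until it becomes nonnegative. -/
theorem lt_eval_of_forall_neg (hp : Oscillating p) {v : ℝ} (hyv : y < v)
    (hy : 0 < p.derivative.eval y) (hneg : ∀ x ∈ Set.Ioo y v, p.eval x < 0) :
    p.eval y ≤ p.eval v := by
  by_contra! hlt
  have hslope := (p.hasDerivAt y).tendsto_slope_zero_right.eventually (lt_mem_nhds hy)
  obtain ⟨t, ht, ht0, htv⟩ := (hslope.and (Ioo_mem_nhdsGT (sub_pos.2 hyv))).exists
  have hyt : p.eval y ≤ p.eval (y + t) := by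
    have := (pos_iff_pos_of_mul_pos ht).1 (inv_pos.2 ht0)
    linarith
  obtain ⟨c, hc, hcmax⟩ := exists_isLocalMax_mem_Ioo p.continuous
    (⟨by linarith, by linarith⟩ : y + t ∈ Set.Ioo y v) hyt (hlt.le.trans hyt)
  have h1 := hp.eval_nonneg_of_isLocalMax hcmax
  have h2 := hneg c hc
  linarith

/-- A highest local minimum of `x (p(x) - p(ξ))` lies to the right of all negative roots. -/
theorem highest_of_step (hp : Oscillating p) (hp0 : p.eval 0 = 0) (hξ : IsHighestLocalMin p ξ)
    {η : ℝ} (hη : IsHighestLocalMin (X * (p - C (p.eval ξ))) η) :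
    ∃ ρ > 0, p.eval (-ρ) = p.eval ξ ∧ (∀ x, -ρ < x → p.eval ξ < p.eval x) ∧
      η ∈ Set.Ioo (-ρ) 0 ∧ ∀ x ∈ Set.Icc (-ρ) 0,
        (X * (p - C (p.eval ξ))).eval η ≤ (X * (p - C (p.eval ξ))).eval x := by
  have hr := hp.step hξ
  obtain ⟨ρ, hρ, hroot, hpos, hnonpos⟩ := hp.exists_largest_root hp0 hξ
  have hneg := (hp.of_isLocalMin hξ.1).2.2
  set r := X * (p - C (p.eval ξ)) with hrdef
  have hreval : ∀ x, r.eval x = x * (p.eval x - p.eval ξ) := by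
    intro x
    simp [hrdef]
  have hrder : ∀ x, r.derivative.eval x = p.eval x - p.eval ξ + x * p.derivative.eval x := by
    intro x
    simp [hrdef]
  -- the minimum over `[-ρ, 0]`
  obtain ⟨c, hc, hcmin⟩ := isCompact_Icc.exists_isMinOn
    (Set.nonempty_Icc.2 (by linarith : -ρ ≤ 0)) (r.continuous.continuousOn (s := Set.Icc (-ρ) 0))
  have hrc : r.eval c < 0 := by
    have h1 : r.eval c ≤ r.eval (-ρ / 2) := hcmin ⟨by linarith, by linarith⟩
    have h2 := hpos (-ρ / 2) (by linarith)
    rw [hreval (-ρ / 2)] at h1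
    nlinarith
  have hρc : -ρ < c := hc.1.lt_of_ne (by
    rintro rfl
    rw [hreval, hroot] at hrc
    linarith)
  have hc0 : c < 0 := hc.2.lt_of_ne (by
    rintro rfl
    rw [hreval] at hrc
    linarith)
  have hηc := hη.2 c (hcmin.isLocalMin (Icc_mem_nhds hρc hc0))
  have hbound : ρ * p.eval ξ < r.eval η := by
    refine lt_of_lt_of_le ?_ hηc
    rw [hreval]
    have := hnonpos c hc
    nlinarith
  obtain ⟨hη1, hη2, hη3⟩ := hr.of_isLocalMin hη.1
  have hη0 : η < 0 := by
    by_contra! h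
    have := hr.eval_nonneg η h
    linarith
  have hρη : -ρ < η := by
    by_contra! hle
    have hqη : p.eval ξ < p.eval η := by
      rw [hreval] at hη3
      nlinarith
    have hpη : p.eval η < 0 := by
      by_contra! h
      rw [hreval] at hbound
      nlinarith
    have hlt : η < -ρ := hle.lt_of_ne (by rintro rfl; linarith)
    have hder : 0 < p.derivative.eval η := by
      rw [hrder] at hη1
      nlinarith
    -- the first zero of `p` to the right of `η`
    set Z := {x ∈ Set.Icc η (-ρ) | 0 ≤ p.eval x} with hZ
    have hZne : Z.Nonempty := by
      by_contra! hempty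
      have h1 := hp.lt_eval_of_forall_neg hlt hder fun x hx => by
        by_contra! h
        have : x ∈ Z := ⟨⟨hx.1.le, hx.2.le⟩, h⟩
        rw [hempty] at this
        exact this
      linarith
    have hZc : IsCompact Z := isCompact_Icc.inter_right
      (isClosed_le continuous_const p.continuous)
    obtain ⟨w, hw, hwmin⟩ := hZc.exists_isLeast hZne
    have hηw : η < w := hw.1.1.lt_of_ne (by
      rintro rfl
      linarith [hw.2])
    have hwρ : w < -ρ := hw.1.2.lt_of_ne (by
      rintro rfl
      linarith [hw.2])
    have hbelow : ∀ x ∈ Set.Ioo η w, p.eval x < 0 := by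
      intro x hx
      by_contra! h
      have := hwmin ⟨⟨hx.1.le, hx.2.le.trans hw.1.2⟩, h⟩
      linarith [hx.2]
    have hrw : r.eval η ≤ r.eval w := by
      by_contra! hgt
      obtain ⟨x, hxη, hx⟩ := ((hη.1.filter_mono nhdsWithin_le_nhds).and
        (Ioo_mem_nhdsGT hηw)).exists
      obtain ⟨v, ⟨hηv, hvw⟩, hvmax⟩ :=
        exists_isLocalMax_mem_Ioo r.continuous hx hxη (hgt.le.trans hxη)
      have h1 := hr.eval_nonneg_of_isLocalMax hvmax
      have h2 := hp.lt_eval_of_forall_neg hηv hder fun x hx => hbelow x ⟨hx.1, hx.2.trans hvw⟩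
      rw [hreval] at h1
      nlinarith
    rw [hreval w] at hrw
    nlinarith [hw.2]
  refine ⟨ρ, hρ, hroot, hpos, ⟨hρη, hη0⟩, fun x hx => ?_⟩
  refine le_trans ?_ (hcmin hx)
  have hnomax : ∀ v ∈ Set.Ioo (-ρ) 0, ¬ IsLocalMax (fun x => r.eval x) v := by
    intro v hv hmax
    have h1 := hr.eval_nonneg_of_isLocalMax hmax
    have h2 := hpos v hv.1
    rw [hreval] at h1
    nlinarith [hv.2]
  rcases lt_trichotomy η c with h | rfl | h
  · obtain ⟨x, hxη, hx⟩ := ((hη.1.filter_mono nhdsWithin_le_nhds).and (Ioo_mem_nhdsGT h)).exists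
    obtain ⟨v, hv, hvmax⟩ := exists_isLocalMax_mem_Ioo r.continuous hx hxη (hηc.trans hxη)
    exact absurd hvmax (hnomax v ⟨hρη.trans hv.1, hv.2.trans hc0⟩)
  · exact le_rfl
  · obtain ⟨x, hxη, hx⟩ := ((hη.1.filter_mono nhdsWithin_le_nhds).and (Ioo_mem_nhdsLT h)).exists
    obtain ⟨v, hv, hvmax⟩ := exists_isLocalMax_mem_Ioo r.continuous hx (hηc.trans hxη) hxη
    exact absurd hvmax (hnomax v ⟨hρc.trans hv.1, hv.2.trans hη0⟩)

end Oscillating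

/-- The polynomial function `s ↦ ∏ (1 - w s)` over a multiset of weights `w`. -/
noncomputable def weightProd (W : Multiset ℝ) (s : ℝ) : ℝ := (W.map fun w => 1 - w * s).prod

theorem weightProd_zero (W : Multiset ℝ) : weightProd W 0 = 1 := by simp [weightProd]

theorem weightProd_cons (w : ℝ) (W : Multiset ℝ) (s : ℝ) :
    weightProd (w ::ₘ W) s = (1 - w * s) * weightProd W s := by simp [weightProd]

theorem weightProd_nonneg {W : Multiset ℝ} {s : ℝ} (h : ∀ w ∈ W, w * s ≤ 1) :
    0 ≤ weightProd W s := by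
  refine Multiset.prod_nonneg fun x hx => ?_
  obtain ⟨w, hw, rfl⟩ := Multiset.mem_map.1 hx
  linarith [h w hw]

theorem weightProd_le_one {W : Multiset ℝ} {s : ℝ} (hW : ∀ w ∈ W, 0 ≤ w) (hs : 0 ≤ s)
    (h : ∀ w ∈ W, w * s ≤ 1) : weightProd W s ≤ 1 := by
  induction W using Multiset.induction_on with
  | empty => simp [weightProd]
  | cons a W ih =>
    simp only [Multiset.forall_mem_cons] at hW h
    rw [weightProd_cons]
    exact mul_le_one₀ (by nlinarith [mul_nonneg hW.1 hs]) (weightProd_nonneg h.2) (ih hW.2 h.2)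

theorem weightProd_lipschitz {W : Multiset ℝ} {s t : ℝ} (hW : ∀ w ∈ W, 0 ≤ w) (hs : 0 ≤ s)
    (ht : 0 ≤ t) (h : ∀ w ∈ W, w * s ≤ 1) (h' : ∀ w ∈ W, w * t ≤ 1) :
    |weightProd W s - weightProd W t| ≤ W.sum * |s - t| := by
  induction W using Multiset.induction_on with
  | empty => simp [weightProd]
  | cons a W ih =>
    simp only [Multiset.forall_mem_cons] at hW h h'
    rw [weightProd_cons, weightProd_cons, Multiset.sum_cons]
    have h1 := ih hW.2 h.2 h'.2
    have h2 := weightProd_nonneg h'.2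
    have h3 := weightProd_le_one hW.2 ht h'.2
    have h4 : (1 - a * s) * weightProd W s - (1 - a * t) * weightProd W t =
        (1 - a * s) * (weightProd W s - weightProd W t) - a * (s - t) * weightProd W t := by ring
    rw [h4]
    refine (abs_sub _ _).trans ?_
    rw [abs_mul, abs_mul, abs_mul, abs_of_nonneg hW.1, abs_of_nonneg h2,
      abs_of_nonneg (by linarith [h.1] : 0 ≤ 1 - a * s)]
    have h5 := mul_nonneg hW.1 (abs_nonneg (s - t))
    nlinarith [mul_nonneg hW.1 hs, abs_nonneg (weightProd W s - weightProd W t)]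

/-- Tangent bound for the logarithm of `weightProd` at `s`. -/
theorem weightProd_le_mul_exp {W : Multiset ℝ} {s t : ℝ} (h : ∀ w ∈ W, w * s < 1)
    (h' : ∀ w ∈ W, w * t ≤ 1) :
    weightProd W t ≤
      weightProd W s * Real.exp (-(t - s) * (W.map fun w => w / (1 - w * s)).sum) := by
  induction W using Multiset.induction_on with
  | empty => simp [weightProd]
  | cons a W ih =>
    simp only [Multiset.forall_mem_cons] at h h'
    rw [weightProd_cons, weightProd_cons, Multiset.map_cons, Multiset.sum_cons, mul_add,
      Real.exp_add]
    have h1 := ih h.2 h'.2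
    have h0 : 0 < 1 - a * s := by linarith [h.1]
    have h2 : 1 - a * t ≤ (1 - a * s) * Real.exp (-(t - s) * (a / (1 - a * s))) := by
      have h3 := Real.add_one_le_exp (-(t - s) * (a / (1 - a * s)))
      calc 1 - a * t = (1 - a * s) * (-(t - s) * (a / (1 - a * s)) + 1) := by
            field_simp
            ring
        _ ≤ _ := by gcongr
    calc (1 - a * t) * weightProd W t
        ≤ ((1 - a * s) * Real.exp (-(t - s) * (a / (1 - a * s)))) *
          (weightProd W s * Real.exp (-(t - s) * (W.map fun w => w / (1 - w * s)).sum)) :=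
          mul_le_mul h2 h1 (weightProd_nonneg h'.2) (by positivity)
      _ = _ := by ring

theorem sum_add_mul_sum_sq_le {W : Multiset ℝ} {s : ℝ} (hW : ∀ w ∈ W, 0 ≤ w)
    (h : ∀ w ∈ W, w * s < 1) :
    W.sum + s * (W.map fun w => w ^ 2).sum ≤ (W.map fun w => w / (1 - w * s)).sum := by
  induction W using Multiset.induction_on with
  | empty => simp
  | cons a W ih =>
    simp only [Multiset.forall_mem_cons] at hW h
    simp only [Multiset.map_cons, Multiset.sum_cons]
    have h1 := ih hW.2 h.2
    have h2 : a + s * a ^ 2 ≤ a / (1 - a * s) := by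
      rw [le_div_iff₀ (by linarith [h.1])]
      nlinarith [mul_nonneg hW.1 (sq_nonneg (a * s))]
    linarith

/-- Convergence of the renormalised iteration `K ↦ 1 - t K(q t)`, `q = max t K(t)`. -/
theorem tendsto_of_renormalised {K : ℕ → ℝ → ℝ} {q s : ℕ → ℝ}
    (hq : ∀ m, q (m + 1) = s m * K m (s m))
    (hK : ∀ m t, K (m + 1) t = 1 - t * K m (q (m + 1) * t))
    (hmax : ∀ m, ∀ t ∈ Set.Icc (0 : ℝ) 1, t * K m t ≤ q (m + 1))
    (hs : ∀ m, s m ∈ Set.Ioc (0 : ℝ) 0.83) (hq_le : ∀ m, q m ≤ 0.37)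
    (hlip : ∀ m, ∀ x ∈ Set.Icc (0 : ℝ) 1, ∀ y ∈ Set.Icc (0 : ℝ) 1, |K m x - K m y| ≤ |x - y|)
    (hK0 : ∀ m, K m 0 = 1) (hK2 : ∀ m, ∀ t ∈ Set.Icc (0 : ℝ) 1, K m t ≤ 1 - t + t ^ 2)
    (hexp : ∀ m, ∀ t ∈ Set.Icc (0 : ℝ) 1, K m t ≤ K m (s m) * Real.exp (1 - t / s m)) :
    ∃ lam ∈ Set.Ioo (0 : ℝ) 1, Tendsto q atTop (nhds lam) ∧
      Tendsto (fun m => s (m + 1) / s m) atTop (nhds 1) := by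
  have hK1 : ∀ m, ∀ t ∈ Set.Icc (0 : ℝ) 1, 1 - t ≤ K m t := by
    intro m t ht
    have h := hlip m 0 ⟨le_rfl, zero_le_one⟩ t ht
    rw [hK0, zero_sub, abs_neg, abs_of_nonneg ht.1] at h
    linarith [le_abs_self (1 - K m t)]
  have hq_ge : ∀ m, 1 / 4 ≤ q (m + 1) := by
    intro m
    have h1 := hmax m (1 / 2) (by norm_num)
    have h2 := hK1 m (1 / 2) (by norm_num)
    linarith
  have hdiff : ∀ m n E, (∀ t ∈ Set.Icc (0 : ℝ) 0.83, |K m t - K n t| ≤ E * t ^ 2) →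
      q (m + 1) - q (n + 1) ≤ 0.83 ^ 3 * E := by
    intro m n E hE
    have hsm := hs m
    have h1 := hE (s m) ⟨hsm.1.le, hsm.2⟩
    have h2 := hmax n (s m) ⟨hsm.1.le, by linarith [hsm.2]⟩
    have hE0 : 0 ≤ E := by
      have := (abs_nonneg _).trans h1
      exact nonneg_of_mul_nonneg_left this (pow_pos hsm.1 2)
    calc q (m + 1) - q (n + 1) ≤ s m * (K m (s m) - K n (s m)) := by
          rw [hq m]
          linarith
      _ ≤ s m * (E * s m ^ 2) := by
          gcongr
          · exact hsm.1.le
          · exact (le_abs_self _).trans h1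
      _ = s m ^ 3 * E := by ring
      _ ≤ 0.83 ^ 3 * E := by
          have := pow_le_pow_left₀ hsm.1.le hsm.2 3
          gcongr
  have hdiff' : ∀ m E, (∀ t ∈ Set.Icc (0 : ℝ) 0.83, |K (m + 1) t - K m t| ≤ E * t ^ 2) →
      |q (m + 2) - q (m + 1)| ≤ 0.83 ^ 3 * E := by
    intro m E hE
    rw [abs_le]
    have h1 := hdiff (m + 1) m E hE
    have h2 := hdiff m (m + 1) E fun t ht => by
      rw [abs_sub_comm]
      exact hE t ht
    constructor <;> linarith
  have hcontr : ∀ m, ∀ t ∈ Set.Icc (0 : ℝ) 0.83, |K (m + 1) t - K m t| ≤ 0.7 ^ m * t ^ 2 := by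
    intro m
    induction m with
    | zero =>
      intro t ht
      have ht' : t ∈ Set.Icc (0 : ℝ) 1 := ⟨ht.1, by linarith [ht.2]⟩
      rw [abs_le]
      constructor <;> linarith [hK1 0 t ht', hK1 1 t ht', hK2 0 t ht', hK2 1 t ht']
    | succ m ih =>
      intro t ht
      set E : ℝ := 0.7 ^ m with hE
      have hE0 : 0 ≤ E := by positivity
      have hqd := hdiff' m E ih
      have ha := hq_ge m
      have hb := hq_ge (m + 1)
      have ha' := hq_le (m + 1)
      have hb' := hq_le (m + 2)
      have e1 : K (m + 1 + 1) t - K (m + 1) t =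
          -(t * ((K (m + 1) (q (m + 2) * t) - K m (q (m + 2) * t)) +
            (K m (q (m + 2) * t) - K m (q (m + 1) * t)))) := by
        rw [hK (m + 1) t, hK m t]
        ring
      have hx0 : 0 ≤ q (m + 2) * t := mul_nonneg (by linarith) ht.1
      have hx1 : q (m + 2) * t ≤ 0.37 * t := by nlinarith [ht.1]
      have hy0 : 0 ≤ q (m + 1) * t := mul_nonneg (by linarith) ht.1
      have hy1 : q (m + 1) * t ≤ 0.37 * t := by nlinarith [ht.1]
      have h1 := ih (q (m + 2) * t) ⟨hx0, by linarith [ht.2]⟩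
      have h2 := hlip m (q (m + 2) * t) ⟨hx0, by linarith [ht.2]⟩ (q (m + 1) * t)
        ⟨hy0, by linarith [ht.2]⟩
      rw [← sub_mul, abs_mul, abs_of_nonneg ht.1] at h2
      rw [e1, abs_neg, abs_mul, abs_of_nonneg ht.1, pow_succ, ← hE]
      calc t * |(K (m + 1) (q (m + 2) * t) - K m (q (m + 2) * t)) +
            (K m (q (m + 2) * t) - K m (q (m + 1) * t))|
          ≤ t * (E * (0.37 * t) ^ 2 + 0.83 ^ 3 * E * t) := by
            refine mul_le_mul_of_nonneg_left ((abs_add_le _ _).trans (add_le_add ?_ ?_)) ht.1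
            · exact h1.trans (by gcongr)
            · exact h2.trans (mul_le_mul_of_nonneg_right hqd ht.1)
        _ = E * t ^ 2 * (0.37 ^ 2 * t + 0.83 ^ 3) := by ring
        _ ≤ E * t ^ 2 * 0.7 := by
            gcongr
            linarith [ht.2]
        _ = E * 0.7 * t ^ 2 := by ring
  have hcauchy : CauchySeq fun m => q (m + 1) := by
    refine cauchySeq_of_le_geometric 0.7 1 (by norm_num) fun m => ?_
    rw [dist_comm, Real.dist_eq]
    refine (hdiff' m _ (hcontr m)).trans ?_
    gcongr
    norm_num
  obtain ⟨lam, hlam⟩ := cauchySeq_tendsto_of_complete hcauchy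
  have hlam_ge : 1 / 4 ≤ lam := ge_of_tendsto' hlam hq_ge
  have hlam_le : lam ≤ 0.37 := le_of_tendsto' hlam fun m => hq_le _
  have hqlim : Tendsto q atTop (nhds lam) := (tendsto_add_atTop_iff_nat 1).1 hlam
  refine ⟨lam, ⟨by linarith, by linarith⟩, hqlim, ?_⟩
  set u : ℕ → ℝ := fun m => s m / s (m + 1) with hu
  have hu0 : ∀ m, 0 < u m := fun m => div_pos (hs m).1 (hs _).1
  set e : ℕ → ℝ := fun m => s m * (K (m + 1) (s m) - K m (s m)) with he
  have hnear : Tendsto e atTop (nhds 0) := by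
    refine squeeze_zero_norm (a := fun m => (0.7 : ℝ) ^ m) (fun m => ?_)
      (tendsto_pow_atTop_nhds_zero_of_lt_one (by norm_num) (by norm_num))
    have hsm := hs m
    have h1 := hcontr m (s m) ⟨hsm.1.le, hsm.2⟩
    rw [Real.norm_eq_abs, he, abs_mul, abs_of_pos hsm.1]
    have h2 : s m ^ 3 ≤ 1 := pow_le_one₀ hsm.1.le (by linarith [hsm.2])
    calc s m * |K (m + 1) (s m) - K m (s m)| ≤ s m * (0.7 ^ m * s m ^ 2) := by
          gcongr
          exact hsm.1.le
      _ = 0.7 ^ m * s m ^ 3 := by ring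
      _ ≤ 0.7 ^ m * 1 := by gcongr
      _ = 0.7 ^ m := mul_one _
  have hratio : ∀ m, ((1 - u m) / (1 + u m)) ^ 2 ≤ 1 - (q (m + 1) + e m) / q (m + 2) := by
    intro m
    have hsm := hs m
    have hq2 := hq_ge (m + 1)
    have h1 := hexp (m + 1) (s m) ⟨hsm.1.le, by linarith [hsm.2]⟩
    have h2 : q (m + 1) + e m = s m * K (m + 1) (s m) := by
      rw [hq m, he]
      ring
    have h3 : s m = u m * s (m + 1) := by
      rw [hu]
      field_simp [(hs (m + 1)).1.ne']
    have h4 : q (m + 1) + e m ≤ q (m + 2) * (u m * Real.exp (1 - u m)) := by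
      calc q (m + 1) + e m = s m * K (m + 1) (s m) := h2
        _ ≤ s m * (K (m + 1) (s (m + 1)) * Real.exp (1 - s m / s (m + 1))) := by
            gcongr
            exact hsm.1.le
        _ = (u m * s (m + 1)) * (K (m + 1) (s (m + 1)) * Real.exp (1 - u m)) := by rw [← h3]
        _ = _ := by
            rw [hq (m + 1)]
            ring
    have h5 : Real.exp (1 - u m) ≤ (2 / (1 + u m)) ^ 2 := by
      have h6 := Real.add_one_le_exp ((u m - 1) / 2)
      have h7 : Real.exp (1 - u m) = (Real.exp ((u m - 1) / 2))⁻¹ ^ 2 := by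
        rw [← Real.exp_neg, ← Real.exp_nat_mul]
        congr 1
        push_cast
        ring
      rw [h7]
      have hum := hu0 m
      gcongr
      rw [inv_le_comm₀ (by positivity) (by positivity), inv_div]
      linarith
    have h8 : (q (m + 1) + e m) / q (m + 2) ≤ u m * (2 / (1 + u m)) ^ 2 := by
      rw [div_le_iff₀' (by linarith)]
      refine h4.trans ?_
      have hum := (hu0 m).le
      gcongr
    have h9 : ((1 - u m) / (1 + u m)) ^ 2 = 1 - u m * (2 / (1 + u m)) ^ 2 := by
      have := hu0 m
      field_simp
      ring
    linarith
  have hw : Tendsto (fun m => (1 - u m) / (1 + u m)) atTop (nhds 0) := by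
    have hr : Tendsto (fun m => 1 - (q (m + 1) + e m) / q (m + 2)) atTop (nhds 0) := by
      have := tendsto_const_nhds (x := (1 : ℝ)) |>.sub
        ((hlam.add hnear).div ((tendsto_add_atTop_iff_nat 2).2 hqlim) (by linarith))
      simpa [div_self (by linarith : lam ≠ 0)] using this
    have hsq := squeeze_zero (fun m => sq_nonneg _) hratio hr
    have := hsq.sqrt
    simp only [Real.sqrt_sq_eq_abs, Real.sqrt_zero] at this
    exact (tendsto_zero_iff_abs_tendsto_zero _).2 this
  have hfin := (tendsto_const_nhds (x := (1 : ℝ)) |>.add hw).div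
    (tendsto_const_nhds (x := (1 : ℝ)) |>.sub hw) (by norm_num)
  simp only [add_zero, sub_zero, div_one] at hfin
  refine hfin.congr fun m => ?_
  have h1 : (1 + (1 - u m) / (1 + u m)) / (1 - (1 - u m) / (1 + u m)) = 1 / u m := by
    have := hu0 m
    have h2 : 1 + (1 - u m) / (1 + u m) = 2 / (1 + u m) := by
      field_simp
      ring
    have h3 : 1 - (1 - u m) / (1 + u m) = 2 * u m / (1 + u m) := by
      field_simp
      ring
    rw [h2, h3]
    field_simp
  rw [Pi.div_apply, h1, hu, one_div_div]

/-- The roots of a real-rooted polynomial with negative roots, rescaled so that their reciprocals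
sum up to `1`. -/
theorem exists_weightProd_eq {Q : ℝ[X]} (hQ : Q.Splits) (hneg : ∀ r, Q.eval r = 0 → r < 0)
    {a q : ℝ} (ha : 0 < a) (h0 : 0 < Q.eval 0) (h1 : Q.derivative.eval 0 * a = Q.eval 0)
    (h2 : Q.derivative.derivative.eval 0 * a ^ 2 = 2 * q * Q.eval 0) :
    ∃ W : Multiset ℝ, (∀ w ∈ W, 0 ≤ w ∧ w ≤ 1 ∧ ∃ r, Q.eval r = 0 ∧ w * r = -a) ∧
      (∀ r, Q.eval r = 0 → r ≤ -a) ∧ W.sum = 1 ∧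
      (W.map fun w => w ^ 2).sum = 1 - 2 * q ∧
      (∀ t, Q.eval (-(a * t)) / Q.eval 0 = weightProd W t) ∧
      ∀ t, Q.eval (-(a * t)) ≠ 0 → Q.eval (-(a * t)) = a * t * Q.derivative.eval (-(a * t)) →
        (W.map fun w => w / (1 - w * t)).sum = 1 / t := by
  have hroot : ∀ r ∈ Q.roots, Q.eval r = 0 := fun r hr => isRoot_of_mem_roots hr
  have hr0 : ∀ r ∈ Q.roots, r < 0 := fun r hr => hneg r (hroot r hr)
  obtain ⟨hd1, hd2⟩ := hQ.eval_derivatives h0.ne'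
  have hsum : (Q.roots.map fun r => -a / r).sum = 1 := by
    have h3 : (Q.roots.map fun r => -a / r).sum =
        a * (Q.roots.map fun r => ((0 : ℝ) - r)⁻¹).sum := by
      rw [← Multiset.sum_map_mul_left]
      refine congrArg _ (Multiset.map_congr rfl fun r hr => ?_)
      rw [zero_sub, inv_neg]
      ring
    rw [h3]
    rw [hd1] at h1
    apply mul_left_cancel₀ h0.ne'
    linarith
  have hpos : ∀ w ∈ Q.roots.map (fun r => -a / r), 0 ≤ w := by
    intro w hw
    obtain ⟨r, hr, rfl⟩ := Multiset.mem_map.1 hw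
    exact div_nonneg_of_nonpos (by linarith) (hr0 r hr).le
  have hle : ∀ w ∈ Q.roots.map (fun r => -a / r), w ≤ 1 := by
    intro w hw
    rw [← hsum]
    exact Multiset.single_le_sum hpos _ hw
  refine ⟨Q.roots.map fun r => -a / r, fun w hw => ⟨hpos w hw, hle w hw, ?_⟩, fun r hr => ?_,
    hsum, ?_, fun t => ?_, fun t ht hcrit => ?_⟩
  · obtain ⟨r, hr, rfl⟩ := Multiset.mem_map.1 hw
    exact ⟨r, hroot r hr, div_mul_cancel₀ _ (hr0 r hr).ne⟩
  · have hQ0 : Q ≠ 0 := by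
      rintro rfl
      simp at h0
    have h3 := hle _ (Multiset.mem_map_of_mem _ ((mem_roots hQ0).2 hr))
    rwa [div_le_one_of_neg (hneg r hr)] at h3
  · have h3 : ((Q.roots.map fun r => -a / r).map fun w => w ^ 2).sum =
        a ^ 2 * (Q.roots.map fun r => ((0 : ℝ) - r)⁻¹ ^ 2).sum := by
      rw [← Multiset.sum_map_mul_left, Multiset.map_map]
      refine congrArg _ (Multiset.map_congr rfl fun r hr => ?_)
      simp only [Function.comp_apply, zero_sub, inv_neg]
      ring
    rw [h3]
    rw [hd1] at h1
    rw [hd2] at h2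
    set σ := (Q.roots.map fun r => ((0 : ℝ) - r)⁻¹).sum
    have h4 : σ * a = 1 := by
      apply mul_left_cancel₀ h0.ne'
      linarith
    apply mul_left_cancel₀ h0.ne'
    have h5 : Q.eval 0 * ((σ * a) ^ 2) = Q.eval 0 := by rw [h4]; ring
    linarith
  · have h3 : ∀ x, Q.eval x = Q.leadingCoeff * (Q.roots.map fun r => x - r).prod :=
      fun x => hQ.eval_eq_prod_roots x
    have h4 : (Q.roots.map fun r => -(a * t) - r).prod =
        (Q.roots.map fun r => 0 - r).prod * weightProd (Q.roots.map fun r => -a / r) t := by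
      rw [weightProd, Multiset.map_map, ← Multiset.prod_map_mul]
      refine congrArg _ (Multiset.map_congr rfl fun r hr => ?_)
      have := (hr0 r hr).ne
      simp only [Function.comp_apply]
      field_simp
      ring
    rw [div_eq_iff h0.ne', h3, h4, h3 0]
    ring
  · have hd := (hQ.eval_derivatives ht).1
    have hat : a * t ≠ 0 := by
      intro h
      rw [h, zero_mul] at hcrit
      rw [h] at ht
      exact ht hcrit
    have ht0 := right_ne_zero_of_mul hat
    have h3 : ((Q.roots.map fun r => -a / r).map fun w => w / (1 - w * t)).sum =
        a * (Q.roots.map fun r => (-(a * t) - r)⁻¹).sum := by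
      rw [← Multiset.sum_map_mul_left, Multiset.map_map]
      refine congrArg _ (Multiset.map_congr rfl fun r hr => ?_)
      have h5 := (hr0 r hr).ne
      have h6 : -(a * t) - r ≠ 0 := by
        intro h
        rw [sub_eq_zero.1 h] at ht
        exact ht (hroot r hr)
      have h7 : 1 - -a / r * t = -(-(a * t) - r) / r := by
        field_simp
        ring
      simp only [Function.comp_apply]
      rw [h7]
      field_simp
    rw [h3, eq_div_iff ht0]
    rw [hd] at hcrit
    apply mul_left_cancel₀ ht
    linarith

theorem tendsto_of_oscillating {T : ℕ → ℝ[X]} {x : ℕ → ℝ} (hT : ∀ n, Oscillating (T n))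
    (hT0 : ∀ n, (T n).eval 0 = 0) (hx : ∀ n, IsHighestLocalMin (T n) (x n))
    (hstep : ∀ n, T (n + 1) = X * (T n - C ((T n).eval (x n)))) :
    ∃ lam ∈ Set.Ioo (0 : ℝ) 1, Tendsto (fun n => x (n + 1) / x n) atTop (nhds lam) ∧
      Tendsto (fun n => (-(T (n + 1)).eval (x (n + 1))) ^ 2 /
        ((-(T n).eval (x n)) * (-(T (n + 2)).eval (x (n + 2))))) atTop (nhds (1 / lam)) := by
  set v : ℕ → ℝ := fun n => -(T n).eval (x n) with hv
  have hvpos : ∀ n, 0 < v n := fun n => neg_pos.2 ((hT n).of_isLocalMin (hx n).1).2.2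
  set Q : ℕ → ℝ[X] := fun n => T n - C ((T n).eval (x n)) with hQdef
  have hTQ : ∀ n, T (n + 1) = X * Q n := hstep
  have hQT : ∀ n, Q n = T n + C (v n) := fun n => by simp [hQdef, hv, sub_eq_add_neg]
  have hQ0 : ∀ n, (Q n).eval 0 = v n := fun n => by simp [hQT, hT0]
  have hQ1 : ∀ n, (Q (n + 1)).derivative.eval 0 = v n := fun n => by
    simp [hQT (n + 1), hTQ, hQ0]
  have hQ2 : ∀ n, (Q (n + 2)).derivative.derivative.eval 0 = 2 * v n := fun n => by
    have : (Q (n + 2)).derivative.derivative.eval 0 = 2 * (Q (n + 1)).derivative.eval 0 := by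
      simp [hQT (n + 2), hTQ (n + 1)]
      ring
    rw [this, hQ1]
  set a : ℕ → ℝ := fun n => v (n + 2) / v (n + 1) with ha
  have hapos : ∀ n, 0 < a n := fun n => div_pos (hvpos _) (hvpos _)
  set q : ℕ → ℝ := fun n => v (n + 2) * v n / v (n + 1) ^ 2 with hq
  set s : ℕ → ℝ := fun n => -x (n + 3) / a n with hs
  have hxs : ∀ n, x (n + 3) = -(a n * s n) := fun n => by
    have := (hapos n).ne'
    simp only [hs]
    field_simp
  set K : ℕ → ℝ → ℝ := fun n t => (Q (n + 2)).eval (-(a n * t)) / v (n + 2) with hK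
  have hvstep : ∀ n, v (n + 3) = a n * s n * v (n + 2) * K n (s n) := fun n => by
    have h1 : v (n + 3) = -(x (n + 3) * (Q (n + 2)).eval (x (n + 3))) := by
      simp only [hv]
      rw [hTQ (n + 2)]
      simp
    have := (hvpos (n + 2)).ne'
    rw [h1, hxs n]
    simp only [hK]
    field_simp
  have hqa : ∀ n, q (n + 1) = a (n + 1) / a n := fun n => by
    have h1 := (hvpos (n + 1)).ne'
    have h2 := (hvpos (n + 2)).ne'
    simp only [hq, ha]
    field_simp
  have hqs : ∀ n, q (n + 1) = s n * K n (s n) := fun n => by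
    have h1 := (hvpos (n + 2)).ne'
    have h2 := (hapos n).ne'
    have h3 : a (n + 1) = v (n + 3) / v (n + 2) := rfl
    rw [hqa, h3, hvstep]
    field_simp
  have hKstep : ∀ n t, K (n + 1) t = 1 - t * K n (q (n + 1) * t) := fun n t => by
    have h1 := (hvpos (n + 2)).ne'
    have h2 := (hapos n).ne'
    have h3 := (hvpos (n + 3)).ne'
    have h4 : a (n + 1) = v (n + 3) / v (n + 2) := rfl
    have h5 : a n * (q (n + 1) * t) = a (n + 1) * t := by
      rw [hqa]
      field_simp
    simp only [hK]
    rw [h5, hQT (n + 2 + 1), hTQ (n + 2)]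
    simp only [eval_add, eval_mul, eval_X, eval_C]
    generalize (Q (n + 2)).eval (-(a (n + 1) * t)) = y
    rw [h4, add_div, div_self h3]
    field_simp
    ring
  have hlevel : ∀ n, 0 < s n ∧ (∀ t ∈ Set.Icc (0 : ℝ) 1, t * K n t ≤ q (n + 1)) ∧
      q (n + 1) ≤ 0.368 ∧ s n * (1 + s n * (1 - 2 * q n)) ≤ 1 ∧
      (∀ x ∈ Set.Icc (0 : ℝ) 1, ∀ y ∈ Set.Icc (0 : ℝ) 1, |K n x - K n y| ≤ |x - y|) ∧
      K n 0 = 1 ∧ (∀ t ∈ Set.Icc (0 : ℝ) 1, K n t ≤ 1 - t + t ^ 2) ∧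
      ∀ t ∈ Set.Icc (0 : ℝ) 1, K n t ≤ K n (s n) * Real.exp (1 - t / s n) := by
    intro n
    have hη := hx (n + 3)
    have hη' := (hT (n + 3)).of_isLocalMin (hx (n + 3)).1
    rw [hstep (n + 2)] at hη
    obtain ⟨ρ, hρ, hρroot, hgt, hmem, hmin⟩ := (hT (n + 2)).highest_of_step (hT0 _) (hx _) hη
    have ha0 := hapos n
    have hspos : 0 < s n := by
      have := hmem.2
      rw [hxs n] at this
      by_contra! h
      nlinarith
    have hQpos : ∀ y, -ρ < y → 0 < (Q (n + 2)).eval y := by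
      intro y hy
      simpa [hQdef] using hgt y hy
    have hQroot : ∀ r, (Q (n + 2)).eval r = 0 → r ≤ -ρ := by
      intro r hr
      by_contra! h
      linarith [hQpos r h]
    obtain ⟨W, hW, hWa, hW1, hW2, hWK, hWs⟩ := exists_weightProd_eq (q := q n)
      ((hT (n + 2)).splits_sub_C (hx (n + 2))) (fun r hr => (hQroot r hr).trans_lt (by linarith))
      ha0 (by rw [hQ0]; exact hvpos _)
      (by
        have := (hvpos (n + 1)).ne'
        rw [hQ0, hQ1]
        simp only [ha]
        field_simp)
      (by
        have := (hvpos (n + 1)).ne'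
        rw [hQ0, hQ2]
        simp only [ha, hq]
        field_simp)
    have hWK' : ∀ t, K n t = weightProd W t := by
      intro t
      rw [← hWK, hQ0]
    have haρ : a n ≤ ρ := by
      have := hWa (-ρ) (by simp [hρroot])
      linarith
    have hasρ : a n * s n < ρ := by
      have := hmem.1
      rw [hxs n] at this
      linarith
    have hws : ∀ w ∈ W, w * s n < 1 := by
      intro w hw
      obtain ⟨hw0, hw1, r, hr, hwr⟩ := hW w hw
      have := hQroot r hr
      have h3 : w * (a n * s n) < a n * 1 := by
        rcases hw0.eq_or_lt with rfl | hw0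
        · linarith
        · nlinarith
      exact lt_of_mul_lt_mul_left (by linarith) ha0.le
    have hw1 : ∀ t ∈ Set.Icc (0 : ℝ) 1, ∀ w ∈ W, w * t ≤ 1 := fun t ht w hw =>
      mul_le_one₀ (hW w hw).2.1 ht.1 ht.2
    have hcrit : (W.map fun w => w / (1 - w * s n)).sum = 1 / s n := by
      refine hWs (s n) (hQpos _ (by linarith)).ne' ?_
      have h1 := hη'.1
      rw [hTQ (n + 2), hxs n] at h1
      simp only [derivative_mul, derivative_X, eval_add, eval_mul, eval_X, one_mul] at h1
      change (Q (n + 2)).eval _ = _ * (Q (n + 2)).derivative.eval _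
      linarith
    have hKexp : ∀ t, (∀ w ∈ W, w * t ≤ 1) → K n t ≤ Real.exp (-t) := by
      intro t ht
      have := weightProd_le_mul_exp (W := W) (s := 0) (t := t) (by simp) ht
      simpa [weightProd_zero, hW1, hWK'] using this
    refine ⟨hspos, fun t ht => ?_, ?_, ?_, fun y hy z hz => ?_, ?_, fun t ht => ?_, fun t ht => ?_⟩
    · have h1 := hmin (-(a n * t)) ⟨by nlinarith [ht.1, ht.2], by nlinarith [ht.1]⟩
      rw [hxs n, eval_mul, eval_mul, eval_X, eval_X] at h1
      change _ * (Q (n + 2)).eval _ ≤ _ * (Q (n + 2)).eval _ at h1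
      rw [hqs]
      simp only [hK]
      rw [mul_div_assoc', mul_div_assoc']
      exact div_le_div_of_nonneg_right (le_of_mul_le_mul_left (by linarith) ha0) (hvpos _).le
    · rw [hqs]
      have h1 := mul_le_mul_of_nonneg_left (hKexp (s n) fun w hw => (hws w hw).le) hspos.le
      have h2 := Real.add_one_le_exp (s n - 1)
      have h3 : s n * Real.exp (-s n) ≤ Real.exp (-1) := by
        calc s n * Real.exp (-s n) ≤ Real.exp (s n - 1) * Real.exp (-s n) := by
              gcongr
              linarith
          _ = Real.exp (-1) := by
              rw [← Real.exp_add]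
              ring_nf
      have h4 := Real.exp_neg_one_lt_d9
      norm_num at h4 ⊢
      linarith
    · have := sum_add_mul_sum_sq_le (fun w hw => (hW w hw).1) hws
      rw [hW1, hW2, hcrit, le_div_iff₀ hspos] at this
      linarith
    · have := weightProd_lipschitz (fun w hw => (hW w hw).1) hy.1 hz.1 (hw1 y hy) (hw1 z hz)
      simpa [hW1, ← hWK'] using this
    · rw [hWK', weightProd_zero]
    · have h1 := hKexp t (hw1 t ht)
      have h2 := Real.abs_exp_sub_one_sub_id_le (x := -t) (by
        rw [abs_neg, abs_of_nonneg ht.1]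
        exact ht.2)
      have := (abs_le.1 h2).2
      nlinarith
    · have := weightProd_le_mul_exp hws (hw1 t ht)
      rw [hcrit] at this
      rw [hWK', hWK']
      convert this using 3
      field_simp
      ring
  choose hspos hmax hqle hsle hlip hK0 hK2 hexp using hlevel
  obtain ⟨lam, hlam, hqlim, hslim⟩ := tendsto_of_renormalised (K := fun n => K (n + 1))
    (q := fun n => q (n + 1)) (s := fun n => s (n + 1)) (fun n => hqs (n + 1))
    (fun n t => hKstep (n + 1) t) (fun n => hmax (n + 1))
    (fun n => ⟨hspos (n + 1), by
      have h1 := hsle (n + 1)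
      have h2 := hqle n
      have h3 := hspos (n + 1)
      by_contra! h
      nlinarith [mul_nonneg (sq_nonneg (s (n + 1))) (sub_nonneg.2 h2)]⟩)
    (fun n => (hqle n).trans (by norm_num)) (fun n => hlip (n + 1)) (fun n => hK0 (n + 1))
    (fun n => hK2 (n + 1)) (fun n => hexp (n + 1))
  refine ⟨lam, hlam, ?_, ?_⟩
  · rw [← tendsto_add_atTop_iff_nat 4]
    have := ((tendsto_add_atTop_iff_nat 1).2 hqlim).mul hslim
    rw [mul_one] at this
    refine this.congr fun n => ?_
    have h1 := (hapos (n + 1)).ne'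
    have h2 := (hspos (n + 1)).ne'
    change q (n + 2) * (s (n + 2) / s (n + 1)) = x (n + 5) / x (n + 4)
    rw [hxs (n + 1), hxs (n + 2), hqa (n + 1)]
    field_simp
  · rw [← tendsto_add_atTop_iff_nat 1]
    have := hqlim.inv₀ hlam.1.ne'
    rw [one_div]
    refine this.congr fun n => ?_
    simp only [hq]
    rw [inv_div, mul_comm (v (n + 1 + 2))]

theorem oscillating_of_squarefree {p : ℝ[X]} (hmonic : p.Monic) (hdeg : p.natDegree ≠ 0)
    (him : ∀ z : ℂ, aeval z p = 0 → z.im = 0) (hneg : ∀ x, p.IsRoot x → x < 0)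
    (hsq : Squarefree p) : Oscillating p := by
  have hsplit := splits_of_forall_aeval_im him
  refine ⟨hmonic, hdeg, hsplit, fun x hx => ?_, fun y hy => ?_⟩
  · rw [hsplit.eval_eq_prod_roots_of_monic hmonic]
    refine Multiset.prod_nonneg fun z hz => ?_
    obtain ⟨r, hr, rfl⟩ := Multiset.mem_map.1 hz
    linarith [hneg r (isRoot_of_mem_roots hr)]
  · have h0 : p.eval y ≠ 0 := by
      have hsep := PerfectField.separable_iff_squarefree.2 hsq
      intro h
      simpa [hy] using hsep.eval₂_derivative_ne_zero (RingHom.id ℝ) (x := y) (by simpa using h)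
    have := hsplit.laguerre hdeg h0 hy
    rcases lt_or_gt_of_ne h0 with h | h
    · exact Or.inl ⟨by nlinarith, h⟩
    · exact Or.inr ⟨by nlinarith, h.le⟩

/-- With `A_m = -S_{m-1}(ξ_{m-1})`: the quantity `A_m^2/(A_{m-1} A_{m+1})` tends to `1/λ`,
where `λ ∈ (0,1)` is the limit of `ξ_k/ξ_{k-1}` (which exists). -/
theorem stmt14 (S : ℕ → Polynomial ℝ) (ξ : ℕ → ℝ) (d : ℕ) (h : GoodSetup S ξ d) :
    ∃ lam : ℝ, lam ∈ Set.Ioo (0 : ℝ) 1 ∧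
      Tendsto (fun k : ℕ => ξ k / ξ (k - 1)) atTop (nhds lam) ∧
      Tendsto (fun m : ℕ =>
          (-(S (m - 1)).eval (ξ (m - 1))) ^ 2 /
            ((-(S (m - 2)).eval (ξ (m - 2))) * (-(S m).eval (ξ m))))
        atTop (nhds (1 / lam)) := by
  obtain ⟨hd, hmonic, hdeg, him, hneg, hsq, -, hS⟩ := h
  have hhigh : ∀ j, IsHighestLocalMin (S (j + 1)) (ξ (j + 1)) := fun j =>
    ⟨(hS (j + 1) (by omega)).1, (hS (j + 1) (by omega)).2.1⟩
  have hstep : ∀ j, S (j + 2) = X * (S (j + 1) - C ((S (j + 1)).eval (ξ (j + 1)))) := fun j =>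
    (hS (j + 1) (by omega)).2.2
  have hdeg0 : (S 1).natDegree ≠ 0 := by omega
  have hosc : ∀ j, Oscillating (S (j + 1)) := by
    intro j
    induction j with
    | zero => exact oscillating_of_squarefree hmonic hdeg0 him hneg hsq
    | succ j ih =>
      rw [hstep j]
      exact ih.step (hhigh j)
  obtain ⟨lam, hlam, h1, h2⟩ := tendsto_of_oscillating (T := fun n => S (n + 2))
    (x := fun n => ξ (n + 2)) (fun n => hosc (n + 1)) (fun n => by simp [hstep n])
    (fun n => hhigh (n + 1)) (fun n => hstep (n + 1))
  exact ⟨lam, hlam, (tendsto_add_atTop_iff_nat 3).1 h1, (tendsto_add_atTop_iff_nat 4).1 h2⟩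
end
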